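/- arXiv:math/0611387 — 3 statements merged into one kernel-verified Lean document; each statement's English description precedes it below -/
import Mathlib

section
/- For every integer d ≥ 2 and every mass distribution μ on ℝ^d, there exist a unit vector u ∈ ℝ^d, real numbers t_1 < t_2 < ... < t_{2d-2}, a unit vector v with v ≠ u and v ≠ -u, and a real number s, such that each of the 2(2d-1) = 4d-2 regions of the form {x ∈ ℝ^d : t_i < ⟨x,u⟩ < t_{i+1}} ∩ {x ∈ ℝ^d : ⟨x,v⟩ < s} and {x ∈ ℝ^d : t_i < ⟨x,u⟩ < t_{i+1}} ∩ {x ∈ ℝ^d : ⟨x,v⟩ > s} (for 0 ≤ i ≤ 2d-2, with the conventions t_0 = -∞ and t_{2d-1} = +∞) has μ-measure equal to μ(ℝ^d)/(4d-2). That is, every mass distribution in ℝ^d admits an equipartition into 4d-2 boxes by a collection of 2d-2 parallel hyperplanes and one additional non-parallel hyperplane. -/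
open MeasureTheory

/-- The open slab between consecutive parallel hyperplanes orthogonal to `u`:
for `0 ≤ i ≤ n`, the region `{x : t i < ⟪x,u⟫ < t (i+1)}`, with the conventions
`t 0 = -∞` and `t (n+1) = +∞` (i.e. the corresponding inequality is dropped). -/
noncomputable def slab {d : ℕ} (u : EuclideanSpace ℝ (Fin d)) (t : ℕ → ℝ) (n i : ℕ) :
    Set (EuclideanSpace ℝ (Fin d)) :=
  {x | (1 ≤ i → t i < (inner ℝ x u : ℝ)) ∧ (i + 1 ≤ n → (inner ℝ x u : ℝ) < t (i + 1))}

/-- The open halfspace below (`b = true`) or above (`b = false`) the hyperplane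
orthogonal to `v` at level `s`. -/
def halfSp {d : ℕ} (v : EuclideanSpace ℝ (Fin d)) (s : ℝ) (b : Bool) :
    Set (EuclideanSpace ℝ (Fin d)) :=
  if b then {x | (inner ℝ x v : ℝ) < s} else {x | s < (inner ℝ x v : ℝ)}

open MeasureTheory

namespace BU

section chains
variable {V : Type*}

/-- Ordered simplicial chains mod 2: formal sums of lists of points. -/
abbrev Ch (V : Type*) := List V →₀ ZMod 2

noncomputable def sg (l : List V) : Ch V := Finsupp.single l 1

noncomputable def cone (v : V) : Ch V →ₗ[ZMod 2] Ch V :=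
  Finsupp.lmapDomain (ZMod 2) (ZMod 2) (List.cons v)

noncomputable def act {W : Type*} (g : V → W) : Ch V →ₗ[ZMod 2] Ch W :=
  Finsupp.lmapDomain (ZMod 2) (ZMod 2) (List.map g)

noncomputable def ext {M : Type*} [AddCommGroup M] [Module (ZMod 2) M] (φ : List V → M) :
    Ch V →ₗ[ZMod 2] M := Finsupp.linearCombination (ZMod 2) φ

@[simp] lemma cone_sg (v : V) (l : List V) : cone v (sg l) = sg (v :: l) := by
  simp [cone, sg]

@[simp] lemma act_sg {W : Type*} (g : V → W) (l : List V) : act g (sg l) = sg (l.map g) := by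
  simp [act, sg]

@[simp] lemma ext_sg {M : Type*} [AddCommGroup M] [Module (ZMod 2) M] (φ : List V → M)
    (l : List V) : ext φ (sg l) = φ l := by
  simp [ext, sg]

lemma hom_ext {M : Type*} [AddCommGroup M] [Module (ZMod 2) M] {φ ψ : Ch V →ₗ[ZMod 2] M}
    (h : ∀ l, φ (sg l) = ψ (sg l)) : φ = ψ := by
  apply Finsupp.lhom_ext'
  intro l
  apply LinearMap.ext_ring
  exact h l

/-- chains supported on a predicate -/
noncomputable def supp (P : List V → Prop) : Submodule (ZMod 2) (Ch V) :=
  Submodule.span (ZMod 2) (Set.image sg {l | P l})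

lemma sg_mem {P : List V → Prop} {l : List V} (h : P l) : sg l ∈ supp P :=
  Submodule.subset_span ⟨l, h, rfl⟩

lemma supp_map {M : Type*} [AddCommGroup M] [Module (ZMod 2) M] {P : List V → Prop}
    (φ : Ch V →ₗ[ZMod 2] M) (S : Submodule (ZMod 2) M)
    (h : ∀ l, P l → φ (sg l) ∈ S) {c : Ch V} (hc : c ∈ supp P) : φ c ∈ S := by
  have : supp P ≤ S.comap φ := by
    apply Submodule.span_le.2
    rintro _ ⟨l, hl, rfl⟩
    exact h l hl
  exact this hc

lemma supp_mono {P Q : List V → Prop} (h : ∀ l, P l → Q l) : supp P ≤ supp Q :=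
  Submodule.span_mono (Set.image_mono h)

lemma supp_eq {M : Type*} [AddCommGroup M] [Module (ZMod 2) M] {P : List V → Prop}
    (φ ψ : Ch V →ₗ[ZMod 2] M)
    (h : ∀ l, P l → φ (sg l) = ψ (sg l)) {c : Ch V} (hc : c ∈ supp P) : φ c = ψ c := by
  have := supp_map (φ - ψ) ⊥ (fun l hl => by simp [h l hl]) hc
  simpa [sub_eq_zero] using this

noncomputable def del1 : List V → Ch V
  | [] => 0
  | v :: l => sg l + cone v (del1 l)

noncomputable def del : Ch V →ₗ[ZMod 2] Ch V := ext del1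

@[simp] lemma del_nil : del (sg ([] : List V)) = 0 := by simp [del, del1]

@[simp] lemma del_cons (v : V) (l : List V) :
    del (sg (v :: l)) = sg l + cone v (del (sg l)) := by simp [del, del1]

lemma del_cone (v : V) (c : Ch V) : del (cone v c) = c + cone v (del c) := by
  have : (del ∘ₗ cone v : Ch V →ₗ[ZMod 2] Ch V) = LinearMap.id + cone v ∘ₗ del :=
    hom_ext fun l => by simp
  exact LinearMap.congr_fun this c

lemma two_eq (c : Ch V) : c + c = 0 := by
  rw [← two_smul (ZMod 2) c]
  have : (2 : ZMod 2) = 0 := rfl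
  rw [this, zero_smul]

lemma del_del (c : Ch V) : del (del c) = 0 := by
  have : (del ∘ₗ del : Ch V →ₗ[ZMod 2] Ch V) = 0 := hom_ext fun l => by
    induction l with
    | nil => simp
    | cons v l ih =>
      simp only [LinearMap.comp_apply, LinearMap.zero_apply] at ih
      simp [del_cone, ih, two_eq]
  exact LinearMap.congr_fun this c

lemma act_cone {W : Type*} (g : V → W) (v : V) (c : Ch V) :
    act g (cone v c) = cone (g v) (act g c) := by
  have : (act g ∘ₗ cone v : Ch V →ₗ[ZMod 2] Ch W) = cone (g v) ∘ₗ act g :=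
    hom_ext fun l => by simp
  exact LinearMap.congr_fun this c

lemma act_del {W : Type*} (g : V → W) (c : Ch V) : act g (del c) = del (act g c) := by
  have : (act g ∘ₗ del : Ch V →ₗ[ZMod 2] Ch W) = del ∘ₗ act g := hom_ext fun l => by
    induction l with
    | nil => simp
    | cons v l ih =>
      simp only [LinearMap.comp_apply] at ih
      simp [act_cone, ih]
  exact LinearMap.congr_fun this c

lemma act_act (g h : V → V) (c : Ch V) : act g (act h c) = act (g ∘ h) c := by
  have : (act g ∘ₗ act h : Ch V →ₗ[ZMod 2] Ch V) = act (g ∘ h) := hom_ext fun l => by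
    simp
  exact LinearMap.congr_fun this c

lemma act_id (c : Ch V) : act id c = c := by
  have : (act id : Ch V →ₗ[ZMod 2] Ch V) = LinearMap.id := hom_ext fun l => by
    simp
  exact LinearMap.congr_fun this c

/-! cochains -/

def e1 : List (V → ZMod 2) → List V → ZMod 2
  | [], [_] => 1
  | [], _ => 0
  | s :: ss, p :: q :: l => (s p + s q) * e1 ss (q :: l)
  | _ :: _, _ => 0

noncomputable def ev (ss : List (V → ZMod 2)) : Ch V →ₗ[ZMod 2] ZMod 2 := ext (e1 ss)

def h1 (s : V → ZMod 2) (ss : List (V → ZMod 2)) : List V → ZMod 2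
  | [] => 0
  | p :: l => s p * e1 ss (p :: l)

noncomputable def hv (s : V → ZMod 2) (ss : List (V → ZMod 2)) : Ch V →ₗ[ZMod 2] ZMod 2 :=
  ext (h1 s ss)

@[simp] lemma ev_sg (ss : List (V → ZMod 2)) (l : List V) : ev ss (sg l) = e1 ss l := by
  simp [ev]
@[simp] lemma hv_sg (s : V → ZMod 2) (ss : List (V → ZMod 2)) (l : List V) :
    hv s ss (sg l) = h1 s ss l := by
  simp [hv]

lemma hv_cone (s : V → ZMod 2) (ss : List (V → ZMod 2)) (v : V) (c : Ch V) :
    hv s ss (cone v c) = s v * ev ss (cone v c) := by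
  have : (hv s ss ∘ₗ cone v : Ch V →ₗ[ZMod 2] ZMod 2) = s v • (ev ss ∘ₗ cone v) :=
    hom_ext fun l => by simp [h1]
  exact LinearMap.congr_fun this c

lemma e1_nil (ss : List (V → ZMod 2)) : e1 ss [] = 0 := by
  cases ss <;> simp [e1]

lemma hv_del_of (s : V → ZMod 2) (ss : List (V → ZMod 2))
    (h : ∀ c, ev ss (del c) = 0) (c : Ch V) : hv s ss (del c) = ev (s :: ss) c := by
  have : (hv s ss ∘ₗ del : Ch V →ₗ[ZMod 2] ZMod 2) = ev (s :: ss) := hom_ext fun l => by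
    match l with
    | [] => simp [e1]
    | [p] => simp [e1, h1]
    | p :: q :: l =>
      have h2 := h (sg (p :: q :: l))
      rw [del_cons, map_add] at h2
      have h3 : ev ss (cone p (del (sg (q :: l)))) = e1 ss (q :: l) := by
        rw [ev_sg] at h2
        have := CharTwo.add_eq_zero.1 h2
        exact this.symm
      rw [LinearMap.comp_apply, del_cons, map_add, hv_cone, h3]
      simp [e1, h1]
      ring
  exact LinearMap.congr_fun this c

lemma ev_del (ss : List (V → ZMod 2)) : ∀ c, ev ss (del c) = 0 := by
  induction ss with
  | nil =>
    intro c
    have : (ev [] ∘ₗ del : Ch V →ₗ[ZMod 2] ZMod 2) = 0 := hom_ext fun l => by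
      match l with
      | [] => simp
      | [p] => simp [e1]
      | [p, q] => 
        simp [e1]
        rfl
      | p :: q :: r :: l =>
        have : ∀ (x y : V) (c : Ch V), ev [] (cone x (cone y c)) = 0 := by
          intro x y c
          have : (ev [] ∘ₗ cone x ∘ₗ cone y : Ch V →ₗ[ZMod 2] ZMod 2) = 0 :=
            hom_ext fun l => by simp [e1]
          exact LinearMap.congr_fun this c
        simp [e1, this]
    exact LinearMap.congr_fun this c
  | cons s ss ih =>
    intro c
    rw [← hv_del_of s ss ih, del_del, map_zero]

lemma hv_del (s : V → ZMod 2) (ss : List (V → ZMod 2)) (c : Ch V) :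
    hv s ss (del c) = ev (s :: ss) c := hv_del_of s ss (ev_del ss) c

lemma e1_const (ss : List (V → ZMod 2)) (l : List V)
    (h : ∃ s ∈ ss, ∀ p ∈ l, ∀ q ∈ l, s p = s q) : e1 ss l = 0 := by
  induction ss generalizing l with
  | nil => simp at h
  | cons s ss ih =>
    match l with
    | [] => simp [e1]
    | [p] => simp [e1]
    | p :: q :: l =>
      obtain ⟨s', hs', h⟩ := h
      simp only [e1]
      rcases List.mem_cons.1 hs' with rfl | hs'
      · rw [h p (by simp) q (by simp), CharTwo.add_self_eq_zero, zero_mul]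
      · rw [ih (q :: l) ⟨s', hs', fun a ha b hb => h a (by simp_all) b (by simp_all)⟩, mul_zero]

/-- `s` is twisted by the constant `χ` under `g`, on points of `K`. -/
def Tw (K : Set V) (g : V → V) (χ : ZMod 2) (s : V → ZMod 2) : Prop :=
  ∀ p ∈ K, s (g p) = s p + χ

lemma e1_inv (K : Set V) (g : V → V) (ss : List (V → ZMod 2))
    (h : ∀ s ∈ ss, ∃ χ, Tw K g χ s) (l : List V) (hl : ∀ p ∈ l, p ∈ K) :
    e1 ss (l.map g) = e1 ss l := by
  induction ss generalizing l with
  | nil => 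
    match l with
    | [] => simp
    | [p] => simp [e1]
    | p :: q :: l => simp [e1]
  | cons s ss ih =>
    match l with
    | [] => simp
    | [p] => simp [e1]
    | p :: q :: l =>
      obtain ⟨χ, hχ⟩ := h s (by simp)
      have := ih (fun s hs => h s (by simp [hs])) (q :: l) (fun p hp => hl p (by simp_all))
      simp only [List.map_cons, e1] at this ⊢
      rw [this, hχ p (hl p (by simp)), hχ q (hl q (by simp))]
      congr 1
      linear_combination CharTwo.add_self_eq_zero χ

lemma h_tw (K : Set V) (g : V → V) (s : V → ZMod 2) (ss : List (V → ZMod 2)) (χ : ZMod 2)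
    (hs : Tw K g χ s)
    (h : ∀ s ∈ ss, ∃ χ, Tw K g χ s) {c : Ch V} (hc : c ∈ supp (fun l => ∀ p ∈ l, p ∈ K)) :
    hv s ss (c + act g c) = χ * ev ss c := by
  have := supp_eq (hv s ss ∘ₗ (LinearMap.id + act g)) (χ • ev ss) (fun l hl => by
    cases l with
    | nil => simp [h1, e1_nil]
    | cons p l =>
      have h2 := e1_inv K g ss h (p :: l) hl
      simp only [List.map_cons] at h2
      simp [h1, h2, hs p (hl p (by simp))]
      linear_combination e1 ss (p :: l) * CharTwo.add_self_eq_zero (s p)) hc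
  simpa using this

end chains
end BU
open MeasureTheory

namespace BU

section sd
variable {V : Type*} [NormedAddCommGroup V] [NormedSpace ℝ V]

noncomputable def bary (l : List V) : V := (l.length : ℝ)⁻¹ • l.sum

noncomputable def Sd : ℕ → Ch V →ₗ[ZMod 2] Ch V
  | 0 => LinearMap.id
  | n + 1 => ext (fun l => cone (bary l) (Sd n (del (sg l))))

lemma Sd_succ (n : ℕ) (l : List V) :
    Sd (n + 1) (sg l) = cone (bary l) (Sd n (del (sg l))) := by simp [Sd]

lemma del_Sd (n : ℕ) (c : Ch V) : del (Sd (n + 1) c) = Sd n (del c) := by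
  have : (del ∘ₗ Sd (n + 1) : Ch V →ₗ[ZMod 2] Ch V) = Sd n ∘ₗ del := by
    induction n with
    | zero =>
      refine hom_ext fun l => ?_
      simp only [LinearMap.comp_apply, Sd_succ, del_cone]
      simp [Sd, del_del]
    | succ n ih =>
      refine hom_ext fun l => ?_
      have := LinearMap.congr_fun ih (del (sg l))
      simp only [LinearMap.comp_apply, del_del, map_zero] at this
      simp only [LinearMap.comp_apply, Sd_succ, del_cone, this]
      simp
  exact LinearMap.congr_fun this c

lemma act_Sd (g : V →ₗ[ℝ] V) (n : ℕ) (c : Ch V) : act g (Sd n c) = Sd n (act g c) := by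
  have : (act g ∘ₗ Sd n : Ch V →ₗ[ZMod 2] Ch V) = Sd n ∘ₗ act g := by
    induction n with
    | zero =>
      refine hom_ext fun l => ?_
      simp [Sd]
    | succ n ih =>
      refine hom_ext fun l => ?_
      have := LinearMap.congr_fun ih (del (sg l))
      simp only [LinearMap.comp_apply] at this
      have hb : g (bary l) = bary (l.map g) := by
        simp [bary, map_list_sum]
      simp only [LinearMap.comp_apply, Sd_succ, act_cone, this, act_del, act_sg, hb]
  exact LinearMap.congr_fun this c

lemma del_supp (l : List V) (n : ℕ) (hl : l.length = n + 1) :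
    del (sg l) ∈ supp (fun l' : List V => l'.length = n ∧ ∀ p ∈ l', p ∈ l) := by
  induction l generalizing n with
  | nil => simp at hl
  | cons v l ih =>
    rw [del_cons]
    simp only [List.length_cons, Nat.add_right_cancel_iff] at hl
    refine add_mem (sg_mem ⟨hl, fun p hp => by simp [hp]⟩) ?_
    cases n with
    | zero =>
      have : l = [] := List.length_eq_zero_iff.1 hl
      subst this
      simp
    | succ n =>
      refine supp_map _ _ ?_ (ih n hl)
      rintro l' ⟨h1, h2⟩
      rw [cone_sg]
      refine sg_mem ⟨by simp [h1], ?_⟩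
      intro p hp
      rcases List.mem_cons.1 hp with rfl | hp
      · simp
      · simp [h2 p hp]

lemma bary_dist (l : List V) (D : ℝ) (M : ℕ) (hD : 0 ≤ D) (hM : l.length ≤ M + 1)
    (h : ∀ p ∈ l, ∀ q ∈ l, dist p q ≤ D) (v : V) (hv : v ∈ l) :
    dist v (bary l) ≤ (M / (M + 1) : ℝ) * D := by
  classical
  have hpos : 0 < l.length := List.length_pos_of_mem hv
  have hperm := List.perm_cons_erase hv
  have hlen : (l.erase v).length + 1 = l.length := by
    rw [List.length_erase_of_mem hv]; omega
  have hl0 : (l.length : ℝ) ≠ 0 := by positivity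
  have hsum : l.sum = v + (l.erase v).sum := by
    rw [hperm.sum_eq]; simp
  have key : ∀ l' : List V, (∀ q ∈ l', dist v q ≤ D) →
      ‖(l'.length : ℝ) • v - l'.sum‖ ≤ l'.length * D := by
    intro l'
    induction l' with
    | nil => simp
    | cons q l' ih =>
      intro h'
      have h1 := ih (fun q hq => h' q (by simp [hq]))
      have h2 := h' q (by simp)
      rw [dist_eq_norm] at h2
      have : ((q :: l').length : ℝ) • v - (q :: l').sum = (v - q) + ((l'.length : ℝ) • v - l'.sum) := by
        simp only [List.length_cons, List.sum_cons, Nat.cast_add, Nat.cast_one, add_smul, one_smul]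
        abel
      rw [this]
      refine (norm_add_le _ _).trans ?_
      simp only [List.length_cons, Nat.cast_add, Nat.cast_one]
      linarith
  have h1 := key (l.erase v) (fun q hq => h v hv q (List.mem_of_mem_erase hq))
  have h2 : v - bary l = (l.length : ℝ)⁻¹ • (((l.erase v).length : ℝ) • v - (l.erase v).sum) := by
    have h3 : (l.length : ℝ) = (l.erase v).length + 1 := by exact_mod_cast hlen.symm
    have h4 : ((l.erase v).length : ℝ) • v - (l.erase v).sum = (l.length : ℝ) • v - l.sum := by
      rw [h3, hsum, add_smul, one_smul]; abel
    rw [h4, smul_sub, smul_smul, inv_mul_cancel₀ hl0, one_smul, bary]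
  rw [dist_eq_norm, h2, norm_smul, norm_inv, Real.norm_natCast]
  have h3 : (l.length : ℝ) = (l.erase v).length + 1 := by exact_mod_cast hlen.symm
  have h5 : ((l.erase v).length : ℝ) ≤ M := by
    have : (l.erase v).length ≤ M := by omega
    exact_mod_cast this
  have h6 : (l.length : ℝ)⁻¹ * ‖((l.erase v).length : ℝ) • v - (l.erase v).sum‖
      ≤ (l.length : ℝ)⁻¹ * ((l.erase v).length * D) := by gcongr
  refine h6.trans ?_
  rw [← mul_assoc]
  refine mul_le_mul_of_nonneg_right ?_ hD
  rw [h3, inv_mul_eq_div, div_le_div_iff₀ (by positivity) (by positivity)]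
  nlinarith

lemma bary_mem (l : List V) (hl : l ≠ []) : bary l ∈ convexHull ℝ {p | p ∈ l} := by
  have hl0 : (l.length : ℝ) ≠ 0 := by
    simpa using hl
  have key : ∀ l' : List V, l' ≠ [] → (∀ p ∈ l', p ∈ l) →
      ∃ b ∈ convexHull ℝ {p | p ∈ l}, l'.sum = (l'.length : ℝ) • b := by
    intro l'
    induction l' with
    | nil => simp
    | cons q l' ih =>
      intro _ h
      by_cases h0 : l' = []
      · subst h0
        exact ⟨q, subset_convexHull _ _ (h q (by simp)), by simp⟩
      · obtain ⟨b, hb, hs⟩ := ih h0 (fun p hp => h p (by simp [hp]))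
        have hq : q ∈ convexHull ℝ {p | p ∈ l} := subset_convexHull _ _ (h q (by simp))
        have hn : (0 : ℝ) < l'.length + 1 := by positivity
        refine ⟨(1 / (l'.length + 1 : ℝ)) • q + ((l'.length : ℝ) / (l'.length + 1)) • b,
          (convex_convexHull ℝ _) hq hb (by positivity) (by positivity) (by field_simp; ring), ?_⟩
        simp only [List.sum_cons, List.length_cons, Nat.cast_add, Nat.cast_one, smul_add, smul_smul, hs]
        congr 1
        · rw [mul_one_div_cancel hn.ne', one_smul]
        · rw [mul_div_cancel₀ _ hn.ne']
  obtain ⟨b, hb, hs⟩ := key l hl (fun p hp => hp)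
  rw [bary, hs, smul_smul, inv_mul_cancel₀ hl0, one_smul]
  exact hb

lemma Sd_mesh (M : ℕ) (D : ℝ) (hD : 0 ≤ D) (n : ℕ) (hn : n ≤ M + 1) (l : List V)
    (hl : l.length = n) (h : ∀ p ∈ l, ∀ q ∈ l, dist p q ≤ D) :
    Sd n (sg l) ∈ supp (fun l' : List V => l'.length = n ∧
      (∀ p ∈ l', p ∈ convexHull ℝ {p | p ∈ l}) ∧
      ∀ p ∈ l', ∀ q ∈ l', dist p q ≤ (M / (M + 1) : ℝ) * D) := by
  induction n generalizing l with
  | zero =>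
    have : l = [] := List.length_eq_zero_iff.1 hl
    subst this
    exact sg_mem (by simp)
  | succ n ih =>
    have hne : l ≠ [] := by rintro rfl; simp at hl
    rw [Sd_succ]
    have h1 : Sd n (del (sg l)) ∈ supp (fun l' : List V => l'.length = n ∧
      (∀ p ∈ l', p ∈ convexHull ℝ {p | p ∈ l}) ∧
      ∀ p ∈ l', ∀ q ∈ l', dist p q ≤ (M / (M + 1) : ℝ) * D) := by
      refine supp_map _ _ ?_ (del_supp l n hl)
      rintro l' ⟨h1, h2⟩
      refine supp_mono ?_ (ih (by omega) l' h1 (fun p hp q hq => h p (h2 p hp) q (h2 q hq)))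
      rintro l'' ⟨h3, h4, h5⟩
      exact ⟨h3, fun p hp => convexHull_mono (fun x hx => h2 x hx) (h4 p hp), h5⟩
    refine supp_map _ _ ?_ h1
    rintro l' ⟨h2, h3, h4⟩
    rw [cone_sg]
    have hball : convexHull ℝ {p | p ∈ l} ⊆ Metric.closedBall (bary l) ((M / (M + 1) : ℝ) * D) := by
      refine convexHull_min ?_ (convex_closedBall _ _)
      intro v hv
      exact bary_dist l D M hD (by omega) h v hv
    have hb : ∀ q ∈ l', dist q (bary l) ≤ (M / (M + 1) : ℝ) * D := fun q hq => hball (h3 q hq)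
    refine sg_mem ⟨by simp [h2], ?_, ?_⟩
    · intro p hp
      rcases List.mem_cons.1 hp with rfl | hp
      · exact bary_mem l hne
      · exact h3 p hp
    · intro p hp q hq
      rcases List.mem_cons.1 hp with rfl | hp <;> rcases List.mem_cons.1 hq with rfl | hq
      · rw [dist_self]; positivity
      · rw [dist_comm]; exact hb q hq
      · exact hb p hp
      · exact h4 p hp q hq

/-- lists of `n` points in a common convex subset of `K` with mesh at most `D` -/
def Good (K : Set V) (n : ℕ) (D : ℝ) (l : List V) : Prop :=
  l.length = n ∧ (∃ C ⊆ K, Convex ℝ C ∧ ∀ p ∈ l, p ∈ C) ∧ ∀ p ∈ l, ∀ q ∈ l, dist p q ≤ D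

lemma Sd_good (K : Set V) (M n : ℕ) (hn : n ≤ M + 1) (D : ℝ) (hD : 0 ≤ D) (c : Ch V)
    (hc : c ∈ supp (Good K n D)) : Sd n c ∈ supp (Good K n ((M / (M + 1) : ℝ) * D)) := by
  refine supp_map _ _ ?_ hc
  rintro l ⟨h1, ⟨C, hCK, hC, hlC⟩, h3⟩
  refine supp_mono ?_ (Sd_mesh M D hD n hn l h1 h3)
  rintro l' ⟨h4, h5, h6⟩
  exact ⟨h4, ⟨C, hCK, hC, fun p hp => convexHull_min (fun x hx => hlC x hx) hC (h5 p hp)⟩, h6⟩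

lemma Sd_iter_good (K : Set V) (M n : ℕ) (hn : n ≤ M + 1) (D : ℝ) (hD : 0 ≤ D) (c : Ch V)
    (hc : c ∈ supp (Good K n D)) (N : ℕ) :
    (Sd n)^[N] c ∈ supp (Good K n ((M / (M + 1) : ℝ) ^ N * D)) := by
  induction N with
  | zero => simpa using hc
  | succ N ih =>
    rw [Function.iterate_succ_apply']
    have := Sd_good K M n hn _ (by positivity) _ ih
    rw [pow_succ', mul_assoc]
    exact this

end sd
end BU
open MeasureTheory

namespace BU

section prod
variable {A B : ℕ}

abbrev VV (A B : ℕ) := (Fin A → ℝ) × (Fin B → ℝ)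

noncomputable def ga : VV A B →ₗ[ℝ] VV A B := LinearMap.prodMap (-LinearMap.id) LinearMap.id
noncomputable def gb : VV A B →ₗ[ℝ] VV A B := LinearMap.prodMap LinearMap.id (-LinearMap.id)

@[simp] lemma ga_apply (p : VV A B) : ga p = (-p.1, p.2) := rfl
@[simp] lemma gb_apply (p : VV A B) : gb p = (p.1, -p.2) := rfl

def ee (A i : ℕ) : Fin A → ℝ := fun p => if p.val = i then 1 else 0

noncomputable def opa (c : Ch (VV A B)) : Ch (VV A B) := c + act ga c
noncomputable def opb (c : Ch (VV A B)) : Ch (VV A B) := c + act gb c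

lemma ga_ga (c : Ch (VV A B)) : act ga (act ga c) = c := by
  rw [act_act]
  conv_rhs => rw [← act_id c]
  congr 2
  funext p; simp
lemma gb_gb (c : Ch (VV A B)) : act gb (act gb c) = c := by
  rw [act_act]
  conv_rhs => rw [← act_id c]
  congr 2
  funext p; simp
lemma ga_gb (c : Ch (VV A B)) : act ga (act gb c) = act gb (act ga c) := by
  rw [act_act, act_act]
  congr 2

lemma opa_opa (c : Ch (VV A B)) : opa (opa c) = 0 := by
  simp only [opa, map_add, ga_ga]
  rw [add_comm (act ga c) c, two_eq]
lemma opb_opb (c : Ch (VV A B)) : opb (opb c) = 0 := by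
  simp only [opb, map_add, gb_gb]
  rw [add_comm (act gb c) c, two_eq]
lemma opa_opb (c : Ch (VV A B)) : opa (opb c) = opb (opa c) := by
  simp only [opb, opa, map_add, ga_gb]
  abel
lemma del_opa (c : Ch (VV A B)) : del (opa c) = opa (del c) := by
  simp only [opa, map_add, act_del]
lemma del_opb (c : Ch (VV A B)) : del (opb c) = opb (del c) := by
  simp only [opb, map_add, act_del]
lemma opa_add (c c' : Ch (VV A B)) : opa (c + c') = opa c + opa c' := by
  simp only [opa, map_add]; abel
lemma opb_add (c c' : Ch (VV A B)) : opb (c + c') = opb c + opb c' := by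
  simp only [opb, map_add]; abel

variable (A B) in
noncomputable def zz : ℕ → ℕ → Ch (VV A B)
  | 0, 0 => sg [(ee A 0, ee B 0)]
  | i + 1, 0 => cone (ee A (i + 1), ee B 0) (opa (zz i 0))
  | 0, j + 1 => cone (ee A 0, ee B (j + 1)) (opb (zz 0 j))
  | i + 1, j + 1 => cone (ee A (i + 1), ee B (j + 1)) (opa (zz i (j + 1)) + opb (zz (i + 1) j))

lemma zz_0 : zz A B 0 0 = sg [(ee A 0, ee B 0)] := by simp [zz]
lemma zz_x (i : ℕ) : zz A B (i + 1) 0 = cone (ee A (i + 1), ee B 0) (opa (zz A B i 0)) := by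
  rw [zz]
lemma zz_y (j : ℕ) : zz A B 0 (j + 1) = cone (ee A 0, ee B (j + 1)) (opb (zz A B 0 j)) := by
  rw [zz]
lemma zz_xy (i j : ℕ) : zz A B (i + 1) (j + 1) =
    cone (ee A (i + 1), ee B (j + 1)) (opa (zz A B i (j + 1)) + opb (zz A B (i + 1) j)) := by
  rw [zz]

lemma del_x (i : ℕ) : del (zz A B (i + 1) 0) = opa (zz A B i 0) := by
  induction i with
  | zero =>
    rw [zz_x, del_cone, del_opa]
    simp [zz_0, opa, two_eq]
  | succ i ih =>
    rw [zz_x, del_cone, del_opa, ih, opa_opa, map_zero, add_zero]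

lemma del_y (j : ℕ) : del (zz A B 0 (j + 1)) = opb (zz A B 0 j) := by
  induction j with
  | zero =>
    rw [zz_y, del_cone, del_opb]
    simp [zz_0, opb, two_eq]
  | succ i ih =>
    rw [zz_y, del_cone, del_opb, ih, opb_opb, map_zero, add_zero]

lemma del_xy (i j : ℕ) : del (zz A B (i + 1) (j + 1)) =
    opa (zz A B i (j + 1)) + opb (zz A B (i + 1) j) := by
  suffices h : del (opa (zz A B i (j + 1)) + opb (zz A B (i + 1) j)) = 0 by
    rw [zz_xy, del_cone, h, map_zero, add_zero]
  induction i generalizing j with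
  | zero =>
    induction j with
    | zero =>
      rw [map_add, del_opa, del_opb, del_x, del_y, opa_opb, two_eq]
    | succ j ihj =>
      have h1 : del (zz A B (0 + 1) (j + 1)) = opa (zz A B 0 (j + 1)) + opb (zz A B (0 + 1) j) := by
        rw [zz_xy, del_cone, ihj, map_zero, add_zero]
      rw [map_add, del_opa, del_opb, del_y, h1, opb_add, opb_opb, add_zero, opa_opb,
        two_eq]
  | succ i ihi =>
    have h0 : ∀ j, del (zz A B (i + 1) (j + 1)) =
        opa (zz A B i (j + 1)) + opb (zz A B (i + 1) j) := fun j => by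
      rw [zz_xy, del_cone, ihi j, map_zero, add_zero]
    induction j with
    | zero =>
      rw [map_add, del_opa, del_opb, del_x, h0, opa_add, opa_opa, zero_add, opa_opb, two_eq]
    | succ j ihj =>
      have h1 : del (zz A B (i + 1 + 1) (j + 1)) =
          opa (zz A B (i + 1) (j + 1)) + opb (zz A B (i + 1 + 1) j) := by
        rw [zz_xy, del_cone, ihj, map_zero, add_zero]
      rw [map_add, del_opa, del_opb, h0, h1, opb_add, opb_opb, add_zero, opa_add, opa_opa,
        zero_add, opa_opb, two_eq]

/-! supports -/

def R0 (A i : ℕ) (σ : Fin A → ℝ) (l : List (Fin A → ℝ)) : Prop :=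
  (∀ p, σ p = 1 ∨ σ p = -1) ∧ ∀ x ∈ l, (∀ p, 0 ≤ σ p * x p) ∧ ∑ p, σ p * x p = 1 ∧
    ∀ p, i < p.val → x p = 0

def R (A i : ℕ) (l : List (Fin A → ℝ)) : Prop :=
  ∃ σ, R0 A i σ l ∧ ∀ p, p.val = i → σ p = 1

lemma R_sing (A i : ℕ) (hi : i < A) : R A i [ee A i] := by
  refine ⟨fun _ => 1, ⟨fun p => Or.inl rfl, ?_⟩, fun _ _ => rfl⟩
  intro x hx
  rw [List.mem_singleton] at hx
  subst hx
  refine ⟨?_, ?_, ?_⟩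
  · intro p; unfold ee; split_ifs <;> simp
  · simp only [ee, one_mul]
    rw [Finset.sum_eq_single (⟨i, hi⟩ : Fin A)]
    · simp
    · intro b _ hb
      rw [if_neg]
      intro h; apply hb; ext; exact h
    · simp
  · intro p hp
    simp [ee, hp.ne']

lemma R_cons (A i : ℕ) (hi : i < A) (l) (h : R A i l) : R A i (ee A i :: l) := by
  obtain ⟨σ, ⟨h1, h2⟩, h3⟩ := h
  refine ⟨σ, ⟨h1, ?_⟩, h3⟩
  intro x hx
  rcases List.mem_cons.1 hx with rfl | hx
  · refine ⟨?_, ?_, ?_⟩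
    · intro p; unfold ee; split_ifs with h
      · rw [h3 p h]; norm_num
      · simp
    · rw [Finset.sum_eq_single (⟨i, hi⟩ : Fin A)]
      · simp [ee, h3 ⟨i, hi⟩ rfl]
      · intro b _ hb
        simp only [ee]
        rw [if_neg, mul_zero]
        intro h; apply hb; ext; exact h
      · simp
    · intro p hp
      simp [ee, hp.ne']
  · exact h2 x hx

lemma R_up (A i : ℕ) (σ) (l) (h : R0 A i σ l) : R A (i + 1) l := by
  obtain ⟨h1, h2⟩ := h
  refine ⟨fun p => if p.val = i + 1 then 1 else σ p, ⟨?_, ?_⟩, fun p hp => by simp [hp]⟩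
  · intro p
    dsimp only
    split_ifs
    · simp
    · exact h1 p
  · intro x hx
    obtain ⟨h3, h4, h5⟩ := h2 x hx
    have : ∀ p : Fin A, (if p.val = i + 1 then 1 else σ p) * x p = σ p * x p := by
      intro p
      split_ifs with h
      · rw [h5 p (by omega)]; simp
      · rfl
    refine ⟨?_, ?_, ?_⟩
    · intro p; rw [this]; exact h3 p
    · rw [Finset.sum_congr rfl (fun p _ => this p)]; exact h4
    · intro p hp; exact h5 p (by omega)

lemma R_neg (A i : ℕ) (σ) (l : List (Fin A → ℝ)) (h : R0 A i σ l) :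
    R0 A i (-σ) (l.map (fun x => -x)) := by
  obtain ⟨h1, h2⟩ := h
  refine ⟨?_, ?_⟩
  · intro p
    rcases h1 p with h | h <;> simp [h]
  · intro x hx
    obtain ⟨y, hy, rfl⟩ := List.mem_map.1 hx
    obtain ⟨h3, h4, h5⟩ := h2 y hy
    refine ⟨?_, ?_, ?_⟩
    · intro p; simpa using h3 p
    · simpa using h4
    · intro p hp; simp [h5 p hp]

def Q (i j : ℕ) (l : List (VV A B)) : Prop :=
  l.length = i + j + 1 ∧ R A i (l.map Prod.fst) ∧ R B j (l.map Prod.snd)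

lemma opa_Q {i j : ℕ} (hi : i + 1 < A) (hj : j < B) (c : Ch (VV A B))
    (hc : c ∈ supp (Q i j)) : cone (ee A (i + 1), ee B j) (opa c) ∈ supp (Q (A := A) (B := B) (i + 1) j) := by
  have := supp_map ((cone (ee A (i + 1), ee B j)) ∘ₗ (LinearMap.id + act ga))
    (supp (Q (A := A) (B := B) (i + 1) j)) ?_ hc
  · simpa [opa] using this
  rintro l ⟨h1, ⟨σ, h2, h2'⟩, h3⟩
  simp only [LinearMap.comp_apply, LinearMap.add_apply, LinearMap.id_apply, map_add, act_sg, cone_sg]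
  refine add_mem (sg_mem ⟨?_, ?_, ?_⟩) (sg_mem ⟨?_, ?_, ?_⟩)
  · simp [h1]; omega
  · exact R_cons _ _ hi _ (R_up _ _ _ _ h2)
  · exact R_cons _ _ hj _ h3
  · simp [h1]; omega
  · have := R_cons _ _ hi _ (R_up _ _ _ _ (R_neg _ _ _ _ h2))
    simpa [Function.comp_def] using this
  · have := R_cons _ _ hj _ h3
    simpa [Function.comp_def] using this

lemma opb_Q {i j : ℕ} (hi : i < A) (hj : j + 1 < B) (c : Ch (VV A B))
    (hc : c ∈ supp (Q i j)) : cone (ee A i, ee B (j + 1)) (opb c) ∈ supp (Q (A := A) (B := B) i (j + 1)) := by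
  have := supp_map ((cone (ee A i, ee B (j + 1))) ∘ₗ (LinearMap.id + act gb))
    (supp (Q (A := A) (B := B) i (j + 1))) ?_ hc
  · simpa [opb] using this
  rintro l ⟨h1, h3, ⟨σ, h2, h2'⟩⟩
  simp only [LinearMap.comp_apply, LinearMap.add_apply, LinearMap.id_apply, map_add, act_sg, cone_sg]
  refine add_mem (sg_mem ⟨?_, ?_, ?_⟩) (sg_mem ⟨?_, ?_, ?_⟩)
  · simp [h1]; omega
  · exact R_cons _ _ hi _ h3
  · exact R_cons _ _ hj _ (R_up _ _ _ _ h2)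
  · simp [h1]; omega
  · have := R_cons _ _ hi _ h3
    simpa [Function.comp_def] using this
  · have := R_cons _ _ hj _ (R_up _ _ _ _ (R_neg _ _ _ _ h2))
    simpa [Function.comp_def] using this

lemma zz_Q (i j : ℕ) (hi : i < A) (hj : j < B) : zz A B i j ∈ supp (Q (A := A) (B := B) i j) := by
  induction i generalizing j with
  | zero =>
    induction j with
    | zero => rw [zz_0]; exact sg_mem ⟨by simp, R_sing _ _ hi, R_sing _ _ hj⟩
    | succ j ih => rw [zz_y]; exact opb_Q hi hj _ (ih (by omega))
  | succ i ihi =>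
    induction j with
    | zero => rw [zz_x]; exact opa_Q hi hj _ (ihi 0 (by omega) hj)
    | succ j ihj =>
      rw [zz_xy, map_add]
      exact add_mem (opa_Q hi hj _ (ihi _ (by omega) hj)) (opb_Q hi hj _ (ihj (by omega)))

variable (A B) in
def KK : Set (VV A B) := {p | ∑ i, |p.1 i| = 1 ∧ ∑ i, |p.2 i| = 1}

lemma sphere_conv (A i : ℕ) (l : List (Fin A → ℝ)) (h : R A i l) :
    ∃ C : Set (Fin A → ℝ), C ⊆ {x | ∑ i, |x i| = 1} ∧ Convex ℝ C ∧ ∀ x ∈ l, x ∈ C := by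
  obtain ⟨σ, ⟨h1, h2⟩, -⟩ := h
  refine ⟨{x | (∀ p, 0 ≤ σ p * x p) ∧ ∑ p, σ p * x p = 1}, ?_, ?_, fun x hx => ⟨(h2 x hx).1, (h2 x hx).2.1⟩⟩
  · rintro x ⟨h3, h4⟩
    simp only [Set.mem_ofPred_eq]
    rw [← h4]
    refine Finset.sum_congr rfl fun p _ => ?_
    rw [← abs_of_nonneg (h3 p), abs_mul]
    rcases h1 p with h | h <;> simp [h]
  · rintro x ⟨h3, h4⟩ y ⟨h5, h6⟩ s t hs ht hst
    refine ⟨?_, ?_⟩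
    · intro p
      have : σ p * (s • x + t • y) p = s * (σ p * x p) + t * (σ p * y p) := by
        simp; ring
      rw [this]
      have := h3 p; have := h5 p
      positivity
    · have : ∀ p, σ p * (s • x + t • y) p = s * (σ p * x p) + t * (σ p * y p) := by
        intro p; simp; ring
      rw [Finset.sum_congr rfl (fun p _ => this p), Finset.sum_add_distrib, ← Finset.mul_sum,
        ← Finset.mul_sum, h4, h6]
      simpa using hst

lemma KK_bdd : KK A B ⊆ Metric.closedBall 0 1 := by
  have key : ∀ (n : ℕ) (x : Fin n → ℝ), ∑ i, |x i| = 1 → ‖x‖ ≤ 1 := by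
    intro n x hx
    rw [pi_norm_le_iff_of_nonneg zero_le_one]
    intro i
    rw [← hx, Real.norm_eq_abs]
    exact Finset.single_le_sum (f := fun i => |x i|) (fun i _ => abs_nonneg _) (Finset.mem_univ i)
  rintro ⟨x, y⟩ ⟨h1, h2⟩
  simp only [Metric.mem_closedBall, dist_zero_right]
  exact max_le (key _ _ h1) (key _ _ h2)

lemma KK_compact : IsCompact (KK A B) := by
  refine Metric.isCompact_of_isClosed_isBounded ?_ (Metric.isBounded_closedBall.subset KK_bdd)
  refine IsClosed.inter (isClosed_eq ?_ continuous_const) (isClosed_eq ?_ continuous_const) <;> fun_prop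

lemma zz_good (i j : ℕ) (hi : i < A) (hj : j < B) : zz A B i j ∈ supp (Good (KK A B) (i + j + 1) 2) := by
  refine supp_mono ?_ (zz_Q i j hi hj)
  rintro l ⟨h1, h2, h3⟩
  obtain ⟨C, hC, hCc, hCl⟩ := sphere_conv _ _ _ h2
  obtain ⟨C', hC', hCc', hCl'⟩ := sphere_conv _ _ _ h3
  have hm : ∀ p ∈ l, p ∈ C ×ˢ C' := fun p hp =>
    ⟨hCl _ (List.mem_map_of_mem hp), hCl' _ (List.mem_map_of_mem hp)⟩
  have hK : C ×ˢ C' ⊆ KK A B := fun p hp => ⟨hC hp.1, hC' hp.2⟩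
  refine ⟨h1, ⟨C ×ˢ C', hK, hCc.prod hCc', hm⟩, ?_⟩
  intro p hp q hq
  have h4 := KK_bdd (hK (hm p hp))
  have h5 := KK_bdd (hK (hm q hq))
  rw [Metric.mem_closedBall] at h4 h5
  have := dist_triangle_right p q 0
  linarith

variable (A B) in
noncomputable def ZN (N i j : ℕ) : Ch (VV A B) := (Sd (i + j + 1))^[N] (zz A B i j)

lemma del_iter (N n : ℕ) (c : Ch (VV A B)) :
    del ((Sd (n + 1))^[N] c) = (Sd n)^[N] (del c) := by
  induction N generalizing c with
  | zero => simp
  | succ N ih => rw [Function.iterate_succ_apply, Function.iterate_succ_apply, ih, del_Sd]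

lemma opa_iter (N n : ℕ) (c : Ch (VV A B)) :
    (Sd n)^[N] (opa c) = opa ((Sd n)^[N] c) := by
  induction N generalizing c with
  | zero => simp
  | succ N ih =>
    rw [Function.iterate_succ_apply, Function.iterate_succ_apply, ← ih]
    simp only [opa, map_add, act_Sd]

lemma opb_iter (N n : ℕ) (c : Ch (VV A B)) :
    (Sd n)^[N] (opb c) = opb ((Sd n)^[N] c) := by
  induction N generalizing c with
  | zero => simp
  | succ N ih =>
    rw [Function.iterate_succ_apply, Function.iterate_succ_apply, ← ih]
    simp only [opb, map_add, act_Sd]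

lemma Zdel_x (N i : ℕ) : del (ZN A B N (i + 1) 0) = opa (ZN A B N i 0) := by
  rw [ZN, del_iter, del_x, opa_iter, ZN]
lemma Zdel_y (N j : ℕ) : del (ZN A B N 0 (j + 1)) = opb (ZN A B N 0 j) := by
  rw [ZN, del_iter, del_y, opb_iter, ZN]
  rw [show 0 + (j + 1) = 0 + j + 1 by omega]
lemma Zdel_xy (N i j : ℕ) : del (ZN A B N (i + 1) (j + 1)) =
    opa (ZN A B N i (j + 1)) + opb (ZN A B N (i + 1) j) := by
  rw [ZN, del_iter, del_xy, iterate_map_add, opa_iter, opb_iter, ZN, ZN]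
  have h1 : i + 1 + (j + 1) = i + (j + 1) + 1 := by omega
  have h2 : i + 1 + (j + 1) = i + 1 + j + 1 := by omega
  congr 2
  · rw [h1]

lemma ZN_good (N i j : ℕ) (hi : i < A) (hj : j < B) (M : ℕ) (hM : i + j ≤ M) :
    ZN A B N i j ∈ supp (Good (KK A B) (i + j + 1) ((M / (M + 1) : ℝ) ^ N * 2)) :=
  Sd_iter_good _ M _ (by omega) 2 (by norm_num) _ (zz_good i j hi hj) N

lemma ZN_K (N i j : ℕ) (hi : i < A) (hj : j < B) :
    ZN A B N i j ∈ supp (fun l => ∀ p ∈ l, p ∈ KK A B) := by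
  refine supp_mono ?_ (ZN_good N i j hi hj _ le_rfl)
  rintro l ⟨-, ⟨C, hC, -, h⟩, -⟩ p hp
  exact hC (h p hp)

lemma ZN_zero (N : ℕ) : ev [] (ZN A B N 0 0) = 1 := by
  have : ZN A B N 0 0 = sg [(ee A 0, ee B 0)] := by
    unfold ZN
    rw [zz_0]
    apply Function.iterate_fixed
    simp [Sd, bary]
  rw [this]
  simp [e1]

/-- y-type cochain functions -/
def TY (s : VV A B → ZMod 2) : Prop := Tw (KK A B) ga 0 s ∧ Tw (KK A B) gb 1 s
def TX (s : VV A B → ZMod 2) : Prop := Tw (KK A B) ga 1 s ∧ Tw (KK A B) gb 1 s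

lemma evY (N : ℕ) (Y : List (VV A B → ZMod 2)) (hY : ∀ s ∈ Y, TY s) (i j : ℕ) (hi : i < A)
    (hj : j < B) (hij : i + j = Y.length) : ev Y (ZN A B N i j) = if i = 0 then 1 else 0 := by
  induction Y generalizing i j with
  | nil =>
    simp only [List.length_nil, Nat.add_eq_zero_iff] at hij
    obtain ⟨rfl, rfl⟩ := hij
    simp [ZN_zero]
  | cons s Y ih =>
    have hs := hY s (by simp)
    have hY' : ∀ s ∈ Y, TY s := fun s h => hY s (by simp [h])
    have hXa : ∀ s ∈ Y, ∃ χ, Tw (KK A B) ga χ s := fun s h => ⟨_, (hY' s h).1⟩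
    have hXb : ∀ s ∈ Y, ∃ χ, Tw (KK A B) gb χ s := fun s h => ⟨_, (hY' s h).2⟩
    simp only [List.length_cons] at hij
    rw [← hv_del]
    match i, j with
    | 0, 0 => omega
    | 0, j + 1 =>
      rw [Zdel_y, opb, h_tw _ _ s Y _ hs.2 hXb (ZN_K N _ _ hi (by omega)),
        ih hY' _ _ hi (by omega) (by omega)]
      simp
    | i + 1, 0 =>
      rw [Zdel_x, opa, h_tw _ _ s Y _ hs.1 hXa (ZN_K N _ _ (by omega) hj)]
      simp
    | i + 1, j + 1 =>
      rw [Zdel_xy, map_add, opa, opb, h_tw _ _ s Y _ hs.1 hXa (ZN_K N _ _ (by omega) hj),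
        h_tw _ _ s Y _ hs.2 hXb (ZN_K N _ _ hi (by omega)),
        ih hY' (i + 1) j hi (by omega) (by omega)]
      simp

lemma evXY (N : ℕ) (X Y : List (VV A B → ZMod 2)) (hX : ∀ s ∈ X, TX s)
    (hY : ∀ s ∈ Y, TY s) (i j : ℕ) (hi : i < A)
    (hj : j < B) (hij : i + j = X.length + Y.length) (hjd : j ≤ Y.length) :
    ev (X ++ Y) (ZN A B N i j) = if j = Y.length then 1 else 0 := by
  induction X generalizing i j with
  | nil =>
    simp only [List.length_nil, zero_add] at hij
    rw [List.nil_append, evY N Y hY i j hi hj hij]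
    have : i = 0 ↔ j = Y.length := by omega
    simp [this]
  | cons s X ih =>
    have hs := hX s (by simp)
    have hX' : ∀ s ∈ X, TX s := fun s h => hX s (by simp [h])
    have hXa : ∀ s ∈ X ++ Y, ∃ χ, Tw (KK A B) ga χ s := fun s h => by
      rcases List.mem_append.1 h with h | h
      · exact ⟨_, (hX' s h).1⟩
      · exact ⟨_, (hY s h).1⟩
    have hXb : ∀ s ∈ X ++ Y, ∃ χ, Tw (KK A B) gb χ s := fun s h => by
      rcases List.mem_append.1 h with h | h
      · exact ⟨_, (hX' s h).2⟩
      · exact ⟨_, (hY s h).2⟩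
    simp only [List.length_cons] at hij
    rw [List.cons_append, ← hv_del]
    match i, j with
    | 0, j => omega
    | i + 1, 0 =>
      rw [Zdel_x, opa, h_tw _ _ s _ _ hs.1 hXa (ZN_K N _ _ (by omega) hj),
        ih hX' _ _ (by omega) hj (by omega) hjd, one_mul]
    | i + 1, j + 1 =>
      rw [Zdel_xy, map_add, opa, opb, h_tw _ _ s _ _ hs.1 hXa (ZN_K N _ _ (by omega) hj),
        h_tw _ _ s _ _ hs.2 hXb (ZN_K N _ _ hi (by omega)),
        ih hX' (i + 1) j hi (by omega) (by omega) (by omega),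
        ih hX' i (j + 1) (by omega) hj (by omega) hjd]
      have : j ≠ Y.length := by omega
      simp [this]

end prod
end BU
open MeasureTheory

namespace BU

section bu

def pos {n : ℕ} (y : Fin n → ℝ) : Prop := 0 < toLex y

lemma pos_neg {n : ℕ} (y : Fin n → ℝ) (hy : y ≠ 0) : pos (-y) ↔ ¬ pos y := by
  unfold pos
  have h1 : toLex (-y) = - toLex y := rfl
  have h2 : toLex y ≠ 0 := fun h => hy (by simpa using congrArg ofLex h)
  rw [h1, neg_pos]
  have h3 : toLex y < 0 ∨ toLex y = 0 ∨ 0 < toLex y := lt_trichotomy (toLex y) 0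
  exact ⟨fun h h' => lt_asymm h h', fun h => h3.resolve_right (by tauto)⟩

open Classical in
noncomputable def sgn {V : Type*} (ε : V → Prop) (F : V → ℝ) (p : V) : ZMod 2 :=
  if 0 < F p ∨ (F p = 0 ∧ ε p) then 1 else 0

lemma sgn_flip {V : Type*} (ε : V → Prop) (F : V → ℝ) (p q : V) (h1 : F q = - F p)
    (h2 : ε q ↔ ¬ ε p) : sgn ε F q = sgn ε F p + 1 := by
  unfold sgn
  rw [h1]
  have h11 : (1 : ZMod 2) + 1 = 0 := rfl
  rcases lt_trichotomy (F p) 0 with h | h | h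
  · have h3 : ¬ 0 < F p := by linarith
    simp [h, h3, h.ne]
  · by_cases h4 : ε p <;> simp [h, h2, h4, h11]
  · have h3 : ¬ F p < 0 := by linarith
    simp [h, h3, h.ne', h11]

lemma sgn_same {V : Type*} (ε : V → Prop) (F : V → ℝ) (p q : V) (h1 : F q = F p)
    (h2 : ε q ↔ ε p) : sgn ε F q = sgn ε F p := by
  unfold sgn
  rw [h1, h2]

lemma ne_of_KK {A B : ℕ} {p : VV A B} (hp : p ∈ KK A B) : p.1 ≠ 0 ∧ p.2 ≠ 0 := by
  obtain ⟨h1, h2⟩ := hp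
  constructor
  · intro h; simp [h] at h1
  · intro h; simp [h] at h2

def εY {A B : ℕ} (p : VV A B) : Prop := pos p.2
def εX {A B : ℕ} (p : VV A B) : Prop := (pos p.1 ↔ pos p.2)

theorem main {k L : ℕ} (X Y : List (VV (k + 1) (L + 1) → ℝ)) (hXk : X.length = k)
    (hYL : Y.length = L)
    (hcont : ∀ F ∈ X ++ Y, ContinuousOn F (KK (k + 1) (L + 1)))
    (hX : ∀ F ∈ X, ∀ p ∈ KK (k + 1) (L + 1), F (-p.1, p.2) = - F p ∧ F (p.1, -p.2) = - F p)
    (hY : ∀ F ∈ Y, ∀ p ∈ KK (k + 1) (L + 1), F (-p.1, p.2) = F p ∧ F (p.1, -p.2) = - F p) :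
    ∃ p ∈ KK (k + 1) (L + 1), ∀ F ∈ X ++ Y, F p = 0 := by
  classical
  by_contra hno
  push Not at hno
  set K := KK (k + 1) (L + 1) with hK
  -- the sign functions
  set X' := X.map (sgn εX) with hX'
  set Y' := Y.map (sgn εY) with hY'
  have hTX : ∀ s ∈ X', TX s := by
    intro s hs
    obtain ⟨F, hF, rfl⟩ := List.mem_map.1 hs
    constructor
    · intro p hp
      have hn := ne_of_KK hp
      refine sgn_flip _ _ _ _ (hX F hF p hp).1 ?_
      simp only [ga_apply, εX, pos_neg _ hn.1]
      tauto
    · intro p hp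
      have hn := ne_of_KK hp
      refine sgn_flip _ _ _ _ (hX F hF p hp).2 ?_
      simp only [gb_apply, εX, pos_neg _ hn.2]
      tauto
  have hTY : ∀ s ∈ Y', TY s := by
    intro s hs
    obtain ⟨F, hF, rfl⟩ := List.mem_map.1 hs
    constructor
    · intro p hp
      rw [add_zero]
      exact sgn_same _ _ _ _ (hY F hF p hp).1 Iff.rfl
    · intro p hp
      have hn := ne_of_KK hp
      refine sgn_flip _ _ _ _ (hY F hF p hp).2 ?_
      simp only [gb_apply, εY, pos_neg _ hn.2]
  -- one-ness
  have hone : ∀ N, ev (X' ++ Y') (ZN (k + 1) (L + 1) N k L) = 1 := by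
    intro N
    rw [evXY N X' Y' hTX hTY k L (by omega) (by omega) (by simp [X', Y', hXk, hYL])
      (by simp [Y', hYL])]
    simp [Y', hYL]
  -- uniform lower bound
  have hsmall : ∃ η > 0, ∀ p ∈ K, ∃ F ∈ X ++ Y, ∀ q ∈ K, ∀ q' ∈ K, dist p q ≤ η → dist p q' ≤ η → 
      0 < F q * F q' := by
    by_contra hcon
    push Not at hcon
    have hseq : ∀ n : ℕ, ∃ p ∈ K, ∀ F ∈ X ++ Y, ∃ q ∈ K, ∃ q' ∈ K, dist p q ≤ 1 / (n + 1 : ℝ) ∧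
        dist p q' ≤ 1 / (n + 1 : ℝ) ∧ F q * F q' ≤ 0 :=
      fun n => hcon _ (by positivity)
    choose p hpK hp using hseq
    obtain ⟨a, haK, φ, hφ, hlim⟩ := KK_compact.tendsto_subseq hpK
    obtain ⟨F, hF, hFa⟩ := hno a haK
    have hc := hcont F hF a haK
    choose q hq q' hq' hd hd' hle using fun n => hp n F hF
    have h0 : Filter.Tendsto (fun n => 1 / ((φ n : ℝ) + 1)) Filter.atTop (nhds 0) :=
      (tendsto_one_div_add_atTop_nhds_zero_nat (𝕜 := ℝ)).comp hφ.tendsto_atTop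
    have hql : ∀ r : ℕ → VV (k + 1) (L + 1), (∀ n, r n ∈ K) →
        (∀ n, dist (p n) (r n) ≤ 1 / ((n : ℝ) + 1)) →
        Filter.Tendsto (fun n => F (r (φ n))) Filter.atTop (nhds (F a)) := by
      intro r hr hdr
      refine hc.tendsto.comp (tendsto_nhdsWithin_iff.2 ⟨?_, Filter.Eventually.of_forall fun n => hr _⟩)
      have hz : Filter.Tendsto (fun n => dist (p (φ n)) (r (φ n))) Filter.atTop (nhds 0) :=
        squeeze_zero (fun _ => dist_nonneg) (fun n => hdr (φ n)) h0
      exact (tendsto_iff_of_dist hz).1 hlim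
    have hmul := (hql q hq hd).mul (hql q' hq' hd')
    have : F a * F a ≤ 0 := le_of_tendsto' hmul fun n => hle (φ n)
    nlinarith [mul_self_pos.2 hFa]
  obtain ⟨η, hη, hsm⟩ := hsmall
  -- mesh
  have hmesh : ∃ N : ℕ, (((k + L : ℕ) : ℝ) / ((k + L : ℕ) + 1)) ^ N * 2 ≤ η := by
    have hlt : ((k + L : ℕ) : ℝ) / ((k + L : ℕ) + 1) < 1 := by
      rw [div_lt_one (by positivity)]; linarith
    obtain ⟨N, hN⟩ := exists_pow_lt_of_lt_one (half_pos hη) hlt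
    exact ⟨N, by linarith⟩
  obtain ⟨N, hN⟩ := hmesh
  have hz : ev (X' ++ Y') (ZN (k + 1) (L + 1) N k L) = (0 : Ch (VV (k+1) (L+1)) →ₗ[ZMod 2] ZMod 2) (ZN (k + 1) (L + 1) N k L) := by
    refine supp_eq _ _ ?_ (ZN_good N k L (by omega) (by omega) (k + L) le_rfl)
    rintro l ⟨hl, ⟨C, hCK, -, hlC⟩, hd⟩
    rw [ev_sg, LinearMap.zero_apply]
    apply e1_const
    obtain ⟨p, hp⟩ : ∃ p, p ∈ l := List.exists_mem_of_length_pos (by omega)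
    obtain ⟨F, hF, hFp⟩ := hsm p (hCK (hlC p hp))
    have hconst : ∀ ε : VV (k + 1) (L + 1) → Prop, ∀ q ∈ l, ∀ q' ∈ l, sgn ε F q = sgn ε F q' := by
      intro ε q hq q' hq'
      have h := hFp q (hCK (hlC q hq)) q' (hCK (hlC q' hq')) ((hd p hp q hq).trans hN)
        ((hd p hp q' hq').trans hN)
      unfold sgn
      rcases pos_and_pos_or_neg_and_neg_of_mul_pos h with ⟨h1, h2⟩ | ⟨h1, h2⟩
      · simp [h1, h2]
      · simp [h1.not_gt, h2.not_gt, h1.ne, h2.ne]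
    rcases List.mem_append.1 hF with h | h
    · exact ⟨_, List.mem_append_left _ (List.mem_map_of_mem h), hconst εX⟩
    · exact ⟨_, List.mem_append_right _ (List.mem_map_of_mem h), hconst εY⟩
  rw [hone] at hz
  simp at hz

end bu
end BU
open MeasureTheory

namespace BU

section meas
open Filter Topology

abbrev EE (d : ℕ) := EuclideanSpace ℝ (Fin d)

lemma vol_hyper {d : ℕ} (u : EE d) (hu : u ≠ 0) (t : ℝ) :
    volume {x : EE d | inner ℝ x u = t} = 0 := by
  by_cases h : ∃ x0 : EE d, inner ℝ x0 u = t
  · obtain ⟨x0, hx0⟩ := h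
    have hsub : {x : EE d | inner ℝ x u = t} ⊆
        (AffineSubspace.mk' x0 (LinearMap.ker (innerSL ℝ u).toLinearMap) : AffineSubspace ℝ (EE d)) := by
      intro x hx
      have hx' : inner ℝ x u = t := hx
      simp only [SetLike.mem_coe, AffineSubspace.mem_mk', vsub_eq_sub, LinearMap.mem_ker]
      show inner ℝ u (x - x0) = 0
      rw [real_inner_comm, inner_sub_left, hx', hx0, sub_self]
    refine measure_mono_null hsub (Measure.addHaar_affineSubspace _ _ ?_)
    intro htop
    have h1 : (x0 + u : EE d) ∈ (AffineSubspace.mk' x0 (LinearMap.ker (innerSL ℝ u).toLinearMap) : AffineSubspace ℝ (EE d)) := by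
      rw [htop]; trivial
    simp only [AffineSubspace.mem_mk', vsub_eq_sub, LinearMap.mem_ker, add_sub_cancel_left] at h1
    have h2 : inner ℝ u u = (0 : ℝ) := h1
    exact hu (inner_self_eq_zero.1 h2)
  · push Not at h
    have : {x : EE d | inner ℝ x u = t} = ∅ := by
      ext x; simp [h x]
    rw [this]; simp

lemma ev_lt {P : Type*} {l : Filter P} {a b : P → ℝ} {a0 b0 : ℝ} (ha : Tendsto a l (𝓝 a0))
    (hb : Tendsto b l (𝓝 b0)) (h : a0 ≠ b0) : ∀ᶠ p in l, (a p < b p ↔ a0 < b0) := by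
  rcases lt_or_gt_of_ne h with h | h
  · filter_upwards [ha.eventually_lt hb h] with p hp
    exact ⟨fun _ => h, fun _ => hp⟩
  · filter_upwards [hb.eventually_lt ha h] with p hp
    exact ⟨fun h' => absurd h' hp.not_gt, fun h' => absurd h' h.not_gt⟩

variable {d : ℕ} (μ : Measure (EE d)) [IsFiniteMeasure μ]

lemma tendsto_real {P : Type*} {l : Filter P} [l.IsCountablyGenerated] {S : P → Set (EE d)}
    {A : Set (EE d)} (hS : ∀ p, MeasurableSet (S p)) (hA : MeasurableSet A)
    (h : ∀ᵐ x ∂μ, ∀ᶠ p in l, (x ∈ S p ↔ x ∈ A)) :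
    Tendsto (fun p => μ.real (S p)) l (𝓝 (μ.real A)) := by
  have := tendsto_measure_of_ae_tendsto_indicator_of_isFiniteMeasure (μ := μ) l hA hS h
  exact (ENNReal.tendsto_toReal (measure_ne_top _ _)).comp this

/-- distribution function in direction `u` -/
noncomputable def G (u : EE d) (t : ℝ) : ℝ := μ.real {x | inner ℝ x u < t}

lemma null_ae (hac : μ ≪ volume) (u : EE d) (hu : u ≠ 0) (t : ℝ) :
    ∀ᵐ x ∂μ, inner ℝ x u ≠ t := by
  have := hac (vol_hyper u hu t)
  rw [ae_iff]
  simpa using this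

lemma meas_lt (u : EE d) (t : ℝ) : MeasurableSet {x : EE d | inner ℝ x u < t} :=
  (isOpen_lt (by fun_prop) continuous_const).measurableSet
lemma meas_gt (u : EE d) (t : ℝ) : MeasurableSet {x : EE d | t < inner ℝ x u} :=
  (isOpen_lt continuous_const (by fun_prop)).measurableSet

lemma G_tendsto (hac : μ ≪ volume) {P : Type*} {l : Filter P} [l.IsCountablyGenerated]
    {a : P → EE d} {b : P → ℝ} {u : EE d} {t : ℝ} (hu : u ≠ 0) (ha : Tendsto a l (𝓝 u))
    (hb : Tendsto b l (𝓝 t)) : Tendsto (fun p => G μ (a p) (b p)) l (𝓝 (G μ u t)) := by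
  refine tendsto_real μ (fun p => meas_lt _ _) (meas_lt _ _) ?_
  filter_upwards [null_ae μ hac u hu t] with x hx
  exact ev_lt (tendsto_const_nhds.inner ha) hb hx

lemma G_mono (u : EE d) : Monotone (G μ u) := fun s t hst =>
  measureReal_mono (fun x hx => lt_of_lt_of_le hx hst)

lemma ex_inner (u : EE d) (hu : u ≠ 0) (r : ℝ) : ∃ x : EE d, inner ℝ x u = r := by
  have h : (inner ℝ u u : ℝ) ≠ 0 := fun h => hu (inner_self_eq_zero.1 h)
  exact ⟨(r / inner ℝ u u : ℝ) • u, by rw [real_inner_smul_left]; field_simp⟩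

lemma pos_real (hpos : ∀ U : Set (EE d), IsOpen U → U.Nonempty → 0 < μ U) (U : Set (EE d))
    (h1 : IsOpen U) (h2 : U.Nonempty) : 0 < μ.real U :=
  ENNReal.toReal_pos (hpos U h1 h2).ne' (measure_ne_top _ _)

lemma G_strict (hpos : ∀ U : Set (EE d), IsOpen U → U.Nonempty → 0 < μ U) (u : EE d)
    (hu : u ≠ 0) : StrictMono (G μ u) := by
  intro s t hst
  have hU : IsOpen {x : EE d | s < inner ℝ x u ∧ inner ℝ x u < t} :=
    IsOpen.and (isOpen_lt continuous_const (by fun_prop)) (isOpen_lt (by fun_prop) continuous_const)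
  obtain ⟨x, hx⟩ := ex_inner u hu ((s + t) / 2)
  have h := pos_real μ hpos _ hU ⟨x, by
    refine ⟨?_, ?_⟩ <;> rw [hx] <;> linarith⟩
  have hd : Disjoint {x : EE d | inner ℝ x u < s} {x : EE d | s < inner ℝ x u ∧ inner ℝ x u < t} :=
    Set.disjoint_left.2 fun x (hx : _ < _) hx' => absurd hx'.1 hx.not_gt
  have h2 := measureReal_union (μ := μ) hd hU.measurableSet
  have h3 : μ.real ({x : EE d | inner ℝ x u < s} ∪ {x : EE d | s < inner ℝ x u ∧ inner ℝ x u < t})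
      ≤ G μ u t := by
    refine measureReal_mono ?_
    rintro x (hx | hx)
    · exact lt_trans hx hst
    · exact hx.2
  unfold G at *
  linarith

lemma G_ex (hac : μ ≪ volume) (u : EE d) (hu : u ≠ 0) (c : ℝ) (h0 : 0 < c)
    (h1 : c < μ.real Set.univ) : ∃ t, G μ u t = c := by
  have hcont : Continuous (G μ u) := continuous_iff_continuousAt.2 fun t =>
    G_tendsto μ hac hu tendsto_const_nhds tendsto_id
  have htop : Tendsto (G μ u) atTop (𝓝 (μ.real Set.univ)) := by
    refine tendsto_real μ (fun p => meas_lt _ _) MeasurableSet.univ ?_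
    refine Eventually.of_forall fun x => ?_
    filter_upwards [eventually_gt_atTop (inner ℝ x u)] with t ht
    exact ⟨fun _ => trivial, fun _ => ht⟩
  have hbot : Tendsto (G μ u) atBot (𝓝 0) := by
    have : (0 : ℝ) = μ.real (∅ : Set (EE d)) := by simp
    rw [this]
    refine tendsto_real μ (fun p => meas_lt _ _) MeasurableSet.empty ?_
    refine Eventually.of_forall fun x => ?_
    filter_upwards [eventually_lt_atBot (inner ℝ x u)] with t ht
    exact ⟨fun (h : _ < _) => absurd h ht.not_gt, fun h => absurd h (by simp)⟩
  obtain ⟨a, ha⟩ := (hbot.eventually_lt_const h0).exists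
  obtain ⟨b, hb⟩ := (htop.eventually_const_lt h1).exists
  exact mem_range_of_exists_le_of_exists_ge hcont ⟨a, ha.le⟩ ⟨b, hb.le⟩

lemma G_neg (hac : μ ≪ volume) (u : EE d) (hu : u ≠ 0) (t : ℝ) :
    G μ (-u) (-t) = μ.real Set.univ - G μ u t := by
  have h1 : {x : EE d | inner ℝ x (-u) < -t} =ᵐ[μ] ({x : EE d | inner ℝ x u < t}ᶜ : Set (EE d)) := by
    filter_upwards [null_ae μ hac u hu t] with x hx
    apply propext
    show (inner ℝ x (-u) < -t) ↔ ¬ (inner ℝ x u < t)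
    rw [inner_neg_right, neg_lt_neg_iff, not_lt]
    exact ⟨fun h => h.le, fun h => lt_of_le_of_ne h hx.symm⟩
  unfold G
  rw [measureReal_congr h1, measureReal_compl (meas_lt _ _)]

/-- thresholds -/
def Thr (n : ℕ) (t : EE d → ℕ → ℝ) : Prop :=
  ∀ u, u ≠ 0 → ∀ i, 1 ≤ i → i ≤ n → G μ u (t u i) = i * μ.real Set.univ / (n + 1)

lemma Thr_ex (hac : μ ≪ volume) (hM : 0 < μ.real Set.univ) (n : ℕ) : ∃ t, Thr μ n t := by
  have : ∀ (u : EE d) (i : ℕ), ∃ t : ℝ, u ≠ 0 → 1 ≤ i → i ≤ n →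
      G μ u t = i * μ.real Set.univ / (n + 1) := by
    intro u i
    by_cases h : u ≠ 0 ∧ 1 ≤ i ∧ i ≤ n
    · obtain ⟨hu, h1, h2⟩ := h
      have h1' : (1 : ℝ) ≤ i := by exact_mod_cast h1
      have h2' : (i : ℝ) ≤ n := by exact_mod_cast h2
      obtain ⟨t, ht⟩ := G_ex μ hac u hu (i * μ.real Set.univ / (n + 1)) (by positivity) (by
        rw [div_lt_iff₀ (by positivity)]; nlinarith)
      exact ⟨t, fun _ _ _ => ht⟩
    · exact ⟨0, fun a b c => absurd ⟨a, b, c⟩ h⟩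
  choose t ht using this
  exact ⟨t, fun u hu i h1 h2 => ht u i hu h1 h2⟩

variable {μ} {n : ℕ} {t : EE d → ℕ → ℝ}

lemma Thr_cont (hac : μ ≪ volume) (hpos : ∀ U : Set (EE d), IsOpen U → U.Nonempty → 0 < μ U)
    (ht : Thr μ n t) (u : EE d) (hu : u ≠ 0) (i : ℕ) (h1 : 1 ≤ i) (h2 : i ≤ n) :
    Tendsto (fun u => t u i) (𝓝 u) (𝓝 (t u i)) := by
  have hne : ∀ᶠ w in 𝓝 u, w ≠ 0 := isOpen_ne.mem_nhds hu
  have hst := G_strict μ hpos u hu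
  rw [tendsto_order]
  constructor
  · intro a ha
    have h3 : Tendsto (fun w => G μ w a) (𝓝 u) (𝓝 (G μ u a)) :=
      G_tendsto μ hac hu tendsto_id tendsto_const_nhds
    filter_upwards [hne, h3.eventually_lt_const (hst ha)] with w hw hw2
    rw [ht u hu i h1 h2, ← ht w hw i h1 h2] at hw2
    exact (G_mono μ w).reflect_lt hw2
  · intro a ha
    have h3 : Tendsto (fun w => G μ w a) (𝓝 u) (𝓝 (G μ u a)) :=
      G_tendsto μ hac hu tendsto_id tendsto_const_nhds
    filter_upwards [hne, h3.eventually_const_lt (hst ha)] with w hw hw2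
    rw [ht u hu i h1 h2, ← ht w hw i h1 h2] at hw2
    exact (G_mono μ w).reflect_lt hw2

lemma Thr_lt (hM : 0 < μ.real Set.univ)
    (ht : Thr μ n t) (u : EE d) (hu : u ≠ 0) (i j : ℕ) (h1 : 1 ≤ i) (hij : i < j) (h2 : j ≤ n) :
    t u i < t u j := by
  refine (G_mono μ u).reflect_lt ?_
  rw [ht u hu i h1 (by omega), ht u hu j (by omega) h2]
  have : (i : ℝ) < j := by exact_mod_cast hij
  gcongr

lemma Thr_neg (hac : μ ≪ volume) (hpos : ∀ U : Set (EE d), IsOpen U → U.Nonempty → 0 < μ U)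
    (ht : Thr μ n t) (u : EE d) (hu : u ≠ 0) (i : ℕ) (h1 : 1 ≤ i) (h2 : i ≤ n) :
    t (-u) i = - t u (n + 1 - i) := by
  have hu' : -u ≠ 0 := neg_ne_zero.2 hu
  refine (G_strict μ hpos (-u) hu').injective ?_
  rw [G_neg μ hac u hu, ht u hu _ (by omega) (by omega), ht (-u) hu' i h1 h2]
  rw [Nat.cast_sub (by omega)]
  push_cast
  field_simp
  ring

lemma slab_neg (hac : μ ≪ volume) (hpos : ∀ U : Set (EE d), IsOpen U → U.Nonempty → 0 < μ U)
    (ht : Thr μ n t) (u : EE d) (hu : u ≠ 0) (i : ℕ) (h2 : i ≤ n) :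
    slab (-u) (t (-u)) n i = slab u (t u) n (n - i) := by
  ext x
  have e1 : (1 ≤ i → t (-u) i < inner ℝ x (-u)) ↔
      (n - i + 1 ≤ n → inner ℝ x u < t u (n - i + 1)) := by
    by_cases h : 1 ≤ i
    · have h3 : n - i + 1 ≤ n := by omega
      have h4 : n - i + 1 = n + 1 - i := by omega
      simp only [h, h3, true_imp_iff]
      rw [Thr_neg hac hpos ht u hu i h h2, inner_neg_right, neg_lt_neg_iff, h4]
    · have h3 : ¬ (n - i + 1 ≤ n) := by omega
      simp [h, h3]
  have e2 : (i + 1 ≤ n → inner ℝ x (-u) < t (-u) (i + 1)) ↔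
      (1 ≤ n - i → t u (n - i) < inner ℝ x u) := by
    by_cases h : i + 1 ≤ n
    · have h3 : 1 ≤ n - i := by omega
      have h4 : n - i = n + 1 - (i + 1) := by omega
      simp only [h, h3, true_imp_iff]
      rw [Thr_neg hac hpos ht u hu _ (by omega) h, inner_neg_right, neg_lt_neg_iff, h4]
    · have h3 : ¬ (1 ≤ n - i) := by omega
      simp [h, h3]
  show (_ ∧ _) ↔ (_ ∧ _)
  rw [e1, e2, and_comm]

lemma slab_meas (u : EE d) (t : ℕ → ℝ) (n i : ℕ) : MeasurableSet (slab u t n i) := by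
  refine MeasurableSet.inter (s₁ := {x | 1 ≤ i → t i < inner ℝ x u})
    (s₂ := {x | i + 1 ≤ n → inner ℝ x u < t (i + 1)}) ?_ ?_
  · by_cases h : 1 ≤ i
    · simpa [h] using meas_gt u (t i)
    · simp [h]
  · by_cases h : i + 1 ≤ n
    · simpa [h] using meas_lt u (t (i + 1))
    · simp [h]

lemma slab_real (hac : μ ≪ volume) (hM : 0 < μ.real Set.univ)
    (ht : Thr μ n t) (u : EE d) (hu : u ≠ 0) (i : ℕ) (h2 : i ≤ n) :
    μ.real (slab u (t u) n i) = μ.real Set.univ / (n + 1) := by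
  set Lo : Set (EE d) := {x | i + 1 ≤ n → inner ℝ x u < t u (i + 1)} with hLo
  set Lc : Set (EE d) := {x | 1 ≤ i ∧ inner ℝ x u ≤ t u i} with hLc
  have hn : (0 : ℝ) < n + 1 := by positivity
  have m1 : μ.real Lo = (i + 1) * μ.real Set.univ / (n + 1) := by
    by_cases h : i + 1 ≤ n
    · have : Lo = {x | inner ℝ x u < t u (i + 1)} := by simp [hLo, h]
      have h3 := ht u hu (i + 1) (by omega) h
      unfold G at h3
      rw [this, h3]; push_cast; rfl
    · have : Lo = Set.univ := by simp [hLo, h]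
      have h3 : i = n := by omega
      rw [this, h3]; field_simp
  have m2 : μ.real Lc = i * μ.real Set.univ / (n + 1) := by
    by_cases h : 1 ≤ i
    · have h1 : Lc =ᵐ[μ] {x : EE d | inner ℝ x u < t u i} := by
        filter_upwards [null_ae μ hac u hu (t u i)] with x hx
        apply propext
        show (1 ≤ i ∧ inner ℝ x u ≤ t u i) ↔ (inner ℝ x u < t u i)
        exact ⟨fun h => lt_of_le_of_ne h.2 hx, fun h' => ⟨h, h'.le⟩⟩
      rw [measureReal_congr h1]
      exact ht u hu i h h2
    · have : Lc = ∅ := by simp [hLc, h]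
      have h3 : i = 0 := by omega
      rw [this, h3]; simp
  have hsub : Lc ⊆ Lo := by
    rintro x ⟨h1, h3⟩ h4
    exact lt_of_le_of_lt h3 (Thr_lt hM ht u hu i (i + 1) h1 (by omega) h4)
  have hmeas : MeasurableSet Lc := by
    by_cases h : 1 ≤ i
    · have : Lc = {x | t u i < inner ℝ x u}ᶜ := by ext x; simp [hLc, h]
      rw [this]; exact (meas_gt _ _).compl
    · have : Lc = ∅ := by simp [hLc, h]
      rw [this]; exact MeasurableSet.empty
  have heq : slab u (t u) n i = Lo \ Lc := by
    ext x
    simp only [slab, hLo, hLc, Set.mem_sdiff, Set.mem_ofPred_eq, not_and, not_le]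
    tauto
  rw [heq, measureReal_sdiff hsub hmeas, m1, m2]
  field_simp
  ring

end meas
end BU
open MeasureTheory

namespace BU

section final
open Filter Topology

lemma half_ae {d : ℕ} {μ : Measure (EE d)} [IsFiniteMeasure μ] (hac : μ ≪ volume) (v : EE d) (s : ℝ)
    (h : v ≠ 0 ∨ s ≠ 0) : ∀ᵐ x ∂μ, inner ℝ x v ≠ s := by
  by_cases hv : v = 0
  · have hs : s ≠ 0 := by tauto
    subst hv
    refine Eventually.of_forall fun x => ?_
    rw [inner_zero_right]; exact hs.symm
  · exact null_ae μ hac v hv s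

/-- signed imbalance of slab `i` with respect to the second hyperplane -/
noncomputable def ff {d : ℕ} (μ : Measure (EE d)) (t : EE d → ℕ → ℝ) (n i : ℕ) (u v : EE d)
    (s : ℝ) : ℝ :=
  μ.real (slab u (t u) n i ∩ {x | s < inner ℝ x v}) - μ.real (slab u (t u) n i ∩ {x | inner ℝ x v < s})

variable {d : ℕ} {μ : Measure (EE d)} [IsFiniteMeasure μ] {n : ℕ} {t : EE d → ℕ → ℝ}

lemma slab_ev (hac : μ ≪ volume) (hpos : ∀ U : Set (EE d), IsOpen U → U.Nonempty → 0 < μ U)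
    (ht : Thr μ n t) {P : Type*} {l : Filter P} {a : P → EE d} {u : EE d} (hu : u ≠ 0)
    (ha : Tendsto a l (𝓝 u)) (i : ℕ) (hi : i ≤ n) :
    ∀ᵐ x ∂μ, ∀ᶠ p in l, (x ∈ slab (a p) (t (a p)) n i ↔ x ∈ slab u (t u) n i) := by
  filter_upwards [null_ae μ hac u hu (t u i), null_ae μ hac u hu (t u (i + 1))] with x hx1 hx2
  have hin : Tendsto (fun p => inner ℝ x (a p)) l (𝓝 (inner ℝ x u)) := tendsto_const_nhds.inner ha
  have e1 : ∀ᶠ p in l, ((1 ≤ i → t (a p) i < inner ℝ x (a p)) ↔ (1 ≤ i → t u i < inner ℝ x u)) := by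
    by_cases h : 1 ≤ i
    · have := ev_lt ((Thr_cont hac hpos ht u hu i h hi).comp ha) hin hx1.symm
      filter_upwards [this] with p hp
      simp only [h, true_imp_iff]
      exact hp
    · simp [h]
  have e2 : ∀ᶠ p in l, ((i + 1 ≤ n → inner ℝ x (a p) < t (a p) (i + 1)) ↔
      (i + 1 ≤ n → inner ℝ x u < t u (i + 1))) := by
    by_cases h : i + 1 ≤ n
    · have := ev_lt hin ((Thr_cont hac hpos ht u hu (i + 1) (by omega) h).comp ha) hx2
      filter_upwards [this] with p hp
      simp only [h, true_imp_iff]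
      exact hp
    · simp [h]
  filter_upwards [e1, e2] with p h1 h2
  exact and_congr h1 h2

lemma ff_tendsto (hac : μ ≪ volume) (hpos : ∀ U : Set (EE d), IsOpen U → U.Nonempty → 0 < μ U)
    (ht : Thr μ n t) {P : Type*} {l : Filter P} [l.IsCountablyGenerated]
    {a b : P → EE d} {c : P → ℝ} {u v : EE d} {s : ℝ} (hu : u ≠ 0) (hvs : v ≠ 0 ∨ s ≠ 0)
    (ha : Tendsto a l (𝓝 u)) (hb : Tendsto b l (𝓝 v)) (hc : Tendsto c l (𝓝 s)) (i : ℕ)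
    (hi : i ≤ n) :
    Tendsto (fun p => ff μ t n i (a p) (b p) (c p)) l (𝓝 (ff μ t n i u v s)) := by
  refine Tendsto.sub ?_ ?_
  · refine tendsto_real μ (fun p => (slab_meas _ _ _ _).inter (meas_gt _ _))
      ((slab_meas _ _ _ _).inter (meas_gt _ _)) ?_
    filter_upwards [slab_ev hac hpos ht hu ha i hi, half_ae hac v s hvs] with x h1 h2
    have h3 := ev_lt hc ((tendsto_const_nhds (x := x)).inner hb) h2.symm
    filter_upwards [h1, h3] with p h4 h5
    exact and_congr h4 h5
  · refine tendsto_real μ (fun p => (slab_meas _ _ _ _).inter (meas_lt _ _))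
      ((slab_meas _ _ _ _).inter (meas_lt _ _)) ?_
    filter_upwards [slab_ev hac hpos ht hu ha i hi, half_ae hac v s hvs] with x h1 h2
    have h3 := ev_lt ((tendsto_const_nhds (x := x)).inner hb) hc h2
    filter_upwards [h1, h3] with p h4 h5
    exact and_congr h4 h5

lemma ff_neg_u (hac : μ ≪ volume) (hpos : ∀ U : Set (EE d), IsOpen U → U.Nonempty → 0 < μ U)
    (ht : Thr μ n t) (u v : EE d) (s : ℝ) (hu : u ≠ 0) (i : ℕ) (hi : i ≤ n) :
    ff μ t n i (-u) v s = ff μ t n (n - i) u v s := by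
  unfold ff
  rw [slab_neg hac hpos ht u hu i hi]

lemma ff_neg_v (u v : EE d) (s : ℝ) (i : ℕ) :
    ff μ t n i u (-v) (-s) = - ff μ t n i u v s := by
  unfold ff
  simp only [inner_neg_right, neg_lt_neg_iff]
  ring

def pu {k : ℕ} (p : VV (k + 1) (k + 1 + 1)) : EE (k + 1) := WithLp.toLp 2 p.1
def pv {k : ℕ} (p : VV (k + 1) (k + 1 + 1)) : EE (k + 1) :=
  WithLp.toLp 2 (fun i => p.2 i.castSucc)
def ps {k : ℕ} (p : VV (k + 1) (k + 1 + 1)) : ℝ := p.2 (Fin.last _)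

lemma pu_cont {k : ℕ} : Continuous (pu (k := k)) := by unfold pu; fun_prop
lemma pv_cont {k : ℕ} : Continuous (pv (k := k)) := by unfold pv; fun_prop
lemma ps_cont {k : ℕ} : Continuous (ps (k := k)) := by unfold ps; fun_prop

theorem exists_zero {k : ℕ} {μ : Measure (EE (k + 1))} [IsFiniteMeasure μ]
    {t : EE (k + 1) → ℕ → ℝ} (hac : μ ≪ volume)
    (hpos : ∀ U : Set (EE (k + 1)), IsOpen U → U.Nonempty → 0 < μ U)
    (ht : Thr μ (2 * k) t) : ∃ (u v : EE (k + 1)) (s : ℝ), u ≠ 0 ∧ (v ≠ 0 ∨ s ≠ 0) ∧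
      ∀ i ≤ 2 * k, ff μ t (2 * k) i u v s = 0 := by
  set f : ℕ → VV (k + 1) (k + 1 + 1) → ℝ := fun i p => ff μ t (2 * k) i (pu p) (pv p) (ps p) with hf
  have hne : ∀ p ∈ KK (k + 1) (k + 1 + 1), pu p ≠ 0 ∧ (pv p ≠ 0 ∨ ps p ≠ 0) := by
    intro p hp
    obtain ⟨h1, h2⟩ := ne_of_KK hp
    constructor
    · intro h; apply h1
      have := congrArg WithLp.ofLp h
      simpa [pu] using this
    · by_contra hcon
      push Not at hcon
      apply h2
      obtain ⟨h3, h4⟩ := hcon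
      funext i
      refine Fin.lastCases ?_ (fun j => ?_) i
      · exact h4
      · have := congrFun (congrArg WithLp.ofLp h3) j
        simpa [pv] using this
  have hfc : ∀ i ≤ 2 * k, ContinuousOn (f i) (KK (k + 1) (k + 1 + 1)) := by
    intro i hi p hp
    obtain ⟨h1, h2⟩ := hne p hp
    exact ff_tendsto hac hpos ht h1 h2 (pu_cont.tendsto p |>.mono_left nhdsWithin_le_nhds)
      (pv_cont.tendsto p |>.mono_left nhdsWithin_le_nhds)
      (ps_cont.tendsto p |>.mono_left nhdsWithin_le_nhds) i hi
  have hfa : ∀ i ≤ 2 * k, ∀ p ∈ KK (k + 1) (k + 1 + 1), f i (-p.1, p.2) = f (2 * k - i) p := by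
    intro i hi p hp
    exact ff_neg_u hac hpos ht (pu p) (pv p) (ps p) (hne p hp).1 i hi
  have hfb : ∀ i, ∀ p ∈ KK (k + 1) (k + 1 + 1), f i (p.1, -p.2) = - f i p := by
    intro i p hp
    exact ff_neg_v (pu p) (pv p) (ps p) i
  obtain ⟨p, hp, hzero⟩ := main (k := k) (L := k + 1)
    (List.ofFn fun j : Fin k => fun p => f j p - f (2 * k - j) p)
    (List.ofFn fun j : Fin (k + 1) => fun p => f j p + f (2 * k - j) p) (by simp) (by simp)
    (by
      intro F hF
      rcases List.mem_append.1 hF with h | h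
      · obtain ⟨j, rfl⟩ := (List.mem_ofFn' _ _).1 h
        exact (hfc _ (by omega)).sub (hfc _ (by omega))
      · obtain ⟨j, rfl⟩ := (List.mem_ofFn' _ _).1 h
        exact (hfc _ (by omega)).add (hfc _ (by omega)))
    (by
      intro F hF p hp
      obtain ⟨j, rfl⟩ := (List.mem_ofFn' _ _).1 hF
      dsimp only
      rw [hfa _ (by omega) p hp, hfa _ (by omega) p hp, hfb _ p hp, hfb _ p hp,
        show 2 * k - (2 * k - j.val) = j.val by omega]
      constructor <;> ring)
    (by
      intro F hF p hp
      obtain ⟨j, rfl⟩ := (List.mem_ofFn' _ _).1 hF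
      dsimp only
      rw [hfa _ (by omega) p hp, hfa _ (by omega) p hp, hfb _ p hp, hfb _ p hp,
        show 2 * k - (2 * k - j.val) = j.val by omega]
      constructor <;> ring)
  refine ⟨pu p, pv p, ps p, (hne p hp).1, (hne p hp).2, ?_⟩
  have hX : ∀ j < k, f j p - f (2 * k - j) p = 0 := fun j hj =>
    hzero (fun p => f j p - f (2 * k - j) p)
      (List.mem_append_left _ ((List.mem_ofFn' _ _).2 ⟨⟨j, hj⟩, rfl⟩))
  have hY : ∀ j < k + 1, f j p + f (2 * k - j) p = 0 := fun j hj =>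
    hzero (fun p => f j p + f (2 * k - j) p)
      (List.mem_append_right _ ((List.mem_ofFn' _ _).2 ⟨⟨j, hj⟩, rfl⟩))
  intro i hi
  show f i p = 0
  rcases lt_trichotomy i k with h | h | h
  · linarith [hX i h, hY i (by omega)]
  · have := hY i (by omega)
    rw [show 2 * k - i = i by omega] at this
    linarith
  · have h1 := hX (2 * k - i) (by omega)
    have h2 := hY (2 * k - i) (by omega)
    rw [show 2 * k - (2 * k - i) = i by omega] at h1 h2
    linarith

lemma half_real (hac : μ ≪ volume) (hM : 0 < μ.real Set.univ) (ht : Thr μ n t)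
    (u v : EE d) (s : ℝ) (hu : u ≠ 0) (hvs : v ≠ 0 ∨ s ≠ 0) (i : ℕ) (hi : i ≤ n)
    (h0 : ff μ t n i u v s = 0) (b : Bool) :
    μ.real (slab u (t u) n i ∩ halfSp v s b) = μ.real Set.univ / (2 * (n + 1)) := by
  have h1 := slab_real hac hM ht u hu i hi
  have hU : slab u (t u) n i =ᵐ[μ] ((slab u (t u) n i ∩ {x | s < inner ℝ x v}) ∪
      (slab u (t u) n i ∩ {x | inner ℝ x v < s}) : Set (EE d)) := by
    filter_upwards [half_ae hac v s hvs] with x hx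
    apply propext
    show x ∈ slab u (t u) n i ↔ (x ∈ slab u (t u) n i ∧ s < inner ℝ x v) ∨
      (x ∈ slab u (t u) n i ∧ inner ℝ x v < s)
    rcases lt_or_gt_of_ne hx with h | h <;> tauto
  have hd : Disjoint (slab u (t u) n i ∩ {x | s < inner ℝ x v})
      (slab u (t u) n i ∩ {x | inner ℝ x v < s}) :=
    Set.disjoint_left.2 fun x hx hx' => lt_asymm (show s < inner ℝ x v from hx.2) hx'.2
  have h2 := measureReal_union (μ := μ) hd ((slab_meas _ _ _ _).inter (meas_lt _ _))
  rw [← measureReal_congr hU, h1] at h2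
  unfold ff at h0
  have hn : (0 : ℝ) < n + 1 := by positivity
  have h3 : μ.real Set.univ / (2 * (n + 1)) = (μ.real Set.univ / (n + 1)) / 2 := by
    field_simp
  rw [h3]
  cases b
  · simp only [halfSp, Bool.false_eq_true, if_false]
    linarith
  · simp only [halfSp, if_true]
    linarith

lemma v_ne (hac : μ ≪ volume) (hM : 0 < μ.real Set.univ) (ht : Thr μ n t)
    (u v : EE d) (s : ℝ) (hu : u ≠ 0) (hvs : v ≠ 0 ∨ s ≠ 0) (hn : 1 ≤ n)
    (h0 : ∀ i ≤ n, ff μ t n i u v s = 0) (c : ℝ) : v ≠ c • u := by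
  intro hv
  have hne : ∀ i ≤ n, ∀ b, (slab u (t u) n i ∩ halfSp v s b).Nonempty := by
    intro i hi b
    have := half_real hac hM ht u v s hu hvs i hi (h0 i hi) b
    by_contra hcon
    rw [Set.not_nonempty_iff_eq_empty] at hcon
    rw [hcon, measureReal_empty] at this
    have h2 : 0 < μ.real Set.univ / (2 * (n + 1)) := by positivity
    linarith
  have h1n : t u 1 ≤ t u n := by
    rcases hn.eq_or_lt with h | h
    · rw [← h]
    · exact (Thr_lt hM ht u hu 1 n le_rfl h le_rfl).le
  obtain ⟨x1, hx1, hx1'⟩ := hne 0 (by omega) false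
  obtain ⟨x2, hx2, hx2'⟩ := hne 0 (by omega) true
  obtain ⟨y1, hy1, hy1'⟩ := hne n le_rfl false
  obtain ⟨y2, hy2, hy2'⟩ := hne n le_rfl true
  have a1 : inner ℝ x1 u < t u 1 := hx1.2 (by omega)
  have a2 : inner ℝ x2 u < t u 1 := hx2.2 (by omega)
  have a3 : t u n < inner ℝ y1 u := hy1.1 hn
  have a4 : t u n < inner ℝ y2 u := hy2.1 hn
  have b1 : s < inner ℝ x1 v := by simpa [halfSp] using hx1'
  have b2 : inner ℝ x2 v < s := by simpa [halfSp] using hx2'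
  have b3 : s < inner ℝ y1 v := by simpa [halfSp] using hy1'
  have b4 : inner ℝ y2 v < s := by simpa [halfSp] using hy2'
  rw [hv, real_inner_smul_right] at b1 b2 b3 b4
  rcases le_total 0 c with hc | hc
  · nlinarith
  · nlinarith

lemma slab_smul (u : EE d) (t : ℕ → ℝ) (n i : ℕ) (c : ℝ) (hc : 0 < c) :
    slab (c • u) (fun i => c * t i) n i = slab u t n i := by
  ext x
  simp only [slab, real_inner_smul_right, mul_lt_mul_iff_right₀ hc]

lemma half_smul (v : EE d) (s : ℝ) (b : Bool) (c : ℝ) (hc : 0 < c) :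
    halfSp (c • v) (c * s) b = halfSp v s b := by
  simp only [halfSp, real_inner_smul_right, mul_lt_mul_iff_right₀ hc]

end final
end BU

/-- Every mass distribution in `ℝ^d` (`d ≥ 2`) admits an equipartition into
`4d - 2` boxes by a collection of `2d - 2` parallel hyperplanes and one
additional non-parallel hyperplane. -/
theorem equipartition_parallel_2d_sub_2 (d : ℕ) (hd : 2 ≤ d)
    (μ : Measure (EuclideanSpace ℝ (Fin d)))
    (f : EuclideanSpace ℝ (Fin d) → ℝ) (hf : Integrable f)
    (hμ : ∀ A : Set (EuclideanSpace ℝ (Fin d)), MeasurableSet A →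
      μ A = ENNReal.ofReal (∫ x in A, f x))
    (hpos : ∀ U : Set (EuclideanSpace ℝ (Fin d)), IsOpen U → U.Nonempty → 0 < μ U) :
    ∃ (u v : EuclideanSpace ℝ (Fin d)) (t : ℕ → ℝ) (s : ℝ),
      ‖u‖ = 1 ∧ ‖v‖ = 1 ∧ v ≠ u ∧ v ≠ -u ∧
      StrictMonoOn t (Set.Icc 1 (2 * d - 2)) ∧
      ∀ i ≤ 2 * d - 2, ∀ b : Bool,
        μ (slab u t (2 * d - 2) i ∩ halfSp v s b) =
          μ Set.univ / ((4 * d - 2 : ℕ) : ENNReal) := by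
  obtain ⟨k, rfl⟩ : ∃ k, d = k + 1 := ⟨d - 1, by omega⟩
  rw [show 2 * (k + 1) - 2 = 2 * k by omega, show 4 * (k + 1) - 2 = 4 * k + 2 by omega]
  haveI : IsFiniteMeasure μ := ⟨by
    rw [hμ _ MeasurableSet.univ]; exact ENNReal.ofReal_lt_top⟩
  have hac : μ ≪ volume := by
    refine Measure.AbsolutelyContinuous.mk fun A hA h0 => ?_
    rw [hμ A hA, setIntegral_measure_zero _ h0, ENNReal.ofReal_zero]
  have hM : 0 < μ.real Set.univ :=
    BU.pos_real μ hpos _ isOpen_univ Set.univ_nonempty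
  obtain ⟨t, ht⟩ := BU.Thr_ex μ hac hM (2 * k)
  obtain ⟨u, v, s, hu, hvs, h0⟩ := BU.exists_zero hac hpos ht
  have hnp := BU.v_ne hac hM ht u v s hu hvs (by omega) h0
  have hv : v ≠ 0 := by simpa using hnp 0
  have hu' : 0 < ‖u‖ := norm_pos_iff.2 hu
  have hv' : 0 < ‖v‖ := norm_pos_iff.2 hv
  refine ⟨‖u‖⁻¹ • u, ‖v‖⁻¹ • v, fun i => ‖u‖⁻¹ * t u i, ‖v‖⁻¹ * s, ?_, ?_, ?_, ?_, ?_, ?_⟩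
  · rw [norm_smul, norm_inv, norm_norm, inv_mul_cancel₀ hu'.ne']
  · rw [norm_smul, norm_inv, norm_norm, inv_mul_cancel₀ hv'.ne']
  · intro h
    apply hnp (‖v‖ * ‖u‖⁻¹)
    rw [mul_smul, ← h, smul_smul, mul_inv_cancel₀ hv'.ne', one_smul]
  · intro h
    apply hnp (-(‖v‖ * ‖u‖⁻¹))
    rw [neg_smul, mul_smul, ← smul_neg, ← h, smul_smul, mul_inv_cancel₀ hv'.ne', one_smul]
  · intro i hi j hj hij
    have := BU.Thr_lt hM ht u hu i j hi.1 hij hj.2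
    exact mul_lt_mul_of_pos_left this (inv_pos.2 hu')
  · intro i hi b
    rw [BU.slab_smul _ _ _ _ _ (inv_pos.2 hu'), BU.half_smul _ _ _ _ (inv_pos.2 hv')]
    have h1 := BU.half_real hac hM ht u v s hu hvs i hi (h0 i hi) b
    rw [← ENNReal.toReal_eq_toReal_iff' (measure_ne_top _ _)
      (ENNReal.div_ne_top (measure_ne_top _ _) (by simp)), ENNReal.toReal_div]
    rw [Measure.real] at h1
    rw [h1, Measure.real, ENNReal.toReal_natCast]
    push_cast
    congr 1
    ring
end

section
/- For every mass distribution μ on ℝ², there exist a unit vector u ∈ ℝ², real numbers t_1 < t_2, a unit vector v with v ≠ u and v ≠ -u, and a real number s, such that each of the 6 regions of the form {x ∈ ℝ² : t_i < ⟨x,u⟩ < t_{i+1}} ∩ {x ∈ ℝ² : ⟨x,v⟩ < s} and {x ∈ ℝ² : t_i < ⟨x,u⟩ < t_{i+1}} ∩ {x ∈ ℝ² : ⟨x,v⟩ > s} (for 0 ≤ i ≤ 2, with t_0 = -∞ and t_3 = +∞) has μ-measure μ(ℝ²)/6. That is, every mass distribution in the plane admits an equipartition into 6 boxes by two parallel lines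 and one additional line not parallel to them. -/
open MeasureTheory

section helpers
open Filter Topology

abbrev E2 := EuclideanSpace ℝ (Fin 2)

def lf (m n : ℝ) (p : E2) : ℝ := m * p 0 + n * p 1

lemma lf_cont (m n : ℝ) : Continuous (lf m n) := by
  unfold lf; fun_prop

lemma vol_line (m n c : ℝ) (h : m ^ 2 + n ^ 2 ≠ 0) :
    (volume : Measure E2) {p | lf m n p = c} = 0 := by
  let S : AffineSubspace ℝ E2 :=
    { carrier := {p | lf m n p = c}
      smul_vsub_vadd_mem' := by
        intro k p₁ p₂ p₃ h1 h2 h3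
        simp only [lf, Set.mem_ofPred_eq] at *
        simp
        linear_combination k * h1 - k * h2 + h3 }
  have hS : S ≠ ⊤ := by
    intro hS
    have hall : ∀ p : E2, lf m n p = c := by
      intro p
      have : p ∈ S := by rw [hS]; trivial
      exact this
    have h0 := hall 0
    have h1 := hall (!₂[m, n])
    simp [lf] at h0 h1
    apply h
    rw [← h0] at h1
    linarith
  exact Measure.addHaar_affineSubspace volume S hS

variable {μ : Measure E2} [IsFiniteMeasure μ]

lemma real_tendsto {ι : Type*} {L : Filter ι} [L.IsCountablyGenerated]
    {As : ι → Set E2} {A : Set E2} (hA : MeasurableSet A) (hAs : ∀ i, MeasurableSet (As i))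
    (h : ∀ᵐ x ∂μ, ∀ᶠ i in L, x ∈ As i ↔ x ∈ A) :
    Tendsto (fun i => μ.real (As i)) L (𝓝 (μ.real A)) := by
  have := tendsto_measure_of_ae_tendsto_indicator_of_isFiniteMeasure L (μ := μ) hA hAs h
  exact (ENNReal.tendsto_toReal (measure_ne_top μ A)).comp this

lemma ev_iff {ι : Type*} {L : Filter ι} {g : ι → ℝ} {a : ℝ} (h : Tendsto g L (𝓝 a)) (ha : a ≠ 0) :
    ∀ᶠ i in L, (g i < 0 ↔ a < 0) := by
  rcases lt_or_gt_of_ne ha with h0 | h0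
  · filter_upwards [h.eventually (gt_mem_nhds h0)] with i hi
    exact iff_of_true hi h0
  · filter_upwards [h.eventually (lt_mem_nhds h0)] with i hi
    exact iff_of_false (not_lt.2 (le_of_lt hi)) (not_lt.2 h0.le)

/-- continuity of the measure of an intersection of two moving half planes -/
lemma cont_two {Z : Type*} [TopologicalSpace Z] [FirstCountableTopology Z]
    (α β : Z → E2 → ℝ) (ca : ∀ p, Continuous fun z => α z p) (cb : ∀ p, Continuous fun z => β z p)
    (ma : ∀ z, Continuous (α z)) (mb : ∀ z, Continuous (β z))
    (na : ∀ z, μ {p | α z p = 0} = 0) (nb : ∀ z, μ {p | β z p = 0} = 0) :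
    Continuous fun z => μ.real ({p | α z p < 0} ∩ {p | β z p < 0}) := by
  rw [continuous_iff_continuousAt]
  intro z
  have hm : ∀ z, MeasurableSet ({p | α z p < 0} ∩ {p | β z p < 0}) := fun z =>
    ((isOpen_lt (ma z) continuous_const).inter (isOpen_lt (mb z) continuous_const)).measurableSet
  refine real_tendsto (hm z) hm ?_
  have h1 : ∀ᵐ p ∂μ, α z p ≠ 0 := by
    rw [ae_iff]; simpa using na z
  have h2 : ∀ᵐ p ∂μ, β z p ≠ 0 := by
    rw [ae_iff]; simpa using nb z
  filter_upwards [h1, h2] with p hp1 hp2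
  filter_upwards [ev_iff ((ca p).tendsto z) hp1, ev_iff ((cb p).tendsto z) hp2] with y h1 h2
  simp [h1, h2]

lemma cont_root {Z : Type*} [TopologicalSpace Z] (F : Z → ℝ → ℝ) (r : Z → ℝ) (c : ℝ)
    (hc : ∀ b, Continuous fun z => F z b) (hm : ∀ z, StrictMono (F z)) (hr : ∀ z, F z (r z) = c) :
    Continuous r := by
  rw [continuous_iff_continuousAt]
  intro z
  refine tendsto_order.2 ⟨fun b hb => ?_, fun b hb => ?_⟩
  · have h : F z b < c := hr z ▸ hm z hb
    filter_upwards [((hc b).tendsto z).eventually (gt_mem_nhds h)] with y hy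
    rw [← hr y] at hy
    exact (hm y).lt_iff_lt.1 hy
  · have h : c < F z b := hr z ▸ hm z hb
    filter_upwards [((hc b).tendsto z).eventually (lt_mem_nhds h)] with y hy
    rw [← hr y] at hy
    exact (hm y).lt_iff_lt.1 hy

lemma quantile (A : Set E2) (hA : MeasurableSet A) (h : E2 → ℝ) (hh : Continuous h)
    (hn : ∀ c, μ {p | h p = c} = 0) (c : ℝ) (h0 : 0 < c) (h1 : c < μ.real A) :
    ∃ b, μ.real (A ∩ {p | h p < b}) = c := by
  have hm : ∀ b, MeasurableSet (A ∩ {p | h p < b}) := fun b =>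
    hA.inter (isOpen_lt hh continuous_const).measurableSet
  have hcont : Continuous fun b => μ.real (A ∩ {p | h p < b}) := by
    rw [continuous_iff_continuousAt]
    intro z
    refine real_tendsto (hm z) hm ?_
    have h1 : ∀ᵐ p ∂μ, h p ≠ z := by
      rw [ae_iff]; simpa using hn z
    filter_upwards [h1] with p hp
    have := ev_iff (g := fun z => h p - z) (a := h p - z) (L := 𝓝 z)
      ((by fun_prop : Continuous fun z => h p - z).tendsto z) (sub_ne_zero.2 hp)
    filter_upwards [this] with y hy
    simp only [sub_neg] at hy
    simp [hy]
  have hbot : Tendsto (fun b => μ.real (A ∩ {p | h p < b})) atBot (𝓝 0) := by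
    have := real_tendsto (μ := μ) (L := atBot) (A := ∅) MeasurableSet.empty hm (by
      refine Eventually.of_forall fun p => ?_
      filter_upwards [eventually_le_atBot (h p)] with b hb
      simp [hb])
    simpa using this
  have htop : Tendsto (fun b => μ.real (A ∩ {p | h p < b})) atTop (𝓝 (μ.real A)) := by
    refine real_tendsto (L := atTop) hA hm ?_
    refine Eventually.of_forall fun p => ?_
    filter_upwards [eventually_gt_atTop (h p)] with b hb
    simp [hb]
  exact mem_range_of_exists_le_of_exists_ge hcont
    ((hbot.eventually (gt_mem_nhds h0)).exists.imp fun _ h => le_of_lt h)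
    ((htop.eventually (lt_mem_nhds h1)).exists.imp fun _ h => le_of_lt h)

lemma real_lt {A B U : Set E2} (hAB : A ⊆ B)
    (hpos : ∀ U : Set E2, IsOpen U → U.Nonempty → 0 < μ U) (hU : IsOpen U)
    (hne : U.Nonempty) (hUB : U ⊆ B) (hd : Disjoint A U) : μ.real A < μ.real B := by
  have h1 : 0 < μ.real U := ENNReal.toReal_pos (hpos U hU hne).ne' (measure_ne_top _ _)
  have h2 : μ.real (A ∪ U) = μ.real A + μ.real U := measureReal_union hd hU.measurableSet
  have h3 : μ.real (A ∪ U) ≤ μ.real B := measureReal_mono (Set.union_subset hAB hUB)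
  linarith


lemma split_real (S : Set E2) (g : E2 → ℝ) (hg : Continuous g) (c : ℝ)
    (hn : μ {p | g p = c} = 0) :
    μ.real S = μ.real (S ∩ {p | g p < c}) + μ.real (S ∩ {p | c < g p}) := by
  have h1 := measureReal_inter_add_sdiff (μ := μ) (s := S)
    (t := {p | g p < c}) (isOpen_lt hg continuous_const).measurableSet
  rw [← h1]
  congr 1
  apply measureReal_congr
  have h2 : ∀ᵐ p ∂μ, g p ≠ c := by
    rw [ae_iff]; simpa using hn
  filter_upwards [h2] with p hp
  apply propext
  change (p ∈ S ∧ ¬ (g p < c)) ↔ (p ∈ S ∧ c < g p)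
  rw [not_lt]
  exact ⟨fun h => ⟨h.1, lt_of_le_of_ne h.2 hp.symm⟩, fun h => ⟨h.1, h.2.le⟩⟩

noncomputable def XX (θ : ℝ) : E2 → ℝ := lf (Real.cos θ) (Real.sin θ)
noncomputable def HH (θ a : ℝ) : E2 → ℝ :=
  lf (-Real.sin θ - a * Real.cos θ) (Real.cos θ - a * Real.sin θ)

lemma XX_pi (θ : ℝ) (p : E2) : XX (θ + Real.pi) p = - XX θ p := by
  simp [XX, lf]; ring

lemma HH_pi (θ a : ℝ) (p : E2) : HH (θ + Real.pi) a p = - HH θ a p := by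
  simp [HH, lf]; ring

lemma HH_add (θ a h : ℝ) (p : E2) : HH θ (a + h) p = HH θ a p - h * XX θ p := by
  simp [HH, XX, lf]; ring

lemma pt_exists (θ a x h : ℝ) : ∃ p : E2, XX θ p = x ∧ HH θ a p = h := by
  refine ⟨!₂[x * Real.cos θ - (h + a * x) * Real.sin θ,
    x * Real.sin θ + (h + a * x) * Real.cos θ], ?_, ?_⟩
  · simp [XX, lf]
    linear_combination x * Real.sin_sq_add_cos_sq θ
  · simp [HH, lf]
    linear_combination h * Real.sin_sq_add_cos_sq θ

lemma XX_cont (θ : ℝ) : Continuous (XX θ) := lf_cont _ _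
lemma HH_cont (θ a : ℝ) : Continuous (HH θ a) := lf_cont _ _

lemma core (hpos : ∀ U : Set E2, IsOpen U → U.Nonempty → 0 < μ U)
    (hnull : ∀ m n c : ℝ, m ^ 2 + n ^ 2 ≠ 0 → μ {p | lf m n p = c} = 0) :
    ∃ θ a t₁ t₂ b : ℝ, t₁ < t₂ ∧
      μ.real {p | XX θ p < t₁} = μ.real Set.univ / 3 ∧
      μ.real {p | t₂ < XX θ p} = μ.real Set.univ / 3 ∧
      μ.real {p | HH θ a p < b} = μ.real Set.univ / 2 ∧
      μ.real ({p | XX θ p < t₁} ∩ {p | HH θ a p < b}) = μ.real Set.univ / 6 ∧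
      μ.real ({p | t₂ < XX θ p} ∩ {p | b < HH θ a p}) = μ.real Set.univ / 6 ∧
      (∀ c, μ {p | XX θ p = c} = 0) ∧ (∀ c, μ {p | HH θ a p = c} = 0) := by
  have hXn : ∀ θ c, μ {p | XX θ p = c} = 0 := fun θ c => hnull _ _ c (by
    have := Real.sin_sq_add_cos_sq θ; nlinarith)
  have hHn : ∀ θ a c, μ {p | HH θ a p = c} = 0 := fun θ a c => hnull _ _ c (by
    have := Real.sin_sq_add_cos_sq θ
    have : (-Real.sin θ - a * Real.cos θ) ^ 2 + (Real.cos θ - a * Real.sin θ) ^ 2 = 1 + a ^ 2 := by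
      linear_combination (1 + a ^ 2) * this
    rw [this]; positivity)
  set m := μ.real Set.univ with hm
  have m0 : 0 < m := ENNReal.toReal_pos (hpos _ isOpen_univ Set.univ_nonempty).ne'
    (measure_ne_top _ _)
  -- quantiles
  have ht : ∀ θ, ∃ t, μ.real (Set.univ ∩ {p | XX θ p < t}) = m / 3 := fun θ =>
    quantile _ MeasurableSet.univ _ (XX_cont θ) (hXn θ) _ (by linarith) (by linarith)
  choose t ht using ht
  simp only [Set.univ_inter] at ht
  have tmono : ∀ θ, StrictMono fun t => μ.real {p | XX θ p < t} := by
    intro θ x y hxy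
    obtain ⟨p, hp, -⟩ := pt_exists θ 0 ((x + y) / 2) 0
    refine real_lt (U := {p | x < XX θ p} ∩ {p | XX θ p < y}) (fun q hq => lt_trans hq hxy) hpos
      ((isOpen_lt continuous_const (XX_cont θ)).inter (isOpen_lt (XX_cont θ) continuous_const))
      ⟨p, ?_, ?_⟩ (fun q hq => hq.2) ?_
    · simp only [Set.mem_ofPred_eq, hp]; linarith
    · simp only [Set.mem_ofPred_eq, hp]; linarith
    · rw [Set.disjoint_left]
      intro q hq hq'
      simp only [Set.mem_ofPred_eq, Set.mem_inter_iff] at hq hq'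
      linarith [hq'.1]
  have tcont : Continuous t := by
    refine cont_root (fun θ t => μ.real {p | XX θ p < t}) t (m / 3) (fun b => ?_) tmono ht
    have := cont_two (μ := μ) (Z := ℝ) (fun θ p => XX θ p - b) (fun θ p => XX θ p - b)
      (fun p => by unfold XX lf; fun_prop) (fun p => by unfold XX lf; fun_prop)
      (fun z => (XX_cont z).sub continuous_const) (fun z => (XX_cont z).sub continuous_const)
      (fun z => by simpa [sub_eq_zero] using hXn z b)
      (fun z => by simpa [sub_eq_zero] using hXn z b)
    simpa using this
  have hb : ∀ θ a, ∃ b, μ.real ({p | XX θ p < t θ} ∩ {p | HH θ a p < b}) = m / 6 := fun θ a =>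
    quantile _ (isOpen_lt (XX_cont θ) continuous_const).measurableSet _ (HH_cont θ a) (hHn θ a) _
      (by linarith) (by rw [ht]; linarith)
  choose b hb using hb
  have bmono : ∀ θ a, StrictMono fun b => μ.real ({p | XX θ p < t θ} ∩ {p | HH θ a p < b}) := by
    intro θ a x y hxy
    obtain ⟨p, hp, hp'⟩ := pt_exists θ a (t θ - 1) ((x + y) / 2)
    refine real_lt (U := {p | XX θ p < t θ} ∩ ({p | x < HH θ a p} ∩ {p | HH θ a p < y}))
      (fun q hq => ⟨hq.1, lt_trans hq.2 hxy⟩) hpos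
      ((isOpen_lt (XX_cont θ) continuous_const).inter ((isOpen_lt continuous_const (HH_cont θ a)).inter
        (isOpen_lt (HH_cont θ a) continuous_const)))
      ⟨p, ?_, ?_, ?_⟩ (fun q hq => ⟨hq.1, hq.2.2⟩) ?_
    · simp only [Set.mem_ofPred_eq, hp]; linarith
    · simp only [Set.mem_ofPred_eq, hp']; linarith
    · simp only [Set.mem_ofPred_eq, hp']; linarith
    · rw [Set.disjoint_left]
      intro q hq hq'
      simp only [Set.mem_ofPred_eq, Set.mem_inter_iff] at hq hq'
      linarith [hq.2, hq'.2.1]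
  have bcont : Continuous fun z : ℝ × ℝ => b z.1 z.2 := by
    refine cont_root (fun (z : ℝ × ℝ) c => μ.real ({p | XX z.1 p < t z.1} ∩ {p | HH z.1 z.2 p < c}))
      _ (m / 6) (fun c => ?_) (fun z => bmono _ _) (fun z => hb _ _)
    have := cont_two (μ := μ) (Z := ℝ × ℝ) (fun z p => XX z.1 p - t z.1)
      (fun z p => HH z.1 z.2 p - c)
      (fun p => by unfold XX lf; fun_prop) (fun p => by unfold HH lf; fun_prop)
      (fun z => (XX_cont z.1).sub continuous_const) (fun z => (HH_cont z.1 z.2).sub continuous_const)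
      (fun z => by simpa [sub_eq_zero] using hXn z.1 (t z.1))
      (fun z => by simpa [sub_eq_zero] using hHn z.1 z.2 c)
    simpa using this
  -- separation
  have hsep : ∀ θ, t θ < - t (θ + Real.pi) := by
    intro θ
    by_contra hcon
    have h1 := ht θ
    have h2 := ht (θ + Real.pi)
    have h3 := split_real (μ := μ) Set.univ (XX θ) (XX_cont θ) (t θ) (hXn θ _)
    simp only [Set.univ_inter] at h3
    have h4 : μ.real {p | t θ < XX θ p} ≤ μ.real {p | XX (θ + Real.pi) p < t (θ + Real.pi)} := by
      refine measureReal_mono fun p hp => ?_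
      simp only [Set.mem_ofPred_eq, XX_pi] at *
      linarith
    linarith
  -- periodicity
  have tper : ∀ θ, t (θ + Real.pi + Real.pi) = t θ := by
    intro θ
    apply (tmono θ).injective
    have := ht (θ + Real.pi + Real.pi)
    simp only [XX_pi, neg_neg] at this
    simp only [this, ht]
  have bper : ∀ θ a, b (θ + Real.pi + Real.pi) a = b θ a := by
    intro θ a
    apply (bmono θ a).injective
    have := hb (θ + Real.pi + Real.pi) a
    simp only [XX_pi, HH_pi, neg_neg, tper] at this
    simp only [this, hb]
  have bineq : ∀ θ a h, 0 ≤ h → b θ a - h * t θ ≤ b θ (a + h) := by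
    intro θ a h hh
    rw [← (bmono θ (a + h)).le_iff_le]
    simp only [hb]
    rw [← hb θ a]
    refine measureReal_mono fun p hp => ?_
    obtain ⟨h1, h2⟩ := hp
    refine ⟨h1, ?_⟩
    simp only [Set.mem_ofPred_eq, HH_add] at *
    nlinarith [mul_le_mul_of_nonneg_left h1.le hh]
  let D : ℝ → ℝ → ℝ := fun θ a => b θ a + b (θ + Real.pi) a
  have Dineq : ∀ θ a h, 0 ≤ h → D θ a + h * (- t (θ + Real.pi) - t θ) ≤ D θ (a + h) := by
    intro θ a h hh
    have h1 := bineq θ a h hh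
    have h2 := bineq (θ + Real.pi) a h hh
    simp only [D]
    linarith
  have Dmono : ∀ θ, StrictMono (D θ) := by
    intro θ x y hxy
    have h1 := Dineq θ x (y - x) (by linarith)
    have h2 := mul_pos (sub_pos.2 hxy) (sub_pos.2 (hsep θ))
    rw [add_sub_cancel] at h1
    linarith
  have Dcont : Continuous fun z : ℝ × ℝ => D z.1 z.2 := by
    have := bcont.comp (by fun_prop : Continuous fun z : ℝ × ℝ => (z.1 + Real.pi, z.2))
    exact bcont.add this
  have hA : ∀ θ, ∃ a, D θ a = 0 := by
    intro θ
    have hδ := sub_pos.2 (hsep θ)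
    set δ := - t (θ + Real.pi) - t θ
    have hq : 0 ≤ |D θ 0| / δ := by positivity
    have hq' : |D θ 0| / δ * δ = |D θ 0| := by field_simp
    refine mem_range_of_exists_le_of_exists_ge (f := D θ)
      (Dcont.comp (by fun_prop : Continuous fun a : ℝ => (θ, a)))
      ⟨- (|D θ 0| / δ), ?_⟩ ⟨0 + |D θ 0| / δ, ?_⟩
    · have := Dineq θ (- (|D θ 0| / δ)) _ hq
      rw [neg_add_cancel, hq'] at this
      linarith [le_abs_self (D θ 0)]
    · have := Dineq θ 0 _ hq
      rw [hq'] at this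
      linarith [neg_abs_le (D θ 0)]
  choose A hA using hA
  have Acont : Continuous A := cont_root D A 0
    (fun a => Dcont.comp (by fun_prop : Continuous fun θ : ℝ => (θ, a))) Dmono hA
  have Aper : ∀ θ, A (θ + Real.pi) = A θ := by
    intro θ
    apply (Dmono θ).injective
    rw [hA θ, ← hA (θ + Real.pi)]
    simp only [D, bper]
    ring
  have hbb : ∀ θ, b (θ + Real.pi) (A θ) = - b θ (A θ) := by
    intro θ
    have := hA θ
    simp only [D] at this
    linarith
  let G : ℝ → ℝ := fun θ => μ.real {p | HH θ (A θ) p < b θ (A θ)}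
  have Gcont : Continuous G := by
    have hc : Continuous fun θ => b θ (A θ) := bcont.comp (by fun_prop : Continuous fun θ : ℝ => (θ, A θ))
    have := cont_two (μ := μ) (Z := ℝ) (fun θ p => HH θ (A θ) p - b θ (A θ))
      (fun θ p => HH θ (A θ) p - b θ (A θ))
      (fun p => by unfold HH lf; fun_prop) (fun p => by unfold HH lf; fun_prop)
      (fun z => (HH_cont z _).sub continuous_const) (fun z => (HH_cont z _).sub continuous_const)
      (fun z => by simpa [sub_eq_zero] using hHn z (A z) (b z (A z)))
      (fun z => by simpa [sub_eq_zero] using hHn z (A z) (b z (A z)))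
    simpa using this
  have hG : G 0 + G (0 + Real.pi) = m := by
    have h3 := split_real (μ := μ) Set.univ (HH 0 (A 0)) (HH_cont _ _) (b 0 (A 0)) (hHn _ _ _)
    simp only [Set.univ_inter] at h3
    rw [hm, h3]
    simp only [G, HH_pi, Aper, hbb, neg_lt_neg_iff]
  have hz : ∃ θ, G θ = m / 2 := by
    rcases le_total (G 0) (m / 2) with h | h
    · exact mem_range_of_exists_le_of_exists_ge Gcont ⟨0, h⟩ ⟨0 + Real.pi, by linarith⟩
    · exact mem_range_of_exists_le_of_exists_ge Gcont ⟨0 + Real.pi, by linarith⟩ ⟨0, h⟩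
  obtain ⟨θ, hθ⟩ := hz
  refine ⟨θ, A θ, t θ, - t (θ + Real.pi), b θ (A θ), hsep θ, ht θ, ?_, hθ, hb _ _, ?_,
    hXn θ, hHn θ _⟩
  · rw [← ht (θ + Real.pi)]
    congr 1; ext p
    simp only [Set.mem_ofPred_eq, XX_pi]
    exact neg_lt
  · rw [← hb (θ + Real.pi) (A θ)]
    congr 1; ext p
    simp only [Set.mem_ofPred_eq, Set.mem_inter_iff, XX_pi, HH_pi, hbb, neg_lt_neg_iff]
    rw [neg_lt]

end helpers

/-- Every mass distribution in the plane admits an equipartition into `6` boxes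
by two parallel lines and one additional line not parallel to them. -/
theorem equipartition_plane_six_boxes
    (μ : Measure (EuclideanSpace ℝ (Fin 2)))
    (f : EuclideanSpace ℝ (Fin 2) → ℝ) (hf : Integrable f)
    (hμ : ∀ A : Set (EuclideanSpace ℝ (Fin 2)), MeasurableSet A →
      μ A = ENNReal.ofReal (∫ x in A, f x))
    (hpos : ∀ U : Set (EuclideanSpace ℝ (Fin 2)), IsOpen U → U.Nonempty → 0 < μ U) :
    ∃ (u v : EuclideanSpace ℝ (Fin 2)) (t : ℕ → ℝ) (s : ℝ),
      ‖u‖ = 1 ∧ ‖v‖ = 1 ∧ v ≠ u ∧ v ≠ -u ∧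
      t 1 < t 2 ∧
      ∀ i ≤ 2, ∀ b : Bool,
        μ (slab u t 2 i ∩ halfSp v s b) = μ Set.univ / 6 := by
  have hfin : IsFiniteMeasure μ := ⟨by rw [hμ _ MeasurableSet.univ]; exact ENNReal.ofReal_lt_top⟩
  have hnull : ∀ m n c : ℝ, m ^ 2 + n ^ 2 ≠ 0 → μ {p | lf m n p = c} = 0 := by
    intro m n c h
    rw [hμ _ (isClosed_eq (lf_cont m n) continuous_const).measurableSet,
      setIntegral_measure_zero f (vol_line m n c h), ENNReal.ofReal_zero]
  obtain ⟨θ, a, t₁, t₂, b, htt, h1, h3, hQ, h1Q, h3Q, nX, nH⟩ := core hpos hnull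
  have cX := XX_cont θ
  have cH := HH_cont θ a
  set m := μ.real Set.univ with hm
  have e1 := split_real (μ := μ) {p | XX θ p < t₁} (HH θ a) cH b (nH b)
  have e3 := split_real (μ := μ) {p | t₂ < XX θ p} (HH θ a) cH b (nH b)
  have eU := split_real (μ := μ) Set.univ (HH θ a) cH b (nH b)
  simp only [Set.univ_inter] at eU
  have key : ∀ Q : Set E2, μ.real Q = μ.real ({p | XX θ p < t₁} ∩ Q) +
      μ.real ({p | t₁ < XX θ p ∧ XX θ p < t₂} ∩ Q) + μ.real ({p | t₂ < XX θ p} ∩ Q) := by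
    intro Q
    have e4 := split_real (μ := μ) Q (XX θ) cX t₁ (nX t₁)
    have e5 := split_real (μ := μ) (Q ∩ {p | t₁ < XX θ p}) (XX θ) cX t₂ (nX t₂)
    have s1 : Q ∩ {p | t₁ < XX θ p} ∩ {p | t₂ < XX θ p} = {p | t₂ < XX θ p} ∩ Q := by
      ext p
      simp only [Set.mem_ofPred_eq, Set.mem_inter_iff]
      exact ⟨fun h => ⟨h.2, h.1.1⟩, fun h => ⟨⟨h.2, htt.trans h.1⟩, h.1⟩⟩
    have s2 : Q ∩ {p | t₁ < XX θ p} ∩ {p | XX θ p < t₂} =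
        {p | t₁ < XX θ p ∧ XX θ p < t₂} ∩ Q := by
      ext p
      simp only [Set.mem_ofPred_eq, Set.mem_inter_iff]
      tauto
    rw [s1, s2] at e5
    rw [Set.inter_comm Q] at e4
    linarith
  have k1 := key {p | HH θ a p < b}
  have k2 := key {p | b < HH θ a p}
  have conv : ∀ S : Set E2, μ.real S = m / 6 → μ S = μ Set.univ / 6 := by
    intro S hS
    rw [← ENNReal.toReal_eq_toReal_iff' (measure_ne_top _ _)
      (ENNReal.div_ne_top (measure_ne_top _ _) (by norm_num)), ENNReal.toReal_div]
    simpa [Measure.real, hm] using hS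
  set r := Real.sqrt (1 + a ^ 2) with hr
  have r0 : 0 < r := Real.sqrt_pos.2 (by positivity)
  have r2 : r ^ 2 = 1 + a ^ 2 := Real.sq_sqrt (by positivity)
  have hsc := Real.sin_sq_add_cos_sq θ
  let u : E2 := !₂[Real.cos θ, Real.sin θ]
  let v : E2 := !₂[(-Real.sin θ - a * Real.cos θ) / r, (Real.cos θ - a * Real.sin θ) / r]
  have iu : ∀ x : E2, (inner ℝ x u : ℝ) = XX θ x := by
    intro x
    simp [u, XX, lf, PiLp.inner_apply, Fin.sum_univ_two]
  have iv : ∀ x : E2, (inner ℝ x v : ℝ) = HH θ a x / r := by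
    intro x
    simp [v, HH, lf, PiLp.inner_apply, Fin.sum_univ_two]
    ring
  have hv : ∀ ε : ℝ, v ≠ ε • u := by
    intro ε h
    have h0 := congrArg (fun w : E2 => w 0) h
    have h1 := congrArg (fun w : E2 => w 1) h
    simp [u, v] at h0 h1
    field_simp at h0 h1
    have : (1 : ℝ) = 0 := by
      linear_combination Real.cos θ * h1 - Real.sin θ * h0 - hsc
    norm_num at this
  refine ⟨u, v, fun i => if i = 1 then t₁ else t₂, b / r, ?_, ?_, ?_, ?_, ?_, ?_⟩
  · rw [EuclideanSpace.norm_eq]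
    simp [u, Fin.sum_univ_two]
  · rw [EuclideanSpace.norm_eq]
    simp only [v, Fin.sum_univ_two, Real.norm_eq_abs, sq_abs]
    rw [Real.sqrt_eq_one]
    simp
    field_simp
    rw [r2]
    linear_combination (1 + a ^ 2) * hsc
  · simpa using hv 1
  · simpa using hv (-1)
  · simpa using htt
  · have hb1 : halfSp v (b / r) true = {p | HH θ a p < b} := by
      ext p; simp [halfSp, iv, div_lt_div_iff_of_pos_right r0]
    have hb2 : halfSp v (b / r) false = {p | b < HH θ a p} := by
      ext p; simp [halfSp, iv, div_lt_div_iff_of_pos_right r0]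
    have hs0 : slab u (fun i => if i = 1 then t₁ else t₂) 2 0 = {p | XX θ p < t₁} := by
      ext p; simp [slab, iu]
    have hs1 : slab u (fun i => if i = 1 then t₁ else t₂) 2 1 =
        {p | t₁ < XX θ p ∧ XX θ p < t₂} := by
      ext p; simp [slab, iu]
    have hs2 : slab u (fun i => if i = 1 then t₁ else t₂) 2 2 = {p | t₂ < XX θ p} := by
      ext p; simp [slab, iu]
    intro i hi bb
    apply conv
    interval_cases i <;> cases bb <;> simp only [hb1, hb2, hs0, hs1, hs2] <;> linarith
end

section
/- For every integer d ≥ 1 and every mass distribution μ on ℝ^{d+1}, there exist a unit vector u ∈ ℝ^{d+1}, real numbers t_1 < t_2 < ... < t_{2d-1}, a unit vector v with v ≠ u and v ≠ -u, and a real number s, such that each of the 2·2d = 4d regions of the form {x : t_i < ⟨x,u⟩ < t_{i+1}} ∩ {x : ⟨x,v⟩ < s} and {x : t_i < ⟨x,u⟩ < t_{i+1}} ∩ {x : ⟨x,v⟩ > s} (for 0 ≤ i ≤ 2d-1, with t_0 = -∞ and t_{2d} = +∞) has μ-measure μ(ℝ^{d+1})/(4d). That is, every mass distribution in ℝ^{d+1}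 admits an equipartition into 4d boxes by a collection of 2d-1 parallel hyperplanes and one additional non-parallel hyperplane. -/
open MeasureTheory

namespace Equi

section Chains

variable {X : Type*}

/-- Coboundary of a cochain on ordered tuples. -/
def bd : (List X → ZMod 2) → List X → ZMod 2
  | _, [] => 0
  | φ, p :: τ => φ τ + bd (fun σ => φ (p :: σ)) τ

/-- Prism operator between the maps `A` and `B` (dualized). -/
def pr (A B : X → X) : (List X → ZMod 2) → List X → ZMod 2
  | _, [] => 0
  | φ, p :: τ => φ (A p :: B p :: τ.map B) + pr A B (fun σ => φ (A p :: σ)) τ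

lemma z2 (a : ZMod 2) : a + a = 0 := CharTwo.add_self_eq_zero a

lemma bd_add (φ ψ : List X → ZMod 2) (τ : List X) :
    bd (fun σ => φ σ + ψ σ) τ = bd φ τ + bd ψ τ := by
  induction τ generalizing φ ψ with
  | nil => simp [bd]
  | cons p τ ih => simp only [bd, ih]; ring

lemma bd_zero (τ : List X) : bd (fun _ => 0) τ = 0 := by
  induction τ with
  | nil => simp [bd]
  | cons p τ ih => simp only [bd, ih]; ring

lemma bd_mul (c : ZMod 2) (φ : List X → ZMod 2) (τ : List X) :
    bd (fun σ => c * φ σ) τ = c * bd φ τ := by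
  induction τ generalizing φ with
  | nil => simp [bd]
  | cons p τ ih => simp only [bd, ih]; ring

lemma pr_add (A B : X → X) (φ ψ : List X → ZMod 2) (τ : List X) :
    pr A B (fun σ => φ σ + ψ σ) τ = pr A B φ τ + pr A B ψ τ := by
  induction τ generalizing φ ψ with
  | nil => simp [pr]
  | cons p τ ih => simp only [pr, ih]; ring

lemma pr_zero (A B : X → X) (τ : List X) : pr A B (fun _ => 0) τ = 0 := by
  induction τ with
  | nil => simp [pr]
  | cons p τ ih => simp only [pr, ih]; ring

lemma bd_bd (φ : List X → ZMod 2) (τ : List X) : bd (bd φ) τ = 0 := by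
  induction τ generalizing φ with
  | nil => simp [bd]
  | cons p τ ih =>
    simp only [bd, bd_add, ih]
    rw [add_zero, z2]

lemma bd_map (B : X → X) (φ : List X → ZMod 2) (τ : List X) :
    bd φ (τ.map B) = bd (fun σ => φ (σ.map B)) τ := by
  induction τ generalizing φ with
  | nil => simp [bd]
  | cons p τ ih => simp only [bd, List.map_cons, ih]

lemma prism (A B : X → X) (φ : List X → ZMod 2) (τ : List X) :
    pr A B (bd φ) τ = bd (pr A B φ) τ + (φ (τ.map A) + φ (τ.map B)) := by
  induction τ generalizing φ with
  | nil => simp [bd, pr, z2]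
  | cons p τ ih =>
    simp only [bd, pr, bd_add, pr_add, ih, List.map_cons, bd_map]
    have h1 := z2 (bd (fun σ => φ (A p :: B p :: σ.map B)) τ)
    have h2 := z2 (φ (A p :: τ.map B))
    linear_combination h2

lemma pr_congr (A B : X → X) (φ ψ : List X → ZMod 2) (τ : List X)
    (h : ∀ σ, σ ⊆ τ.map A ++ τ.map B → φ σ = ψ σ) : pr A B φ τ = pr A B ψ τ := by
  induction τ generalizing φ ψ with
  | nil => simp [pr]
  | cons p τ ih =>
    simp only [pr]
    congr 1
    · apply h
      intro x hx
      simp only [List.mem_cons, List.map_cons, List.mem_append] at hx ⊢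
      tauto
    · apply ih
      intro σ hσ
      apply h
      intro x hx
      simp only [List.mem_cons, List.map_cons, List.mem_append] at hx ⊢
      rcases hx with hx | hx
      · tauto
      · have := hσ hx
        simp only [List.mem_append] at this
        tauto

lemma pr_map (A B g : X → X) (φ : List X → ZMod 2) (τ : List X) :
    pr A B φ (τ.map g) = pr (fun x => A (g x)) (fun x => B (g x)) φ τ := by
  induction τ generalizing φ with
  | nil => simp [pr]
  | cons p τ ih => simp only [pr, List.map_cons, ih, List.map_map]; rfl

lemma pr_comp (A B g : X → X) (φ : List X → ZMod 2) (τ : List X) :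
    pr A B (fun σ => φ (σ.map g)) τ = pr (fun x => g (A x)) (fun x => g (B x)) φ τ := by
  induction τ generalizing φ with
  | nil => simp [pr]
  | cons p τ ih =>
    simp only [pr, List.map_cons, List.map_map]
    rw [ih (fun σ => φ (g (A p) :: σ))]; rfl

/-- Sum of prisms over a subdivided interval with `2N` edges, each oriented from even to odd. -/
def PR (N : ℕ) (H : ℕ → X → X) (φ : List X → ZMod 2) (τ : List X) : ZMod 2 :=
  ∑ j ∈ Finset.range N,
    (pr (H (2 * j)) (H (2 * j + 1)) φ τ + pr (H (2 * j + 2)) (H (2 * j + 1)) φ τ)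

lemma PR_nil (N : ℕ) (H : ℕ → X → X) (φ : List X → ZMod 2) : PR N H φ [] = 0 := by
  simp [PR, pr]

lemma bd_sum (n : ℕ) (φ : ℕ → List X → ZMod 2) (τ : List X) :
    bd (fun σ => ∑ j ∈ Finset.range n, φ j σ) τ = ∑ j ∈ Finset.range n, bd (φ j) τ := by
  induction n with
  | zero => simp [bd_zero]
  | succ n ih => simp only [Finset.sum_range_succ, bd_add, ih]

lemma PR_bd (N : ℕ) (H : ℕ → X → X) (φ : List X → ZMod 2) (τ : List X) :
    PR N H (bd φ) τ = bd (PR N H φ) τ + (φ (τ.map (H 0)) + φ (τ.map (H (2 * N)))) := by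
  have e : PR N H φ = fun σ => ∑ j ∈ Finset.range N,
    (pr (H (2 * j)) (H (2 * j + 1)) φ σ + pr (H (2 * j + 2)) (H (2 * j + 1)) φ σ) := rfl
  rw [e, bd_sum]
  simp only [PR, prism, bd_add]
  induction N with
  | zero => simp [z2]
  | succ N ih =>
    simp only [Finset.sum_range_succ, ih rfl, show 2 * (N + 1) = 2 * N + 2 by ring]
    have h2 := z2 (φ (τ.map (H (2 * N))))
    have h3 := z2 (φ (τ.map (H (2 * N + 1))))
    linear_combination h2 + h3

lemma PR_add (N : ℕ) (H : ℕ → X → X) (φ ψ : List X → ZMod 2) (τ : List X) :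
    PR N H (fun σ => φ σ + ψ σ) τ = PR N H φ τ + PR N H ψ τ := by
  simp only [PR, pr_add, ← Finset.sum_add_distrib]
  exact Finset.sum_congr rfl fun _ _ => by ring

lemma PR_zero (N : ℕ) (H : ℕ → X → X) (τ : List X) :
    PR N H (fun _ => 0) τ = 0 := by
  simp [PR, pr_zero]

lemma PR_congr (N : ℕ) (H : ℕ → X → X) (φ ψ : List X → ZMod 2) (τ : List X)
    (h : ∀ m < 2 * N, ∀ σ, σ ⊆ τ.map (H m) ++ τ.map (H (m + 1)) → φ σ = ψ σ) :
    PR N H φ τ = PR N H ψ τ := by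
  unfold PR
  refine Finset.sum_congr rfl fun j hj => ?_
  rw [Finset.mem_range] at hj
  congr 1
  · exact pr_congr _ _ _ _ _ (h (2 * j) (by omega))
  · refine pr_congr _ _ _ _ _ fun σ hσ => h (2 * j + 1) (by omega) σ fun x hx => ?_
    have := hσ hx
    simp only [List.mem_append] at this ⊢
    tauto

lemma PR_symm (N : ℕ) (H : ℕ → X → X) (g : X → X)
    (hg : ∀ m ≤ 2 * N, ∀ x, H m (g x) = H (2 * N - m) x)
    (φ : List X → ZMod 2) (τ : List X) : PR N H φ (τ.map g) = PR N H φ τ := by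
  unfold PR
  rw [← Finset.sum_range_reflect]
  refine Finset.sum_congr rfl fun j hj => ?_
  rw [Finset.mem_range] at hj
  rw [pr_map, pr_map, add_comm]
  have e1 : (fun x => H (2 * (N - 1 - j)) (g x)) = H (2 * j + 2) := by
    funext x; rw [hg _ (by omega)]; congr 1; omega
  have e2 : (fun x => H (2 * (N - 1 - j) + 1) (g x)) = H (2 * j + 1) := by
    funext x; rw [hg _ (by omega)]; congr 1; omega
  have e3 : (fun x => H (2 * (N - 1 - j) + 2) (g x)) = H (2 * j) := by
    funext x; rw [hg _ (by omega)]; congr 1; omega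
  rw [e1, e2, e3]

lemma PR_comm (N : ℕ) (H : ℕ → X → X) (g : X → X)
    (hg : ∀ m x, H m (g x) = g (H m x))
    (φ : List X → ZMod 2) (τ : List X) :
    PR N H φ (τ.map g) = PR N H (fun σ => φ (σ.map g)) τ := by
  unfold PR
  refine Finset.sum_congr rfl fun j hj => ?_
  simp only [pr_map, pr_comp, hg]

/-- The iterated chain. -/
def Phi (N : ℕ) (H : ℕ → ℕ → X → X) (p0 : X) : ℕ → (List X → ZMod 2) → ZMod 2
  | 0, φ => φ [p0]
  | k + 1, φ => Phi N H p0 k (PR N (H k) φ)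

lemma Phi_add (N : ℕ) (H : ℕ → ℕ → X → X) (p0 : X) (k : ℕ) (φ ψ : List X → ZMod 2) :
    Phi N H p0 k (fun σ => φ σ + ψ σ) = Phi N H p0 k φ + Phi N H p0 k ψ := by
  induction k generalizing φ ψ with
  | zero => rfl
  | succ k ih =>
    simp only [Phi]
    rw [← ih]; congr 1; funext τ; exact PR_add _ _ _ _ _

lemma Phi_zero (N : ℕ) (H : ℕ → ℕ → X → X) (p0 : X) (k : ℕ) :
    Phi N H p0 k (fun _ => 0) = 0 := by
  induction k with
  | zero => rfl
  | succ k ih =>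
    have e : PR N (H k) (fun _ => 0) = fun _ => 0 := funext (PR_zero N (H k))
    simp only [Phi, e, ih]

/-- Iterated cup product of the coboundaries of `s (k-1), …, s 0`. -/
def W (s : ℕ → X → ZMod 2) : ℕ → List X → ZMod 2
  | 0, [_] => 1
  | 0, _ => 0
  | k + 1, p :: q :: τ => (s k p + s k q) * W s k (q :: τ)
  | _ + 1, _ => 0

/-- `s k` cup the product. -/
def V (s : ℕ → X → ZMod 2) (k : ℕ) : List X → ZMod 2
  | [] => 0
  | p :: τ => s k p * W s k (p :: τ)

lemma bd_W_zero (s : ℕ → X → ZMod 2) (τ : List X) : bd (W s 0) τ = 0 := by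
  match τ with
  | [] => rfl
  | [p] => simp [bd, W]
  | [p, q] => simp [bd, W]; rfl
  | p :: q :: r :: τ =>
    simp only [bd, W]
    rw [bd_zero]; ring

lemma W_nil (s : ℕ → X → ZMod 2) (k : ℕ) : W s k [] = 0 := by
  cases k <;> rfl

lemma bd_V_of (s : ℕ → X → ZMod 2) (k : ℕ) (h : ∀ τ, bd (W s k) τ = 0) (τ : List X) :
    bd (V s k) τ = W s (k + 1) τ := by
  match τ with
  | [] => rfl
  | [p] => simp [bd, V, W]
  | p :: q :: τ =>
    have h1 := h (p :: q :: τ)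
    have e : bd (V s k) (p :: q :: τ) = V s k (q :: τ) +
      bd (fun σ => s k p * W s k (p :: σ)) (q :: τ) := rfl
    have e2 : bd (W s k) (p :: q :: τ) = W s k (q :: τ) +
      bd (fun σ => W s k (p :: σ)) (q :: τ) := rfl
    rw [e, bd_mul]
    rw [e2] at h1
    simp only [V, W]
    have h2 := z2 (s k p * W s k (q :: τ))
    linear_combination s k p * h1 - h2

lemma bd_W (s : ℕ → X → ZMod 2) (k : ℕ) (τ : List X) : bd (W s k) τ = 0 := by
  induction k generalizing τ with
  | zero => exact bd_W_zero s τ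
  | succ k ih =>
    have : W s (k + 1) = bd (V s k) := by
      funext τ; exact (bd_V_of s k ih τ).symm
    rw [this, bd_bd]

lemma bd_V (s : ℕ → X → ZMod 2) (k : ℕ) : bd (V s k) = W s (k + 1) := by
  funext τ; exact bd_V_of s k (bd_W s k) τ

lemma W_map (s : ℕ → X → ZMod 2) (g : X → X) (k : ℕ) (τ : List X)
    (h : ∀ j < k, ∃ c, ∀ p ∈ τ, s j (g p) = s j p + c) :
    W s k (τ.map g) = W s k τ := by
  induction k generalizing τ with
  | zero => match τ with
    | [] => rfl
    | [p] => rfl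
    | p :: q :: τ => rfl
  | succ k ih => match τ with
    | [] => rfl
    | [p] => rfl
    | p :: q :: τ =>
      have := ih (q :: τ) (fun j hj => by
        obtain ⟨c, hc⟩ := h j (by omega)
        exact ⟨c, fun p hp => hc p (List.mem_cons_of_mem _ hp)⟩)
      obtain ⟨c, hc⟩ := h k (by omega)
      simp only [List.map_cons, W] at this ⊢
      rw [this, hc p (by simp), hc q (by simp)]
      have := z2 c
      linear_combination W s k (q :: τ) * this

lemma W_eq_zero (s : ℕ → X → ZMod 2) (k j : ℕ) (hj : j < k) (τ : List X)
    (h : ∀ p ∈ τ, ∀ q ∈ τ, s j p = s j q) : W s k τ = 0 := by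
  induction k generalizing τ with
  | zero => omega
  | succ k ih => match τ with
    | [] => rfl
    | [p] => rfl
    | p :: q :: τ =>
      simp only [W]
      rcases Nat.lt_succ_iff_lt_or_eq.1 hj with hj | rfl
      · rw [ih hj (q :: τ) (fun p hp r hr => h p (List.mem_cons_of_mem _ hp) r
          (List.mem_cons_of_mem _ hr)), mul_zero]
      · rw [h p (by simp) q (by simp), z2, zero_mul]

/-- The combinatorial core. -/
theorem core (d N : ℕ) (H : ℕ → ℕ → X → X) (p0 : X) (a b : X → X)
    (P : ℕ → List X → Prop) (S : Set X)
    (hP0 : P 0 [p0])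
    (hPsub : ∀ k τ σ, P k τ → σ ⊆ τ → P k σ)
    (hPS : ∀ k ≤ 2 * d, ∀ τ, P k τ → ∀ p ∈ τ, p ∈ S)
    (hP1 : ∀ k τ, P k τ → P (k + 1) τ)
    (hP : ∀ k < 2 * d, ∀ m < 2 * N, ∀ τ, P k τ →
      P (k + 1) (τ.map (H k m) ++ τ.map (H k (m + 1))))
    (hH0 : ∀ k x, H k 0 x = x)
    (hHa : ∀ k < d, ∀ x, H k (2 * N) x = a x)
    (hHb : ∀ k, d ≤ k → ∀ x, H k (2 * N) x = b x)
    (hsa : ∀ k < d, ∀ m ≤ 2 * N, ∀ x, H k m (a x) = H k (2 * N - m) x)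
    (hsb : ∀ k, d ≤ k → ∀ m ≤ 2 * N, ∀ x, H k m (b x) = H k (2 * N - m) x)
    (hca : ∀ k, d ≤ k → ∀ m x, H k m (a x) = a (H k m x))
    (s : ℕ → X → ZMod 2)
    (hxa : ∀ k < d, ∀ x ∈ S, s k (a x) = s k x + 1)
    (hxb : ∀ k < d, ∀ x ∈ S, s k (b x) = s k x + 1)
    (hya : ∀ k < 2 * d, d ≤ k → ∀ x ∈ S, s k (a x) = s k x)
    (hyb : ∀ k < 2 * d, d ≤ k → ∀ x ∈ S, s k (b x) = s k x + 1) :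
    ∃ τ, P (2 * d) τ ∧ ∀ k < 2 * d, ∃ p ∈ τ, ∃ q ∈ τ, s k p ≠ s k q := by
  have congr : ∀ k ≤ 2 * d, ∀ φ ψ : List X → ZMod 2, (∀ τ, P k τ → φ τ = ψ τ) →
      Phi N H p0 k φ = Phi N H p0 k ψ := by
    intro k
    induction k with
    | zero => intro _ φ ψ h; exact h _ hP0
    | succ k ih =>
      intro hk φ ψ h
      refine ih (by omega) _ _ fun τ hτ => PR_congr _ _ _ _ _ fun m hm σ hσ => h _ ?_
      exact hPsub _ _ _ (hP k (by omega) m hm τ hτ) hσ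
  have PRa : ∀ k < 2 * d, ∀ φ : List X → ZMod 2,
      (d ≤ k → ∀ τ, P (k + 1) τ → φ (τ.map a) = φ τ) →
      ∀ τ, P k τ → PR N (H k) φ (τ.map a) = PR N (H k) φ τ := by
    intro k hk φ h τ hτ
    rcases lt_or_ge k d with hkd | hkd
    · exact PR_symm _ _ _ (hsa k hkd) _ _
    · rw [PR_comm _ _ _ (hca k hkd)]
      refine PR_congr _ _ _ _ _ fun m hm σ hσ => h hkd _ ?_
      exact hPsub _ _ _ (hP k (by omega) m hm τ hτ) hσ
  have key : ∀ k < 2 * d, ∀ φ : List X → ZMod 2,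
      Phi N H p0 (k + 1) (bd φ) = Phi N H p0 k (bd (PR N (H k) φ)) +
        Phi N H p0 k (fun τ => φ τ + φ (τ.map (H k (2 * N)))) := by
    intro k hk φ
    rw [← Phi_add]
    simp only [Phi]
    congr 1
    funext τ
    rw [PR_bd]
    have : τ.map (H k 0) = τ := by
      conv_rhs => rw [← List.map_id τ]
      exact List.map_congr_left fun x _ => hH0 k x
    rw [this]
  have cyc : ∀ k ≤ 2 * d, ∀ φ : List X → ZMod 2, φ [] = 0 →
      (∀ τ, P k τ → φ (τ.map a) = φ τ) → (d < k → ∀ τ, P k τ → φ (τ.map b) = φ τ) →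
      Phi N H p0 k (bd φ) = 0 := by
    intro k
    induction k with
    | zero => intro _ φ h0 _ _; simp [Phi, bd, h0]
    | succ k ih =>
      intro hk φ h0 ha hb
      rw [key k (by omega)]
      have h1 : Phi N H p0 k (bd (PR N (H k) φ)) = 0 := by
        refine ih (by omega) _ (PR_nil _ _ _) (PRa k (by omega) φ fun _ => ha) ?_
        intro hdk τ _
        exact PR_symm _ _ _ (hsb k hdk.le) _ _
      rw [h1, zero_add, ← Phi_zero N H p0 k]
      refine congr k (by omega) _ _ fun τ hτ => ?_
      rcases lt_or_ge k d with hkd | hkd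
      · rw [show H k (2 * N) = a from funext (hHa k hkd), ha τ (hP1 _ _ hτ), z2]
      · rw [show H k (2 * N) = b from funext (hHb k hkd), hb (by omega) τ (hP1 _ _ hτ), z2]
  have Vadd : ∀ k < 2 * d, ∀ g : X → X, ∀ τ, P k τ → (∀ x ∈ S, s k (g x) = s k x + 1) →
      (∀ j < k, ∃ c, ∀ p ∈ τ, s j (g p) = s j p + c) →
      V s k τ + V s k (τ.map g) = W s k τ := by
    intro k hk g τ hτ hg hW
    have hw := W_map s g k τ hW
    match τ with
    | [] => simp [V, W_nil]
    | p :: τ =>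
      simp only [List.map_cons, V] at hw ⊢
      rw [hw, hg p (hPS k (by omega) _ hτ p (by simp))]
      have := z2 (s k p * W s k (p :: τ))
      linear_combination this
  have main : ∀ k ≤ 2 * d, Phi N H p0 k (W s k) = 1 := by
    intro k
    induction k with
    | zero => intro _; rfl
    | succ k ih =>
      intro hk
      rw [← bd_V, key k (by omega)]
      have h1 : Phi N H p0 k (bd (PR N (H k) (V s k))) = 0 := by
        refine cyc k (by omega) _ (PR_nil _ _ _) (PRa k (by omega) _ ?_) ?_
        · intro hdk τ hτ
          have hw := W_map s a k τ (fun j hj => by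
            rcases lt_or_ge j d with hjd | hjd
            · exact ⟨1, fun p hp => hxa j hjd p (hPS _ hk τ hτ p hp)⟩
            · exact ⟨0, fun p hp => by
                rw [hya j (by omega) hjd p (hPS _ hk τ hτ p hp), add_zero]⟩)
          match τ with
          | [] => rfl
          | p :: τ =>
            simp only [List.map_cons, V] at hw ⊢
            rw [hw, hya k (by omega) hdk p (hPS _ hk _ hτ p (by simp))]
        · intro hdk τ _
          exact PR_symm _ _ _ (hsb k hdk.le) _ _
      rw [h1, zero_add, ← ih (by omega)]
      refine congr k (by omega) _ _ fun τ hτ => ?_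
      rcases lt_or_ge k d with hkd | hkd
      · rw [show H k (2 * N) = a from funext (hHa k hkd)]
        exact Vadd k (by omega) a τ hτ (hxa k hkd) fun j hj =>
          ⟨1, fun p hp => hxa j (by omega) p (hPS k (by omega) τ hτ p hp)⟩
      · rw [show H k (2 * N) = b from funext (hHb k hkd)]
        refine Vadd k (by omega) b τ hτ (hyb k (by omega) hkd) fun j hj => ⟨1, fun p hp => ?_⟩
        rcases lt_or_ge j d with hjd | hjd
        · exact hxb j hjd p (hPS k (by omega) τ hτ p hp)
        · exact hyb j (by omega) hjd p (hPS k (by omega) τ hτ p hp)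
  by_contra hcon
  push Not at hcon
  have h1 := main (2 * d) le_rfl
  rw [congr (2 * d) le_rfl (W s (2 * d)) (fun _ => 0) ?_, Phi_zero] at h1
  · exact zero_ne_one h1
  · intro τ hτ
    obtain ⟨k, hk, h⟩ := hcon τ hτ
    exact W_eq_zero s (2 * d) k hk τ h

end Chains

section Sphere

variable {d : ℕ}

local notation "𝔼" => EuclideanSpace ℝ (Fin (d + 1))

/-- Basis vectors indexed by `ℕ`. -/
noncomputable def ev (d j : ℕ) : EuclideanSpace ℝ (Fin (d + 1)) :=
  if h : j < d + 1 then EuclideanSpace.single ⟨j, h⟩ 1 else 0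

/-- Rotation towards `e_j`. -/
noncomputable def rot (d N j m : ℕ) (y : EuclideanSpace ℝ (Fin (d + 1))) :
    EuclideanSpace ℝ (Fin (d + 1)) :=
  Real.cos (Real.pi * m / (2 * N)) • y + Real.sin (Real.pi * m / (2 * N)) • ev d j

/-- The `j`-dimensional subsphere. -/
def sub (d j : ℕ) : Set (EuclideanSpace ℝ (Fin (d + 1))) :=
  {y | ‖y‖ = 1 ∧ ∀ i : Fin (d + 1), j < i → y i = 0}

lemma ev_norm {j : ℕ} (h : j ≤ d) : ‖ev d j‖ = 1 := by
  rw [ev, dif_pos (by omega)]; simp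

lemma ev_norm_le (j : ℕ) : ‖ev d j‖ ≤ 1 := by
  by_cases h : j ≤ d
  · exact (ev_norm h).le
  · rw [ev, dif_neg (by omega)]; simp

lemma sub_mono {j : ℕ} {y : 𝔼} (h : y ∈ sub d j) : y ∈ sub d (j + 1) :=
  ⟨h.1, fun i hi => h.2 i (by omega)⟩

lemma ev_mem_sub : ev d 0 ∈ sub d 0 := by
  refine ⟨ev_norm (by omega), fun i hi => ?_⟩
  rw [ev, dif_pos (by omega)]
  have : i ≠ 0 := by rintro rfl; simp at hi
  simp [this]

lemma rot_mem {N j m : ℕ} {y : 𝔼} (h : y ∈ sub d j) (hj : j + 1 ≤ d) :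
    rot d N (j + 1) m y ∈ sub d (j + 1) := by
  obtain ⟨h1, h2⟩ := h
  have hin : inner ℝ y (ev d (j + 1)) = 0 := by
    rw [ev, dif_pos (by omega), EuclideanSpace.inner_single_right]
    simp [h2 ⟨j + 1, by omega⟩ (by simp)]
  constructor
  · have : ‖rot d N (j + 1) m y‖ ^ 2 = 1 := by
      rw [rot, norm_add_sq_real, inner_smul_left, inner_smul_right, hin, norm_smul, norm_smul, h1,
        ev_norm hj]
      simp
    have h0 := norm_nonneg (rot d N (j + 1) m y)
    nlinarith
  · intro i hi
    have h3 : (ev d (j + 1)) i = 0 := by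
      rw [ev, dif_pos (by omega)]
      have : i ≠ ⟨j + 1, by omega⟩ := by intro h; rw [h] at hi; simp at hi
      simp [this]
    simp [rot, h3, h2 i (by omega)]

lemma rot_zero (N j : ℕ) (y : 𝔼) : rot d N j 0 y = y := by simp [rot]

lemma rot_end {N : ℕ} (hN : 0 < N) (j : ℕ) (y : 𝔼) : rot d N j (2 * N) y = -y := by
  have : Real.pi * ((2 * N : ℕ) : ℝ) / (2 * N) = Real.pi := by
    have : (N : ℝ) ≠ 0 := by positivity
    push_cast; field_simp
  simp only [rot, this]; simp

lemma rot_neg {N : ℕ} (hN : 0 < N) (j m : ℕ) (hm : m ≤ 2 * N) (y : 𝔼) :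
    rot d N j m (-y) = rot d N j (2 * N - m) y := by
  have : Real.pi * ((2 * N - m : ℕ) : ℝ) / (2 * N) = Real.pi - Real.pi * m / (2 * N) := by
    have : (N : ℝ) ≠ 0 := by positivity
    push_cast [hm]; field_simp
  simp only [rot, this, Real.cos_pi_sub, Real.sin_pi_sub, smul_neg, neg_smul]

lemma rot_dist {N : ℕ} (hN : 0 < N) (j m m' : ℕ) (hm : |(m : ℝ) - m'| ≤ 1) (y y' : 𝔼)
    (hy' : ‖y'‖ = 1) :
    dist (rot d N j m y) (rot d N j m' y') ≤ dist y y' + Real.pi / N := by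
  set θ := Real.pi * m / (2 * N) with hθ
  set θ' := Real.pi * m' / (2 * N) with hθ'
  have hN' : (0 : ℝ) < N := by positivity
  have h1 : |θ - θ'| ≤ Real.pi / (2 * N) := by
    have : θ - θ' = Real.pi / (2 * N) * ((m : ℝ) - m') := by rw [hθ, hθ']; ring
    rw [this, abs_mul, abs_of_pos (by positivity)]
    exact mul_le_of_le_one_right (by positivity) hm
  have e : rot d N j m y - rot d N j m' y' =
      Real.cos θ • (y - y') + ((Real.cos θ - Real.cos θ') • y' +
        (Real.sin θ - Real.sin θ') • ev d j) := by
    simp only [rot, ← hθ, ← hθ', smul_sub, sub_smul]; abel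
  have hc : |Real.cos θ - Real.cos θ'| ≤ |θ - θ'| := by
    simpa [Real.dist_eq] using Real.lipschitzWith_cos.dist_le_mul θ θ'
  have hs : |Real.sin θ - Real.sin θ'| ≤ |θ - θ'| := by
    simpa [Real.dist_eq] using Real.lipschitzWith_sin.dist_le_mul θ θ'
  rw [dist_eq_norm, dist_eq_norm, e]
  have t1 : ‖Real.cos θ • (y - y')‖ ≤ ‖y - y'‖ := by
    rw [norm_smul]
    exact mul_le_of_le_one_left (norm_nonneg _) (Real.abs_cos_le_one θ)
  have t2 : ‖(Real.cos θ - Real.cos θ') • y'‖ ≤ Real.pi / (2 * N) := by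
    rw [norm_smul, hy', mul_one]; exact hc.trans h1
  have t3 : ‖(Real.sin θ - Real.sin θ') • ev d j‖ ≤ Real.pi / (2 * N) := by
    rw [norm_smul]
    exact (mul_le_of_le_one_right (norm_nonneg _) (ev_norm_le j)).trans (hs.trans h1)
  have t4 : Real.pi / N = Real.pi / (2 * N) + Real.pi / (2 * N) := by field_simp; ring
  calc _ ≤ _ := norm_add_le _ _
    _ ≤ _ + (_ + _) := add_le_add_right (norm_add_le _ _) _
    _ ≤ _ := by rw [t4]; gcongr

/-- An antisymmetric sign. -/
lemma exists_sgn : ∃ σ : 𝔼 → ZMod 2, ∀ y, y ≠ 0 → σ (-y) = σ y + 1 := by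
  classical
  refine ⟨fun y => if WellOrderingRel y (-y) then 0 else 1, fun y hy => ?_⟩
  have hne : y ≠ -y := fun h => hy (by
    have h2 : (2 : ℝ) • y = 0 := by rw [two_smul]; nth_rewrite 2 [h]; simp
    simpa using h2)
  have htri := trichotomous_of (WellOrderingRel (α := 𝔼)) y (-y)
  simp only [neg_neg]
  by_cases h : WellOrderingRel y (-y)
  · have h' : ¬ WellOrderingRel (-y) y := fun h' => asymm_of WellOrderingRel h h'
    simp [h, h']
  · have h' : WellOrderingRel (-y) y := by tauto
    simp only [h, h', if_true, if_false]; decide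

/-- The sequence of homotopies. -/
noncomputable def Hm (d N k m : ℕ) (p : EuclideanSpace ℝ (Fin (d + 1)) × EuclideanSpace ℝ (Fin (d + 1))) :
    EuclideanSpace ℝ (Fin (d + 1)) × EuclideanSpace ℝ (Fin (d + 1)) :=
  if k < d then (rot d N (k + 1) m p.1, p.2) else (p.1, rot d N (k - d + 1) m p.2)

lemma Hm_dist {N : ℕ} (hN : 0 < N) (k m m' : ℕ) (hm : |(m : ℝ) - m'| ≤ 1) (p q : 𝔼 × 𝔼)
    (hq1 : ‖q.1‖ = 1) (hq2 : ‖q.2‖ = 1) :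
    dist (Hm d N k m p) (Hm d N k m' q) ≤ dist p q + Real.pi / N := by
  have h0 : 0 ≤ Real.pi / N := by positivity
  unfold Hm
  split_ifs
  · rw [Prod.dist_eq, Prod.dist_eq]
    have := rot_dist hN (k + 1) m m' hm p.1 q.1 hq1
    apply max_le
    · exact this.trans (by gcongr; exact le_max_left _ _)
    · exact le_add_of_le_of_nonneg (le_max_right _ _) h0
  · rw [Prod.dist_eq, Prod.dist_eq]
    have := rot_dist hN (k - d + 1) m m' hm p.2 q.2 hq2
    apply max_le
    · exact le_add_of_le_of_nonneg (le_max_left _ _) h0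
    · exact this.trans (by gcongr; exact le_max_right _ _)

/-- Admissible lists at stage `k`. -/
def Adm (d N k : ℕ)
    (τ : List (EuclideanSpace ℝ (Fin (d + 1)) × EuclideanSpace ℝ (Fin (d + 1)))) : Prop :=
  (∀ p ∈ τ, p.1 ∈ sub d (min k d) ∧ p.2 ∈ sub d (k - d)) ∧
    ∀ p ∈ τ, ∀ q ∈ τ, dist p q ≤ k * (Real.pi / N)

lemma Hm_mem {N : ℕ} (k : ℕ) (hk : k < 2 * d) (m : ℕ) (p : 𝔼 × 𝔼) (h1 : p.1 ∈ sub d (min k d))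
    (h2 : p.2 ∈ sub d (k - d)) :
    (Hm d N k m p).1 ∈ sub d (min (k + 1) d) ∧ (Hm d N k m p).2 ∈ sub d (k + 1 - d) := by
  unfold Hm
  split_ifs with hkd
  · rw [min_eq_left hkd.le] at h1
    rw [min_eq_left (by omega : k + 1 ≤ d), show k + 1 - d = k - d by omega]
    exact ⟨rot_mem h1 (by omega), h2⟩
  · rw [min_eq_right (by omega)] at h1 ⊢
    rw [show k + 1 - d = k - d + 1 by omega]
    exact ⟨h1, rot_mem h2 (by omega)⟩

lemma Adm_succ {N k : ℕ} {τ : List (𝔼 × 𝔼)} (h : Adm d N k τ) : Adm d N (k + 1) τ := by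
  refine ⟨fun p hp => ⟨?_, ?_⟩, fun p hp q hq => (h.2 p hp q hq).trans (by gcongr; simp)⟩
  · have := (h.1 p hp).1
    rcases lt_or_ge k d with hkd | hkd
    · rw [min_eq_left hkd.le] at this
      rw [min_eq_left (by omega : k + 1 ≤ d)]
      exact sub_mono this
    · rwa [min_eq_right (by omega)] at this ⊢
  · have := (h.1 p hp).2
    rcases lt_or_ge k d with hkd | hkd
    · rwa [show k + 1 - d = k - d by omega]
    · rw [show k + 1 - d = k - d + 1 by omega]; exact sub_mono this

lemma Adm_step {N : ℕ} (hN : 0 < N) (k : ℕ) (hk : k < 2 * d) (m : ℕ) (τ : List (𝔼 × 𝔼))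
    (h : Adm d N k τ) :
    Adm d N (k + 1) (τ.map (Hm d N k m) ++ τ.map (Hm d N k (m + 1))) := by
  have key : ∀ x ∈ τ.map (Hm d N k m) ++ τ.map (Hm d N k (m + 1)),
      ∃ p ∈ τ, ∃ n : ℕ, (n = m ∨ n = m + 1) ∧ x = Hm d N k n p := by
    intro x hx
    simp only [List.mem_append, List.mem_map] at hx
    rcases hx with ⟨q, hq, rfl⟩ | ⟨q, hq, rfl⟩
    · exact ⟨q, hq, m, Or.inl rfl, rfl⟩
    · exact ⟨q, hq, m + 1, Or.inr rfl, rfl⟩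
  refine ⟨?_, ?_⟩
  · intro x hx
    obtain ⟨q, hq, n, -, rfl⟩ := key x hx
    exact Hm_mem k hk n q (h.1 q hq).1 (h.1 q hq).2
  · intro x hx y hy
    obtain ⟨p, hp, n, hn, rfl⟩ := key x hx
    obtain ⟨q, hq, n', hn', rfl⟩ := key y hy
    have habs : |(n : ℝ) - n'| ≤ 1 := by
      rcases hn with rfl | rfl <;> rcases hn' with rfl | rfl <;> push_cast <;> simp
    have h1 := Hm_dist hN k n n' habs p q (h.1 q hq).1.1 (h.1 q hq).2.1
    have h2 := h.2 p hp q hq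
    push_cast
    rw [add_mul, one_mul]
    linarith

lemma core_sphere {N : ℕ} (hN : 0 < N) (s : ℕ → 𝔼 × 𝔼 → ZMod 2)
    (hxa : ∀ k < d, ∀ x y : 𝔼, ‖x‖ = 1 → ‖y‖ = 1 → s k (-x, y) = s k (x, y) + 1)
    (hya : ∀ k < 2 * d, d ≤ k → ∀ x y : 𝔼, ‖x‖ = 1 → ‖y‖ = 1 → s k (-x, y) = s k (x, y))
    (hb : ∀ k < 2 * d, ∀ x y : 𝔼, ‖x‖ = 1 → ‖y‖ = 1 → s k (x, -y) = s k (x, y) + 1) :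
    ∃ τ, Adm d N (2 * d) τ ∧ ∀ k < 2 * d, ∃ p ∈ τ, ∃ q ∈ τ, s k p ≠ s k q := by
  refine core d N (Hm d N) (ev d 0, ev d 0) (fun p => (-p.1, p.2))
    (fun p => (p.1, -p.2)) (Adm d N) {p | ‖p.1‖ = 1 ∧ ‖p.2‖ = 1} ?_ ?_ ?_ ?_ ?_ ?_ ?_ ?_ ?_ ?_ ?_
    s ?_ ?_ ?_ ?_
  · refine ⟨?_, ?_⟩
    · simp [ev_mem_sub]
    · simp
  · exact fun k τ σ h hs =>
      ⟨fun p hp => h.1 p (hs hp), fun p hp q hq => h.2 p (hs hp) q (hs hq)⟩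
  · exact fun k _ τ h p hp => ⟨(h.1 p hp).1.1, (h.1 p hp).2.1⟩
  · exact fun k τ h => Adm_succ h
  · exact fun k hk m _ τ h => Adm_step hN k hk m τ h
  · intro k x; unfold Hm; split_ifs <;> simp [rot_zero]
  · intro k hk x; simp only [Hm, if_pos hk, rot_end hN]
  · intro k hk x; simp only [Hm, if_neg hk.not_gt, rot_end hN]
  · intro k hk m hm x; simp only [Hm, if_pos hk, rot_neg hN _ m hm]
  · intro k hk m hm x; simp only [Hm, if_neg hk.not_gt, rot_neg hN _ m hm]
  · intro k hk m x; simp only [Hm, if_neg hk.not_gt]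
  · exact fun k hk x hx => hxa k hk _ _ hx.1 hx.2
  · exact fun k hk x hx => hb k (by omega) _ _ hx.1 hx.2
  · exact fun k hk hkd x hx => hya k hk hkd _ _ hx.1 hx.2
  · exact fun k hk _ x hx => hb k hk _ _ hx.1 hx.2

/-- The sign of a real number, with a tie-breaker. -/
noncomputable def sg (r : ℝ) (c : ZMod 2) : ZMod 2 := if r < 0 then 1 else if 0 < r then 0 else c

lemma sg_neg (r : ℝ) (c : ZMod 2) : sg (-r) (c + 1) = sg r c + 1 := by
  unfold sg
  rcases lt_trichotomy r 0 with h | h | h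
  · simp [h, h.le.not_gt]; decide
  · simp [h]
  · simp [h, h.le.not_gt]

lemma sg_close {r r' ε : ℝ} (h : ε ≤ |r|) (h' : |r' - r| < ε) (c c' : ZMod 2) :
    sg r' c' = sg r c := by
  have h1 := abs_lt.1 h'
  unfold sg
  rcases lt_or_ge r 0 with h0 | h0
  · rw [abs_of_neg h0] at h
    rw [if_pos h0, if_pos (by linarith)]
  · rw [abs_of_nonneg h0] at h
    have hr : 0 < r := by linarith
    have hr' : 0 < r' := by linarith
    rw [if_neg hr'.le.not_gt, if_neg hr.le.not_gt, if_pos hr, if_pos hr']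

/-- A Borsuk–Ulam type theorem for a product of two spheres. -/
theorem borsuk (f : ℕ → 𝔼 × 𝔼 → ℝ)
    (hc : ∀ k < 2 * d, ContinuousOn (f k) (Metric.sphere (0 : 𝔼) 1 ×ˢ Metric.sphere (0 : 𝔼) 1))
    (hxa : ∀ k < d, ∀ x y : 𝔼, ‖x‖ = 1 → ‖y‖ = 1 → f k (-x, y) = - f k (x, y))
    (hya : ∀ k < 2 * d, d ≤ k → ∀ x y : 𝔼, ‖x‖ = 1 → ‖y‖ = 1 → f k (-x, y) = f k (x, y))
    (hb : ∀ k < 2 * d, ∀ x y : 𝔼, ‖x‖ = 1 → ‖y‖ = 1 → f k (x, -y) = - f k (x, y)) :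
    ∃ x y : 𝔼, ‖x‖ = 1 ∧ ‖y‖ = 1 ∧ ∀ k < 2 * d, f k (x, y) = 0 := by
  by_contra hcon
  push Not at hcon
  obtain ⟨K, hK⟩ : ∃ K : Set (𝔼 × 𝔼), K = Metric.sphere (0 : 𝔼) 1 ×ˢ Metric.sphere (0 : 𝔼) 1 := ⟨_, rfl⟩
  rw [← hK] at hc
  have hKc : IsCompact K := hK ▸ (isCompact_sphere 0 1).prod (isCompact_sphere 0 1)
  have memK : ∀ p : 𝔼 × 𝔼, p ∈ K ↔ ‖p.1‖ = 1 ∧ ‖p.2‖ = 1 := by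
    intro p; simp [hK, Set.mem_prod]
  have hKne : K.Nonempty := by
    have h0 : ‖ev d 0‖ = 1 := ev_norm (Nat.zero_le d)
    refine ⟨(ev d 0, ev d 0), ?_⟩
    rw [memK]
    exact ⟨h0, h0⟩
  obtain ⟨F, hFdef⟩ : ∃ F : 𝔼 × 𝔼 → (Fin (2 * d) → ℝ), ∀ p k, F p k = f k p :=
    ⟨fun p k => f k p, fun _ _ => rfl⟩
  have hF : ContinuousOn F K := continuousOn_pi.2 fun k => by
    simp only [hFdef]; exact hc k k.2
  obtain ⟨pm, hpm, hmin⟩ := hKc.exists_isMinOn hKne hF.norm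
  have hε : 0 < ‖F pm‖ := by
    rw [norm_pos_iff]
    intro h0
    obtain ⟨k, hk, hne⟩ := hcon pm.1 pm.2 ((memK _).1 hpm).1 ((memK _).1 hpm).2
    have := hFdef pm ⟨k, hk⟩
    rw [h0] at this
    exact hne this.symm
  obtain ⟨ε, hεdef⟩ : ∃ ε, ε = ‖F pm‖ := ⟨_, rfl⟩
  rw [← hεdef] at hε
  obtain ⟨δ, hδ, hunif⟩ := Metric.uniformContinuousOn_iff.1
    (hKc.uniformContinuousOn_of_continuous hF) ε hε
  obtain ⟨N, hn⟩ := exists_nat_gt ((2 * d : ℕ) * Real.pi / δ)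
  have hNr : (0 : ℝ) < N := lt_of_le_of_lt (by positivity) hn
  have hN : 0 < N := by exact_mod_cast hNr
  have hη : (2 * d : ℕ) * (Real.pi / N) < δ := by
    rw [div_lt_iff₀ hδ] at hn
    rw [← mul_div_assoc, div_lt_iff₀ hNr]; linarith
  obtain ⟨σ, hσ⟩ := exists_sgn (d := d)
  have nz : ∀ x : 𝔼, ‖x‖ = 1 → x ≠ 0 := by
    intro x hx h; rw [h, norm_zero] at hx; exact zero_ne_one hx
  obtain ⟨s, hs⟩ : ∃ s : ℕ → 𝔼 × 𝔼 → ZMod 2, ∀ k p,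
      s k p = sg (f k p) (if k < d then σ p.1 + σ p.2 else σ p.2) := ⟨_, fun _ _ => rfl⟩
  obtain ⟨τ, hτ, hsep⟩ := core_sphere hN s
    (by
      intro k hk x y hx hy
      rw [hs, hs, hxa k hk x y hx hy, ← sg_neg]
      simp only [if_pos hk, hσ _ (nz _ hx)]
      congr 1; ring)
    (by
      intro k hk hkd x y hx hy
      rw [hs, hs, hya k hk hkd x y hx hy]
      simp only [if_neg hkd.not_gt])
    (by
      intro k hk x y hx hy
      rw [hs, hs, hb k hk x y hx hy, ← sg_neg]
      simp only [hσ _ (nz _ hy)]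
      congr 1; split_ifs <;> ring)
  have hτK : ∀ p ∈ τ, p ∈ K := fun p hp => (memK _).2 ⟨(hτ.1 p hp).1.1, (hτ.1 p hp).2.1⟩
  have hd0 : 0 < 2 * d := by
    obtain ⟨k, hk, -⟩ := hcon pm.1 pm.2 ((memK _).1 hpm).1 ((memK _).1 hpm).2
    omega
  obtain ⟨p, hp, -⟩ := hsep 0 hd0
  have hbig : ∃ k : Fin (2 * d), ε ≤ |f k p| := by
    by_contra hno
    push Not at hno
    have : ‖F p‖ < ε := (pi_norm_lt_iff hε).2 fun k => by rw [hFdef]; exact hno k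
    have h2 : ‖F pm‖ ≤ ‖F p‖ := hmin (hτK p hp)
    linarith
  obtain ⟨k, hk⟩ := hbig
  have hconst : ∀ q ∈ τ, s k q = s k p := by
    intro q hq
    have h1 := hunif q (hτK q hq) p (hτK p hp) ((hτ.2 q hq p hp).trans_lt hη)
    have h2 := (dist_pi_lt_iff hε).1 h1 k
    rw [Real.dist_eq, hFdef, hFdef] at h2
    rw [hs, hs]
    exact sg_close hk h2 _ _
  obtain ⟨q, hq, r, hr, hne⟩ := hsep k k.2
  exact hne ((hconst q hq).trans (hconst r hr).symm)

end Sphere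

section Mass

open Filter Topology

variable {d : ℕ}

local notation "𝔼" => EuclideanSpace ℝ (Fin (d + 1))

lemma hyper_null (μ : Measure 𝔼) (f : 𝔼 → ℝ)
    (hμ : ∀ A : Set 𝔼, MeasurableSet A → μ A = ENNReal.ofReal (∫ x in A, f x))
    (u : 𝔼) (t : ℝ) (hu : ‖u‖ = 1) : ∀ᵐ x ∂μ, inner ℝ x u ≠ t := by
  have hm : MeasurableSet {x : 𝔼 | inner ℝ x u = t} :=
    measurableSet_eq_fun (by fun_prop) (by fun_prop)
  have hin : ∀ x : 𝔼, x ∈ AffineSubspace.mk' (t • u) (ℝ ∙ u)ᗮ ↔ inner ℝ x u = t := by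
    intro x
    rw [AffineSubspace.mem_mk', Submodule.mem_orthogonal_singleton_iff_inner_left, vsub_eq_sub,
      inner_sub_left, inner_smul_left, real_inner_self_eq_norm_sq, hu]
    simp [sub_eq_zero]
  have hv : volume {x : 𝔼 | inner ℝ x u = t} = 0 := by
    have e : {x : 𝔼 | inner ℝ x u = t} = (AffineSubspace.mk' (t • u) (ℝ ∙ u)ᗮ : Set 𝔼) := by
      ext x; exact (hin x).symm
    rw [e]
    apply Measure.addHaar_affineSubspace
    intro htop
    have h1 : (t + 1) • u ∈ AffineSubspace.mk' (t • u) (ℝ ∙ u)ᗮ := by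
      rw [htop]; exact AffineSubspace.mem_top _ _ _
    rw [hin, inner_smul_left, real_inner_self_eq_norm_sq, hu] at h1
    simp at h1
  have : μ {x : 𝔼 | inner ℝ x u = t} = 0 := by
    rw [hμ _ hm, Measure.restrict_eq_zero.2 hv]; simp
  rw [ae_iff]
  simpa using this

lemma ev_lt {Y : Type*} {L : Filter Y} {a : Y → ℝ} {b : Y → ℝ} {a0 b0 : ℝ}
    (ha : Tendsto a L (𝓝 a0)) (hb : Tendsto b L (𝓝 b0)) (h : a0 ≠ b0) :
    ∀ᶠ y in L, (a y < b y ↔ a0 < b0) := by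
  rcases lt_or_gt_of_ne h with h | h
  · filter_upwards [ha.eventually_lt hb h] with y hy
    exact ⟨fun _ => h, fun _ => hy⟩
  · filter_upwards [hb.eventually_lt ha h] with y hy
    exact ⟨fun h' => absurd h' hy.le.not_gt, fun h' => absurd h' h.le.not_gt⟩

lemma tendsto_real {Y : Type*} {L : Filter Y} [L.IsCountablyGenerated]
    (μ : Measure 𝔼) [IsFiniteMeasure μ] {A : Set 𝔼}
    {As : Y → Set 𝔼} (hA : MeasurableSet A) (hAs : ∀ i, MeasurableSet (As i))
    (h : ∀ᵐ x ∂μ, ∀ᶠ i in L, x ∈ As i ↔ x ∈ A) :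
    Tendsto (fun i => μ.real (As i)) L (𝓝 (μ.real A)) :=
  (ENNReal.tendsto_toReal (measure_ne_top μ A)).comp
    (tendsto_measure_of_ae_tendsto_indicator_of_isFiniteMeasure L hA hAs h)

/-- Lower half space mass. -/
noncomputable def low (μ : Measure (EuclideanSpace ℝ (Fin (d + 1))))
    (u : EuclideanSpace ℝ (Fin (d + 1))) (t : ℝ) : ℝ :=
  μ.real {x | inner ℝ x u < t}

lemma meas_lt (u : 𝔼) (t : ℝ) : MeasurableSet {x : 𝔼 | inner ℝ x u < t} :=
  measurableSet_lt (by fun_prop) (by fun_prop)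

lemma meas_gt (u : 𝔼) (t : ℝ) : MeasurableSet {x : 𝔼 | t < inner ℝ x u} :=
  measurableSet_lt (by fun_prop) (by fun_prop)

lemma low_mono (μ : Measure 𝔼) [IsFiniteMeasure μ] (u : 𝔼) : Monotone (low μ u) := by
  intro t t' h
  exact measureReal_mono (fun x hx => lt_of_lt_of_le hx h)

lemma low_strict (μ : Measure 𝔼) [IsFiniteMeasure μ]
    (hpos : ∀ U : Set 𝔼, IsOpen U → U.Nonempty → 0 < μ U) (u : 𝔼) (hu : ‖u‖ = 1) :
    StrictMono (low μ u) := by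
  intro t t' h
  have ho : IsOpen {x : 𝔼 | t < inner ℝ x u ∧ inner ℝ x u < t'} := by
    have h1 : IsOpen {x : 𝔼 | t < inner ℝ x u} := isOpen_lt (by fun_prop) (by fun_prop)
    have h2 : IsOpen {x : 𝔼 | inner ℝ x u < t'} := isOpen_lt (by fun_prop) (by fun_prop)
    exact h1.inter h2
  have hne : {x : 𝔼 | t < inner ℝ x u ∧ inner ℝ x u < t'}.Nonempty := by
    refine ⟨((t + t') / 2) • u, ?_⟩
    rw [Set.mem_setOf_eq, inner_smul_left, real_inner_self_eq_norm_sq, hu]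
    simp only [RCLike.conj_to_real, one_pow, mul_one]
    constructor <;> linarith
  have h1 := hpos _ ho hne
  have h2 : 0 < μ.real {x : 𝔼 | t < inner ℝ x u ∧ inner ℝ x u < t'} :=
    ENNReal.toReal_pos h1.ne' (measure_ne_top _ _)
  have h3 : low μ u t + μ.real {x : 𝔼 | t < inner ℝ x u ∧ inner ℝ x u < t'} ≤ low μ u t' := by
    unfold low
    rw [← measureReal_union ?_ ho.measurableSet]
    · refine measureReal_mono ?_
      rintro x (hx | hx)
      · exact lt_trans hx h
      · exact hx.2
    · rw [Set.disjoint_left]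
      intro x hx hx'
      exact lt_asymm hx hx'.1
  linarith

lemma low_cont (μ : Measure 𝔼) [IsFiniteMeasure μ]
    (hnull : ∀ u : 𝔼, ∀ t, ‖u‖ = 1 → ∀ᵐ x ∂μ, inner ℝ x u ≠ t) (u : 𝔼) (t : ℝ) (hu : ‖u‖ = 1) :
    ContinuousAt (fun p : 𝔼 × ℝ => low μ p.1 p.2) (u, t) := by
  refine tendsto_real μ (meas_lt u t) (fun p => meas_lt p.1 p.2) ?_
  filter_upwards [hnull u t hu] with x hx
  refine ev_lt ?_ ?_ hx
  · exact ((continuous_const.inner continuous_fst).tendsto (u, t))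
  · exact (continuous_snd.tendsto (u, t))

lemma low_exists (μ : Measure 𝔼) [IsFiniteMeasure μ]
    (hnull : ∀ u : 𝔼, ∀ t, ‖u‖ = 1 → ∀ᵐ x ∂μ, inner ℝ x u ≠ t) (u : 𝔼) (hu : ‖u‖ = 1)
    (c : ℝ) (h0 : 0 < c) (h1 : c < μ.real Set.univ) : ∃ t, low μ u t = c := by
  have hcont : Continuous (low μ u) := by
    rw [continuous_iff_continuousAt]
    intro t
    exact (low_cont μ hnull u t hu).comp (f := fun t => (u, t)) (by fun_prop)
  have hbot : Tendsto (low μ u) atBot (𝓝 (μ.real ∅)) := by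
    refine tendsto_real μ MeasurableSet.empty (fun t => meas_lt u t) (ae_of_all _ fun x => ?_)
    filter_upwards [eventually_le_atBot (inner ℝ x u)] with t ht
    simp [ht]
  have htop : Tendsto (low μ u) atTop (𝓝 (μ.real Set.univ)) := by
    refine tendsto_real μ MeasurableSet.univ (fun t => meas_lt u t) (ae_of_all _ fun x => ?_)
    filter_upwards [eventually_gt_atTop (inner ℝ x u)] with t ht
    simp [ht]
  rw [measureReal_empty] at hbot
  obtain ⟨a, ha⟩ := (hbot.eventually_lt_const h0).exists
  obtain ⟨b, hb⟩ := (htop.eventually_const_lt h1).exists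
  exact mem_range_of_exists_le_of_exists_ge hcont ⟨a, ha.le⟩ ⟨b, hb.le⟩

lemma low_neg (μ : Measure 𝔼) [IsFiniteMeasure μ]
    (hnull : ∀ u : 𝔼, ∀ t, ‖u‖ = 1 → ∀ᵐ x ∂μ, inner ℝ x u ≠ t) (u : 𝔼) (t : ℝ) (hu : ‖u‖ = 1) :
    low μ (-u) (-t) = μ.real Set.univ - low μ u t := by
  unfold low
  rw [← measureReal_compl (meas_lt u t)]
  apply measureReal_congr
  filter_upwards [hnull u t hu] with x hx
  apply propext
  change inner ℝ x (-u) < -t ↔ ¬ (inner ℝ x u < t)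
  rw [inner_neg_right, neg_lt_neg_iff, not_lt]
  exact ⟨le_of_lt, fun h => lt_of_le_of_ne h hx.symm⟩

lemma meas_slab (u : 𝔼) (t : ℕ → ℝ) (n i : ℕ) : MeasurableSet (slab u t n i) := by
  have : slab u t n i = {x | 1 ≤ i → t i < (inner ℝ x u : ℝ)} ∩
      {x | i + 1 ≤ n → (inner ℝ x u : ℝ) < t (i + 1)} := rfl
  rw [this]
  refine MeasurableSet.inter ?_ ?_
  · by_cases h : 1 ≤ i
    · simpa [h] using meas_gt u (t i)
    · simp [h]
  · by_cases h : i + 1 ≤ n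
    · simpa [h] using meas_lt u (t (i + 1))
    · simp [h]

lemma meas_half (v : 𝔼) (s : ℝ) (b : Bool) : MeasurableSet (halfSp v s b) := by
  cases b
  · simpa [halfSp] using meas_gt v s
  · simpa [halfSp] using meas_lt v s

lemma half_neg (v : 𝔼) (b : Bool) : halfSp (-v) 0 b = halfSp v 0 (!b) := by
  cases b <;> ext x <;> simp [halfSp, inner_neg_right]

/-- Continuity of box masses. -/
lemma box_cont (μ : Measure 𝔼) [IsFiniteMeasure μ]
    (hnull : ∀ u : 𝔼, ∀ t, ‖u‖ = 1 → ∀ᵐ x ∂μ, inner ℝ x u ≠ t) (n i : ℕ) (T : 𝔼 → ℕ → ℝ)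
    (hT : ∀ j, 1 ≤ j → j ≤ n → ContinuousOn (fun u => T u j) (Metric.sphere (0 : 𝔼) 1))
    (hi : i ≤ n) (b : Bool) :
    ContinuousOn (fun p : 𝔼 × 𝔼 => μ.real (slab p.1 (T p.1) n i ∩ halfSp p.2 0 b))
      (Metric.sphere (0 : 𝔼) 1 ×ˢ Metric.sphere (0 : 𝔼) 1) := by
  rintro ⟨u, v⟩ ⟨hu, hv⟩
  have hu' : ‖u‖ = 1 := by simpa using hu
  have hv' : ‖v‖ = 1 := by simpa using hv
  refine tendsto_real μ ((meas_slab _ _ _ _).inter (meas_half _ _ _))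
    (fun p => (meas_slab _ _ _ _).inter (meas_half _ _ _)) ?_
  filter_upwards [hnull u (T u i) hu', hnull u (T u (i + 1)) hu', hnull v 0 hv'] with x h1 h2 h3
  set L := 𝓝[Metric.sphere (0 : 𝔼) 1 ×ˢ Metric.sphere (0 : 𝔼) 1] (u, v) with hL
  have tu : Tendsto (fun p : 𝔼 × 𝔼 => (inner ℝ x p.1 : ℝ)) L (𝓝 (inner ℝ x u)) :=
    ((continuous_const.inner continuous_fst).tendsto (u, v)).mono_left nhdsWithin_le_nhds
  have tv : Tendsto (fun p : 𝔼 × 𝔼 => (inner ℝ x p.2 : ℝ)) L (𝓝 (inner ℝ x v)) :=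
    ((continuous_const.inner continuous_snd).tendsto (u, v)).mono_left nhdsWithin_le_nhds
  have tT : ∀ j, 1 ≤ j → j ≤ n → Tendsto (fun p : 𝔼 × 𝔼 => T p.1 j) L (𝓝 (T u j)) := by
    intro j hj1 hj2
    exact ((hT j hj1 hj2).comp continuousOn_fst (fun p hp => hp.1)) (u, v) ⟨hu, hv⟩
  have E1 : ∀ᶠ p in L, ((1 ≤ i → T p.1 i < inner ℝ x p.1) ↔ (1 ≤ i → T u i < inner ℝ x u)) := by
    by_cases h : 1 ≤ i
    · filter_upwards [ev_lt (tT i h hi) tu h1.symm] with p hp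
      simp [h, hp]
    · simp [h]
  have E2 : ∀ᶠ p in L, ((i + 1 ≤ n → inner ℝ x p.1 < T p.1 (i + 1)) ↔
      (i + 1 ≤ n → inner ℝ x u < T u (i + 1))) := by
    by_cases h : i + 1 ≤ n
    · filter_upwards [ev_lt tu (tT (i + 1) (by omega) h) h2] with p hp
      simp [h, hp]
    · simp [h]
  have E3 : ∀ᶠ p in L, (x ∈ halfSp p.2 0 b ↔ x ∈ halfSp v 0 b) := by
    cases b
    · simpa [halfSp] using ev_lt tendsto_const_nhds tv h3.symm
    · simpa [halfSp] using ev_lt tv tendsto_const_nhds h3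
  filter_upwards [E1, E2, E3] with p e1 e2 e3
  exact and_congr (and_congr e1 e2) e3

theorem main (hd : 1 ≤ d) (μ : Measure 𝔼) [IsFiniteMeasure μ]
    (hnull : ∀ u : 𝔼, ∀ t, ‖u‖ = 1 → ∀ᵐ x ∂μ, inner ℝ x u ≠ t)
    (hpos : ∀ U : Set 𝔼, IsOpen U → U.Nonempty → 0 < μ U) :
    ∃ (u v : 𝔼) (t : ℕ → ℝ), ‖u‖ = 1 ∧ ‖v‖ = 1 ∧
      StrictMonoOn t (Set.Icc 1 (2 * d - 1)) ∧
      ∀ i ≤ 2 * d - 1, ∀ b : Bool,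
        μ.real (slab u t (2 * d - 1) i ∩ halfSp v 0 b) = μ.real Set.univ / (4 * d) := by
  obtain ⟨n, hn⟩ : ∃ n, n = 2 * d - 1 := ⟨_, rfl⟩
  rw [← hn]
  obtain ⟨m, hm⟩ : ∃ m, m = μ.real Set.univ := ⟨_, rfl⟩
  have hm0 : 0 < m := by
    rw [hm]
    exact ENNReal.toReal_pos (hpos _ isOpen_univ Set.univ_nonempty).ne' (measure_ne_top _ _)
  have hdr : (0 : ℝ) < d := by exact_mod_cast hd
  have hex : ∀ (u : 𝔼) (i : ℕ), ‖u‖ = 1 → 1 ≤ i → i ≤ n → ∃ t, low μ u t = i * m / (2 * d) := by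
    intro u i hu h1 h2
    have hi : (1 : ℝ) ≤ i := by exact_mod_cast h1
    have hi2 : (i : ℝ) < 2 * d := by
      have : i < 2 * d := by omega
      exact_mod_cast this
    refine low_exists μ hnull u hu _ (by positivity) ?_
    rw [← hm, div_lt_iff₀ (by positivity)]
    nlinarith
  choose! T hT using hex
  have hstrict := low_strict μ hpos
  have hmono : ∀ u : 𝔼, ‖u‖ = 1 → StrictMonoOn (T u) (Set.Icc 1 n) := by
    intro u hu i hi j hj hij
    rw [← (hstrict u hu).lt_iff_lt, hT u i hu hi.1 hi.2, hT u j hu hj.1 hj.2]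
    have : (i : ℝ) < j := by exact_mod_cast hij
    gcongr
  have hneg : ∀ u : 𝔼, ‖u‖ = 1 → ∀ i, 1 ≤ i → i ≤ n → T (-u) i = - T u (2 * d - i) := by
    intro u hu i h1 h2
    have hu' : ‖-u‖ = 1 := by rwa [norm_neg]
    apply (hstrict (-u) hu').injective
    rw [hT (-u) i hu' h1 h2, low_neg μ hnull u _ hu, hT u _ hu (by omega) (by omega), ← hm,
      Nat.cast_sub (by omega)]
    push_cast
    field_simp
    ring
  have hTc : ∀ j, 1 ≤ j → j ≤ n → ContinuousOn (fun u => T u j) (Metric.sphere (0 : 𝔼) 1) := by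
    intro j h1 h2 u hu
    have hu' : ‖u‖ = 1 := by simpa using hu
    have hlow : ∀ t, Tendsto (fun w => low μ w t) (𝓝[Metric.sphere (0 : 𝔼) 1] u)
        (𝓝 (low μ u t)) := fun t =>
      ((low_cont μ hnull u t hu').comp (f := fun w => (w, t)) (by fun_prop)).mono_left
        nhdsWithin_le_nhds
    rw [ContinuousWithinAt, tendsto_order]
    constructor
    · intro a ha
      have h3 : low μ u a < j * m / (2 * d) := by
        rw [← hT u j hu' h1 h2]; exact hstrict u hu' ha
      filter_upwards [(hlow a).eventually_lt_const h3, self_mem_nhdsWithin] with w hw hws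
      have hw' : ‖w‖ = 1 := by simpa using hws
      rw [← hT w j hw' h1 h2] at hw
      exact (hstrict w hw').lt_iff_lt.1 hw
    · intro a ha
      have h3 : j * m / (2 * d) < low μ u a := by
        rw [← hT u j hu' h1 h2]; exact hstrict u hu' ha
      filter_upwards [(hlow a).eventually_const_lt h3, self_mem_nhdsWithin] with w hw hws
      have hw' : ‖w‖ = 1 := by simpa using hws
      rw [← hT w j hw' h1 h2] at hw
      exact (hstrict w hw').lt_iff_lt.1 hw
  have hslabneg : ∀ u : 𝔼, ‖u‖ = 1 → ∀ i ≤ n, slab (-u) (T (-u)) n i = slab u (T u) n (n - i) := by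
    intro u hu i hi
    ext x
    simp only [slab, Set.mem_setOf_eq, inner_neg_right]
    rw [and_comm]
    apply and_congr
    · constructor
      · intro h h1
        have := h (by omega)
        rw [hneg u hu (i + 1) (by omega) (by omega), neg_lt_neg_iff,
          show 2 * d - (i + 1) = n - i by omega] at this
        exact this
      · intro h h1
        rw [hneg u hu (i + 1) (by omega) (by omega), neg_lt_neg_iff,
          show 2 * d - (i + 1) = n - i by omega]
        exact h (by omega)
    · constructor
      · intro h h1
        have := h (by omega)
        rw [hneg u hu i (by omega) (by omega), neg_lt_neg_iff,
          show 2 * d - i = n - i + 1 by omega] at this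
        exact this
      · intro h h1
        rw [hneg u hu i (by omega) (by omega), neg_lt_neg_iff,
          show 2 * d - i = n - i + 1 by omega]
        exact h (by omega)
  obtain ⟨G, hG⟩ : ∃ G : ℕ → 𝔼 × 𝔼 → ℝ, ∀ i, G i = fun p =>
      μ.real (slab p.1 (T p.1) n i ∩ halfSp p.2 0 true) -
      μ.real (slab p.1 (T p.1) n i ∩ halfSp p.2 0 false) := ⟨_, fun _ => rfl⟩
  have hGc : ∀ i ≤ n, ContinuousOn (G i) (Metric.sphere (0 : 𝔼) 1 ×ˢ Metric.sphere (0 : 𝔼) 1) := by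
    intro i hi
    rw [hG]
    exact (box_cont μ hnull n i T hTc hi true).sub (box_cont μ hnull n i T hTc hi false)
  have hGa : ∀ i ≤ n, ∀ x y : 𝔼, ‖x‖ = 1 → G i (-x, y) = G (n - i) (x, y) := by
    intro i hi x y hx
    simp only [hG, hslabneg x hx i hi]
  have hGb : ∀ i, ∀ x y : 𝔼, G i (x, -y) = - G i (x, y) := by
    intro i x y
    simp only [hG, half_neg]
    simp
  obtain ⟨u, v, hu, hv, hz⟩ := borsuk (d := d)
    (fun k p => if k < d then G k p - G (n - k) p else G (k - d) p + G (n - (k - d)) p)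
    (by
      intro k hk
      split_ifs with h
      · exact (hGc _ (by omega)).sub (hGc _ (by omega))
      · exact (hGc _ (by omega)).add (hGc _ (by omega)))
    (by
      intro k hk x y hx hy
      simp only [if_pos hk]
      rw [hGa k (by omega) x y hx, hGa (n - k) (by omega) x y hx, show n - (n - k) = k by omega]
      ring)
    (by
      intro k hk hkd x y hx hy
      simp only [if_neg hkd.not_gt]
      rw [hGa (k - d) (by omega) x y hx, hGa (n - (k - d)) (by omega) x y hx,
        show n - (n - (k - d)) = k - d by omega]
      ring)
    (by
      intro k hk x y hx hy
      split_ifs <;> simp only [hGb] <;> ring)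
  have hG0' : ∀ i < d, G i (u, v) = 0 ∧ G (n - i) (u, v) = 0 := by
    intro i hi
    have h1 := hz i (by omega)
    have h2 := hz (i + d) (by omega)
    simp only [if_pos hi] at h1
    simp only [if_neg (show ¬ (i + d < d) by omega), Nat.add_sub_cancel] at h2
    constructor <;> linarith
  have hG0 : ∀ i ≤ n, G i (u, v) = 0 := by
    intro i hi
    rcases lt_or_ge i d with h | h
    · exact (hG0' i h).1
    · have := (hG0' (n - i) (by omega)).2
      rwa [show n - (n - i) = i by omega] at this
  refine ⟨u, v, T u, hu, hv, hmono u hu, ?_⟩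
  obtain ⟨D, hD⟩ : ∃ D : ℕ → Set 𝔼, ∀ j, D j =
      if j = 0 then ∅ else {x | j ≤ n → inner ℝ x u < T u j} := ⟨_, fun _ => rfl⟩
  have hDm : ∀ j, MeasurableSet (D j) := by
    intro j
    rw [hD]
    split_ifs
    · exact MeasurableSet.empty
    · by_cases h : j ≤ n
      · simpa [h] using meas_lt u (T u j)
      · simp [h]
  have hDv : ∀ j ≤ 2 * d, μ.real (D j) = j * m / (2 * d) := by
    intro j hj
    rw [hD]
    split_ifs with h0
    · simp [h0]
    · by_cases h : j ≤ n
      · rw [← hT u j hu (by omega) h]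
        simp [h, low]
      · have : j = 2 * d := by omega
        have e : {x : 𝔼 | j ≤ n → inner ℝ x u < T u j} = Set.univ := by
          ext x
          simp [h]
        rw [e, ← hm, this]
        push_cast
        field_simp
  have hDsub : ∀ i ≤ n, D i ⊆ D (i + 1) := by
    intro i hi x hx
    rw [hD] at hx ⊢
    split_ifs at hx with h0
    · exact absurd hx (Set.notMem_empty x)
    · rw [if_neg (by omega)]
      intro h1
      exact (hx hi).trans (hmono u hu ⟨by omega, hi⟩ ⟨by omega, h1⟩ (by omega))
  have hslab : ∀ i ≤ n, μ.real (slab u (T u) n i) = m / (2 * d) := by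
    intro i hi
    have e : μ.real (slab u (T u) n i) = μ.real (D (i + 1) \ D i) := by
      apply measureReal_congr
      filter_upwards [hnull u (T u i) hu] with x hx
      apply propext
      change ((1 ≤ i → T u i < inner ℝ x u) ∧ (i + 1 ≤ n → inner ℝ x u < T u (i + 1))) ↔
        (x ∈ D (i + 1) ∧ x ∉ D i)
      rw [and_comm, hD, hD, if_neg (by omega)]
      apply and_congr
      · rfl
      · split_ifs with h0
        · simp [h0]
        · simp only [Set.mem_setOf_eq, hi, forall_const, not_lt,
            show 1 ≤ i by omega]
          exact ⟨le_of_lt, fun h => lt_of_le_of_ne h hx.symm⟩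
    rw [e, measureReal_diff (hDsub i hi) (hDm i), hDv _ (by omega), hDv _ (by omega)]
    push_cast
    field_simp
    ring
  intro i hi b
  have hsum : μ.real (slab u (T u) n i ∩ halfSp v 0 true) +
      μ.real (slab u (T u) n i ∩ halfSp v 0 false) = m / (2 * d) := by
    rw [← hslab i hi, ← measureReal_inter_add_sdiff (s := slab u (T u) n i) (meas_half v 0 true)]
    congr 1
    apply measureReal_congr
    filter_upwards [hnull v 0 hv] with x hx
    apply propext
    change (x ∈ slab u (T u) n i ∧ x ∈ halfSp v 0 false) ↔
      (x ∈ slab u (T u) n i ∧ x ∉ halfSp v 0 true)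
    simp only [halfSp, if_true, Bool.false_eq_true, if_false, Set.mem_setOf_eq, not_lt]
    exact and_congr Iff.rfl ⟨le_of_lt, fun h => lt_of_le_of_ne h hx.symm⟩
  have hdiff := hG0 i hi
  simp only [hG] at hdiff
  rw [← hm]
  have h4 : m / (4 * d) = m / (2 * d) / 2 := by field_simp; norm_num
  rw [h4]
  cases b <;> linarith

end Mass

end Equi

/-- Every mass distribution in `ℝ^(d+1)` admits an equipartition into `4d`
boxes by a collection of `2d - 1` parallel hyperplanes and one additional
non-parallel hyperplane. -/
theorem equipartition_parallel_odd (d : ℕ) (hd : 1 ≤ d)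
    (μ : Measure (EuclideanSpace ℝ (Fin (d + 1))))
    (f : EuclideanSpace ℝ (Fin (d + 1)) → ℝ) (hf : Integrable f)
    (hμ : ∀ A : Set (EuclideanSpace ℝ (Fin (d + 1))), MeasurableSet A →
      μ A = ENNReal.ofReal (∫ x in A, f x))
    (hpos : ∀ U : Set (EuclideanSpace ℝ (Fin (d + 1))), IsOpen U → U.Nonempty → 0 < μ U) :
    ∃ (u v : EuclideanSpace ℝ (Fin (d + 1))) (t : ℕ → ℝ) (s : ℝ),
      ‖u‖ = 1 ∧ ‖v‖ = 1 ∧ v ≠ u ∧ v ≠ -u ∧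
      StrictMonoOn t (Set.Icc 1 (2 * d - 1)) ∧
      ∀ i ≤ 2 * d - 1, ∀ b : Bool,
        μ (slab u t (2 * d - 1) i ∩ halfSp v s b) =
          μ Set.univ / ((4 * d : ℕ) : ENNReal) := by
  have : IsFiniteMeasure μ := ⟨by rw [hμ _ MeasurableSet.univ]; exact ENNReal.ofReal_lt_top⟩
  obtain ⟨u, v, t, hu, hv, ht, hbox⟩ :=
    Equi.main hd μ (Equi.hyper_null μ f hμ) hpos
  have hdr : (0 : ℝ) < d := by exact_mod_cast hd
  have hm0 : 0 < μ.real Set.univ :=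
    ENNReal.toReal_pos (hpos _ isOpen_univ Set.univ_nonempty).ne' (measure_ne_top _ _)
  have hne : ∀ i ≤ 2 * d - 1, ∀ b : Bool, ∃ x, x ∈ slab u t (2 * d - 1) i ∩ halfSp v 0 b := by
    intro i hi b
    by_contra hno
    push Not at hno
    have h1 := hbox i hi b
    rw [Set.eq_empty_of_forall_notMem hno, measureReal_empty] at h1
    have : 0 < μ.real Set.univ / (4 * d) := by positivity
    linarith
  have hcon : ∀ b : Bool, (∀ x, x ∈ halfSp v 0 b → 0 < inner ℝ x u) →
      (∀ x, x ∈ halfSp v 0 (!b) → inner ℝ x u < 0) → False := by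
    intro b h1 h2
    obtain ⟨x, hx, hxb⟩ := hne 0 (by omega) b
    obtain ⟨y, hy, hyb⟩ := hne (2 * d - 1) le_rfl (!b)
    have a1 := h1 x hxb
    have a2 := h2 y hyb
    have a3 := hx.2 (by omega)
    have a4 := hy.1 (by omega)
    have a5 : t (0 + 1) ≤ t (2 * d - 1) :=
      ht.monotoneOn ⟨by omega, by omega⟩ ⟨by omega, le_rfl⟩ (by omega)
    linarith
  refine ⟨u, v, t, 0, hu, hv, ?_, ?_, ht, ?_⟩
  · rintro rfl
    exact hcon false (fun x hx => by simpa [halfSp] using hx)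
      (fun x hx => by simpa [halfSp] using hx)
  · rintro rfl
    exact hcon true (fun x hx => by simpa [halfSp, inner_neg_right] using hx)
      (fun x hx => by simpa [halfSp, inner_neg_right] using hx)
  · intro i hi b
    have h1 := hbox i hi b
    have h2 : μ (slab u t (2 * d - 1) i ∩ halfSp v 0 b) =
        ENNReal.ofReal (μ.real (slab u t (2 * d - 1) i ∩ halfSp v 0 b)) :=
      (ENNReal.ofReal_toReal (measure_ne_top _ _)).symm
    have h3 : μ Set.univ = ENNReal.ofReal (μ.real Set.univ) :=
      (ENNReal.ofReal_toReal (measure_ne_top _ _)).symm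
    rw [h2, h1, ENNReal.ofReal_div_of_pos (by positivity), ← h3]
    congr 1
    rw [← ENNReal.ofReal_natCast]
    push_cast
    rfl
end
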